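/- arXiv:2504.21319 — 7 statements merged into one kernel-verified Lean document; each statement's English description precedes it below -/
import Mathlib

section
/- Let G be a finite simple connected graph on the vertex set {1,…,n} (n ≥ 2), let e = {i₀, j₀} be an edge of G, and fix a vertex r. Define the n×n matrix L_x over the polynomial ring ℤ[x] by: the (i,i)-entry is deg_{G∖e}(i) for i ∉ {i₀, j₀} and deg_{G∖e}(i) + x for i ∈ {i₀, j₀}; the (i,j)-entry for i ≠ j is −x if {i,j} = {i₀,j₀}, −1 if {i,j} is an edge of G different from e, and 0 otherwise. Let L̃_x be the (n−1)×(n−1) matrix obtained from L_x by deleting the row and column indexed by r. Then the coefficient of x in the polynomial det(L̃_x) equals the number of spanning trees of G that contain the edge e. -/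
open Polynomial

namespace MMT

variable {V : Type*} [Fintype V] [DecidableEq V] {r : V}

/-- A parent function is good if it strictly decreases some rank. -/
def Good (f : {i : V // i ≠ r} → V) : Prop :=
  ∃ d : V → ℕ, ∀ i : {i : V // i ≠ r}, d (f i) < d i

/-- The matrix of a parent function. -/
noncomputable def M (f : {i : V // i ≠ r} → V) :
    Matrix {i : V // i ≠ r} {i : V // i ≠ r} ℤ[X] :=
  fun i j => (if i = j then 1 else 0) - (if f i = j then 1 else 0)

lemma det_good (f : {i : V // i ≠ r} → V) (hf : Good f) : (M f).det = 1 := by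
  obtain ⟨d, hd⟩ := hf
  have hb : (M f).BlockTriangular (fun i => OrderDual.toDual (d i)) := by
    intro i j hij
    have hij' : d i < d j := by simpa using hij
    have h1 : i ≠ j := by rintro rfl; omega
    have h2 : f i ≠ j := by
      intro h
      have := hd i
      rw [h] at this; omega
    simp [M, h1, h2]
  rw [hb.det]
  apply Finset.prod_eq_one
  intro a _
  have : (M f).toSquareBlock (fun i => OrderDual.toDual (d i)) a = 1 := by
    ext1 i j
    have h2 : f i.1 ≠ j.1 := by
      intro h
      have h3 := hd i.1
      rw [h] at h3
      have h4 : d i.1 = d j.1 := OrderDual.toDual.injective (i.2.trans j.2.symm)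
      omega
    simp only [Matrix.toSquareBlock_def, Matrix.of_apply, M, h2, if_false, sub_zero,
      Matrix.one_apply, Subtype.ext_iff]
  rw [this, Matrix.det_one]

open Classical in
lemma det_bad (f : {i : V // i ≠ r} → V) (hf : ¬ Good f) : (M f).det = 0 := by
  let F : V → V := fun v => if h : v ≠ r then f ⟨v, h⟩ else r
  have hF : ∀ i : {i : V // i ≠ r}, F i = f i := fun i => by simp [F, i.2]
  have hFr : F r = r := by simp [F]
  let R : V → Prop := fun v => ∃ k, F^[k] v = r
  have hRr : R r := ⟨0, rfl⟩
  have hR : ∀ i : {i : V // i ≠ r}, R (f i) ↔ R i := by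
    intro i
    constructor
    · rintro ⟨k, hk⟩
      exact ⟨k + 1, by rw [Function.iterate_succ_apply, hF, hk]⟩
    · rintro ⟨k, hk⟩
      cases k with
      | zero => exact absurd hk i.2
      | succ k => exact ⟨k, by rwa [Function.iterate_succ_apply, hF] at hk⟩
  by_cases hall : ∀ v, R v
  · exfalso
    apply hf
    refine ⟨fun v => Nat.find (hall v), fun i => ?_⟩
    have h := Nat.find_spec (hall i)
    have h0 : Nat.find (hall i) ≠ 0 := by
      intro h0
      rw [h0] at h
      exact i.2 h
    obtain ⟨k, hk⟩ := Nat.exists_eq_succ_of_ne_zero h0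
    have : Nat.find (hall (f i)) ≤ k := by
      apply Nat.find_min'
      rw [hk, Nat.succ_eq_add_one, Function.iterate_succ_apply, hF] at h
      exact h
    show Nat.find (hall (f i)) < Nat.find (hall i)
    omega
  · push Not at hall
    obtain ⟨v, hv⟩ := hall
    have hvr : v ≠ r := by rintro rfl; exact hv hRr
    rw [← Matrix.exists_mulVec_eq_zero_iff]
    refine ⟨fun i => if R i then 0 else 1, ?_, ?_⟩
    · intro h
      have := congrFun h ⟨v, hvr⟩
      simp [hv] at this
    · ext1 i
      simp only [Matrix.mulVec, dotProduct, M, sub_mul, Finset.sum_sub_distrib, ite_mul,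
        one_mul, zero_mul, Finset.sum_ite_eq, Finset.mem_univ, if_true, Pi.zero_apply]
      by_cases hfr : f i = r
      · have : R i := (hR i).1 (hfr ▸ hRr)
        rw [if_pos this, zero_sub, neg_eq_zero]
        apply Finset.sum_eq_zero
        intro j _
        rw [if_neg]
        rw [hfr]; exact j.2.symm
      · rw [Finset.sum_eq_single ⟨f i, hfr⟩]
        · simp [hR i]
        · intro j _ hj
          rw [if_neg]
          rintro h
          exact hj (Subtype.ext h.symm)
        · simp

/-- The expansion of the determinant. -/
lemma det_expand (w : V → V → ℤ[X]) :
    Matrix.det (fun i j : {i : V // i ≠ r} =>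
      ∑ k, w i k * ((if i = j then 1 else 0) - (if k = j then 1 else 0))) =
    ∑ f : {i : V // i ≠ r} → V, (∏ i : {i : V // i ≠ r}, w i (f i)) * (M f).det := by
  have h := (Matrix.detRowAlternating (R := ℤ[X]) (n := {i : V // i ≠ r})).toMultilinearMap.map_sum
    (fun (i : {i : V // i ≠ r}) (k : V) => w i k • fun j : {i : V // i ≠ r} =>
      (((if i = j then 1 else 0) - (if k = j then 1 else 0) : ℤ[X])))
  simp only [MultilinearMap.map_smul_univ] at h
  convert h using 1
  · congr 1
    ext1 i j
    simp
  · rfl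

/-- The graph of a parent function. -/
def T (f : {i : V // i ≠ r} → V) : SimpleGraph V :=
  SimpleGraph.fromEdgeSet (Set.range fun i : {i : V // i ≠ r} => s((i : V), f i))

lemma T_adj (f : {i : V // i ≠ r} → V) (hf : Good f) (i : {i : V // i ≠ r}) :
    (T f).Adj i (f i) := by
  obtain ⟨d, hd⟩ := hf
  rw [T, SimpleGraph.fromEdgeSet_adj]
  refine ⟨⟨i, rfl⟩, fun h => ?_⟩
  have := hd i
  rw [← h] at this
  omega

lemma T_edge (f : {i : V // i ≠ r} → V) (hf : Good f) (e : Sym2 V) :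
    e ∈ (T f).edgeSet ↔ ∃ i : {i : V // i ≠ r}, s((i : V), f i) = e := by
  constructor
  · intro h
    rw [T, SimpleGraph.edgeSet_fromEdgeSet] at h
    exact h.1
  · rintro ⟨i, rfl⟩
    exact T_adj f hf i

lemma T_tree (f : {i : V // i ≠ r} → V) (hf : Good f) : (T f).IsTree := by
  have hc : (T f).Connected := by
    have hr : ∀ v, (T f).Reachable v r := by
      obtain ⟨d, hd⟩ := id hf
      intro v
      induction hk : d v using Nat.strong_induction_on generalizing v with
      | _ k ih =>
        by_cases hv : v = r
        · rw [hv]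
        · exact (T_adj f hf ⟨v, hv⟩).reachable.trans
            (ih _ (hk ▸ hd ⟨v, hv⟩) _ rfl)
    haveI : Nonempty V := ⟨r⟩
    exact ⟨fun u v => (hr u).trans (hr v).symm⟩
  rw [SimpleGraph.isTree_iff_connected_and_card]
  refine ⟨hc, le_antisymm ?_ hc.card_vert_le_card_edgeSet_add_one⟩
  have h1 : (T f).edgeSet ⊆ Set.range fun i : {i : V // i ≠ r} => s((i : V), f i) := by
    intro e he
    exact (T_edge f hf e).1 he
  have h2 := Nat.card_mono (Set.toFinite _) h1
  have h3 : Nat.card (Set.range fun i : {i : V // i ≠ r} => s((i : V), f i)) ≤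
    Nat.card {i : V // i ≠ r} := Finite.card_range_le _
  have h4 : Nat.card {i : V // i ≠ r} + 1 = Nat.card V := by
    have : 0 < Fintype.card V := Fintype.card_pos_iff.2 ⟨r⟩
    simp [Nat.card_eq_fintype_card, Fintype.card_subtype_compl]
    omega
  omega

lemma T_inj (f g : {i : V // i ≠ r} → V) (hf : Good f) (hg : Good g) (h : T f = T g) :
    f = g := by
  obtain ⟨d, hd⟩ := id hf
  have key : ∀ v (hv : v ≠ r), f ⟨v, hv⟩ = g ⟨v, hv⟩ := by
    intro v
    induction hk : d v using Nat.strong_induction_on generalizing v with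
    | _ k ih =>
      intro hv
      have h1 : s(v, f ⟨v, hv⟩) ∈ (T g).edgeSet := h ▸ T_adj f hf ⟨v, hv⟩
      obtain ⟨⟨j, hj⟩, hje⟩ := (T_edge g hg _).1 h1
      rcases Sym2.eq_iff.1 hje with ⟨h2, h3⟩ | ⟨h2, h3⟩
      · dsimp only at h2 h3
        subst h2
        exact h3.symm
      · dsimp only at h2 h3
        have hlt := hd ⟨v, hv⟩
        dsimp only at hlt
        rw [← h2] at hlt
        have h4 := ih (d j) (hk ▸ hlt) j rfl hj
        have h5 := hd ⟨j, hj⟩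
        rw [h4, h3] at h5
        dsimp only at h5
        omega
  ext1 i
  exact key i.1 i.2

lemma T_surj (H : SimpleGraph V) (hH : H.IsTree) :
    ∃ f : {i : V // i ≠ r} → V, Good f ∧ T f = H := by
  have hc := hH.1
  have : ∀ i : {i : V // i ≠ r}, ∃ v, H.Adj i v ∧ H.dist v r < H.dist i r := by
    rintro ⟨i, hi⟩
    obtain ⟨p, hp⟩ := (hc.preconnected i r).exists_walk_length_eq_dist
    cases p with
    | nil => exact absurd rfl hi
    | cons hadj q =>
      refine ⟨_, hadj, ?_⟩
      have := SimpleGraph.dist_le q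
      simp at hp
      dsimp only
      omega
  choose f hf using this
  have hg : Good f := ⟨fun v => H.dist v r, fun i => (hf i).2⟩
  refine ⟨f, hg, ?_⟩
  have hle : T f ≤ H := by
    rw [← SimpleGraph.edgeSet_subset_edgeSet]
    intro e he
    obtain ⟨i, rfl⟩ := (T_edge f hg e).1 he
    exact (hf i).1
  have h1 := (SimpleGraph.isTree_iff_connected_and_card.1 hH).2
  have h2 := (SimpleGraph.isTree_iff_connected_and_card.1 (T_tree f hg)).2
  rw [← SimpleGraph.edgeSet_inj]
  apply Set.eq_of_subset_of_ncard_le (SimpleGraph.edgeSet_subset_edgeSet.2 hle) _ (Set.toFinite _)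
  rw [← Nat.card_coe_set_eq, ← Nat.card_coe_set_eq]
  omega

/-- Edge weights. -/
noncomputable def W (G : SimpleGraph V) [DecidableRel G.Adj] (a b : V) (i k : V) : ℤ[X] :=
  if s(i, k) = s(a, b) then X else if G.Adj i k then 1 else 0

open Classical in
lemma term_coeff (G : SimpleGraph V) [DecidableRel G.Adj] (a b : V) (he : G.Adj a b)
    (f : {i : V // i ≠ r} → V) :
    ((∏ i : {i : V // i ≠ r}, W G a b i (f i)) * (M f).det).coeff 1 =
      if Good f ∧ T f ≤ G ∧ s(a, b) ∈ (T f).edgeSet then 1 else 0 := by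
  by_cases hf : Good f
  swap
  · simp [det_bad f hf, hf]
  rw [det_good f hf, mul_one]
  have hle : T f ≤ G ↔ ∀ i : {i : V // i ≠ r}, G.Adj i (f i) := by
    constructor
    · intro h i
      exact h (T_adj f hf i)
    · intro h
      rw [← SimpleGraph.edgeSet_subset_edgeSet]
      intro e he
      obtain ⟨i, rfl⟩ := (T_edge f hf e).1 he
      exact h i
  by_cases hG : T f ≤ G
  swap
  · have := mt hle.2 hG
    push Not at this
    obtain ⟨i, hi⟩ := this
    rw [Finset.prod_eq_zero (Finset.mem_univ i)]
    · simp [hG]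
    · have : s((i : V), f i) ≠ s(a, b) := by
        intro h
        apply hi
        rw [← SimpleGraph.mem_edgeSet, h]
        exact he
      simp [W, this, hi]
  have hW : ∀ i : {i : V // i ≠ r}, W G a b i (f i) =
      if s((i : V), f i) = s(a, b) then X else 1 := by
    intro i
    simp [W, hle.1 hG i]
  simp only [hW, hf, hG, true_and, T_edge f hf]
  by_cases hex : ∃ i : {i : V // i ≠ r}, s((i : V), f i) = s(a, b)
  · obtain ⟨i, hi⟩ := id hex
    rw [if_pos hex, Finset.prod_eq_single i]
    · simp [hi]
    · intro j _ hj
      rw [if_neg]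
      intro h
      rw [← hi, Sym2.eq_iff] at h
      rcases h with ⟨h1, _⟩ | ⟨h1, h2⟩
      · exact hj (Subtype.ext h1)
      · obtain ⟨d, hd⟩ := hf
        have h3 := hd i
        have h4 := hd j
        rw [h2] at h4
        rw [← h1] at h3
        omega
    · simp
  · rw [if_neg hex]
    push Not at hex
    simp [hex, Polynomial.coeff_one]

lemma entry (G : SimpleGraph V) [DecidableRel G.Adj] (a b : V) (he : G.Adj a b)
    (i j : {i : V // i ≠ r}) :
    (if (i : V) = j then
          (((G.deleteEdges {s(a, b)}).neighborSet i).ncard : Polynomial ℤ) +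
            (if (i : V) = a ∨ (i : V) = b then Polynomial.X else 0)
        else
          if s((i : V), (j : V)) = s(a, b) then -Polynomial.X
          else if G.Adj i j then -1 else 0) =
      ∑ k, W G a b i k * ((if i = j then 1 else 0) - (if k = j then 1 else 0)) := by
  classical
  have hab := he.ne
  simp only [mul_sub, Finset.sum_sub_distrib, mul_ite, mul_one, mul_zero, Finset.sum_ite_eq',
    Finset.mem_univ, if_true]
  by_cases hij : i = j
  · subst hij
    have h0 : W G a b i i = 0 := by
      have : s((i : V), (i : V)) ≠ s(a, b) := by
        intro h
        rcases Sym2.eq_iff.1 h with ⟨h1, h2⟩ | ⟨h1, h2⟩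
        · exact hab (h1.symm.trans h2)
        · exact hab (h2.symm.trans h1)
      simp [W, this]
    have h1 : ∀ k, W G a b i k = (if (G.deleteEdges {s(a, b)}).Adj i k then 1 else 0) +
        (if s((i : V), k) = s(a, b) then X else 0) := by
      intro k
      simp only [W, SimpleGraph.deleteEdges_adj, Set.mem_singleton_iff]
      split_ifs <;> simp_all
    simp only [if_true, h0, sub_zero]
    simp only [h1, Finset.sum_add_distrib]
    congr 1
    · rw [Finset.sum_boole]
      congr 1
      rw [← Set.ncard_coe_finset]
      congr 1
      ext k
      simp
    · by_cases hia : (i : V) = a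
      · have : ∀ k, s((i : V), k) = s(a, b) ↔ k = b := by
          intro k; rw [hia]; simp [hab]
        simp only [this]
        simp [hia]
      · by_cases hib : (i : V) = b
        · have : ∀ k, s((i : V), k) = s(a, b) ↔ k = a := by
            intro k; rw [hib, Sym2.eq_swap (a := a)]; simp [hab.symm]
          simp only [this]
          simp [hib]
        · have : ∀ k, s((i : V), k) ≠ s(a, b) := by
            intro k h
            rcases Sym2.eq_iff.1 h with ⟨h1, h2⟩ | ⟨h1, h2⟩
            · exact hia h1
            · exact hib h1
          simp [this, hia, hib]
  · have hij' : (i : V) ≠ j := fun h => hij (Subtype.ext h)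
    simp only [hij, hij', if_false, Finset.sum_const_zero, zero_sub, W]
    split_ifs <;> simp

end MMT

/-- Modified matrix tree theorem: the coefficient of `x` in the determinant of the
reduced weighted Laplacian (with the edge `e = {i₀, j₀}` given weight `x`) equals
the number of spanning trees of `G` containing `e`. -/
theorem modified_matrix_tree_theorem (n : ℕ) (hn : 2 ≤ n)
    (G : SimpleGraph (Fin n)) [DecidableRel G.Adj] (hG : G.Connected)
    (i₀ j₀ : Fin n) (he : G.Adj i₀ j₀) (r : Fin n) :
    ((Matrix.det ((Matrix.of fun i j : Fin n =>
        if i = j then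
          (((G.deleteEdges {s(i₀, j₀)}).neighborSet i).ncard : Polynomial ℤ) +
            (if i = i₀ ∨ i = j₀ then Polynomial.X else 0)
        else
          if s(i, j) = s(i₀, j₀) then -Polynomial.X
          else if G.Adj i j then -1 else 0).submatrix
        (fun i : {i : Fin n // i ≠ r} => (i : Fin n))
        (fun j : {j : Fin n // j ≠ r} => (j : Fin n)))).coeff 1) =
      (Nat.card {H : SimpleGraph (Fin n) //
        H ≤ G ∧ H.IsTree ∧ s(i₀, j₀) ∈ H.edgeSet} : ℤ) := by
  classical
  have hmat : ((Matrix.of fun i j : Fin n =>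
        if i = j then
          (((G.deleteEdges {s(i₀, j₀)}).neighborSet i).ncard : Polynomial ℤ) +
            (if i = i₀ ∨ i = j₀ then Polynomial.X else 0)
        else
          if s(i, j) = s(i₀, j₀) then -Polynomial.X
          else if G.Adj i j then -1 else 0).submatrix
        (fun i : {i : Fin n // i ≠ r} => (i : Fin n))
        (fun j : {j : Fin n // j ≠ r} => (j : Fin n))) =
      (fun i j : {i : Fin n // i ≠ r} =>
      ∑ k, MMT.W G i₀ j₀ i k * ((if i = j then 1 else 0) - (if k = j then 1 else 0))) := by
    ext1 i j
    exact MMT.entry G i₀ j₀ he i j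
  rw [hmat, MMT.det_expand, Polynomial.finsetSum_coeff]
  simp only [MMT.term_coeff G i₀ j₀ he]
  rw [Finset.sum_boole, ← Fintype.card_subtype, ← Nat.card_eq_fintype_card]
  congr 1
  refine Nat.card_congr (Equiv.ofBijective (fun f => ⟨MMT.T f.1, f.2.2.1,
    MMT.T_tree f.1 f.2.1, f.2.2.2⟩) ⟨?_, ?_⟩)
  · intro f g hfg
    exact Subtype.ext (MMT.T_inj _ _ f.2.1 g.2.1 (congrArg Subtype.val hfg))
  · rintro ⟨H, hH, ht, hm⟩
    obtain ⟨f, hf, rfl⟩ := MMT.T_surj (r := r) H ht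
    exact ⟨⟨f, hf, hH, hm⟩, rfl⟩
end

section
/- For n ≥ 2, the number of pairs (T, r), where T is a spanning tree of the complete graph K_n and r ∈ {1,…,n} is a vertex such that every neighbor of r in T is smaller than r (i.e., the total number of uprooted spanning trees of K_n over all roots), equals (n−1)^{n−1}. -/
open Finset

section helpers

variable {V : Type*} [Fintype V] [DecidableEq V]

/-- Forests on `U` with root set `R`, encoded as parent functions. -/
noncomputable def forestFns (U R : Finset V) : Finset (V → V) := by
  classical
  exact univ.filter (fun f => (∀ v, v ∉ U \ R → f v = v) ∧ (∀ v ∈ U \ R, f v ∈ U) ∧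
    ∀ v ∈ U, ∃ k : ℕ, f^[k] v ∈ R)

theorem mem_forestFns {U R : Finset V} {f : V → V} : f ∈ forestFns U R ↔
    (∀ v, v ∉ U \ R → f v = v) ∧ (∀ v ∈ U \ R, f v ∈ U) ∧
    ∀ v ∈ U, ∃ k : ℕ, f^[k] v ∈ R := by
  simp [forestFns]

theorem forestFns_fiber (U R J : Finset V) (hR : R ⊆ U) (hJ : J ⊆ U \ R) :
    #{f ∈ forestFns U R | {v ∈ U \ R | f v ∈ R} = J} =
      #R ^ #J * #(forestFns (U \ R) J) := by
  have h1 : #(Fintype.piFinset (fun v => if v ∈ J then R else {v})) = #R ^ #J := by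
    rw [Fintype.card_piFinset]
    have : ∀ v, #(if v ∈ J then R else {v}) = if v ∈ J then #R else 1 := by
      intro v; split_ifs <;> simp
    simp [this]
  rw [← h1, ← card_product]
  refine Finset.card_nbij' (fun f => (fun v => if v ∈ J then f v else v,
    fun v => if v ∈ J then v else f v)) (fun p v => if v ∈ J then p.1 v else p.2 v) ?_ ?_ ?_ ?_
  · intro f hf
    simp only [coe_filter, Set.mem_ofPred_eq, mem_forestFns] at hf
    obtain ⟨⟨ha, hb, hc⟩, hd⟩ := hf
    have hd' : ∀ v, v ∈ J ↔ v ∈ U \ R ∧ f v ∈ R := by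
      intro v; rw [← hd]; simp
    simp only [coe_product, Set.mem_prod, mem_coe, Fintype.mem_piFinset, mem_forestFns]
    refine ⟨?_, ?_, ?_, ?_⟩
    · intro v
      by_cases hv : v ∈ J
      · simp only [hv, if_true]; exact ((hd' v).1 hv).2
      · simp [hv]
    · intro v hv
      by_cases hvJ : v ∈ J
      · simp [hvJ]
      · simp only [hvJ, if_false]
        apply ha
        intro h; exact hv (mem_sdiff.2 ⟨h, hvJ⟩)
    · intro v hv
      obtain ⟨h1, h2⟩ := mem_sdiff.1 hv
      simp only [h2, if_false]
      refine mem_sdiff.2 ⟨hb v h1, fun h => h2 ((hd' v).2 ⟨h1, h⟩)⟩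
    · intro v hv
      obtain ⟨k, hk⟩ := hc v (mem_sdiff.1 hv).1
      induction k generalizing v with
      | zero => exact absurd hk (mem_sdiff.1 hv).2
      | succ k ih =>
        by_cases hvJ : v ∈ J
        · exact ⟨0, hvJ⟩
        · have h3 : f v ∈ U \ R := mem_sdiff.2 ⟨hb v hv, fun h => hvJ ((hd' v).2 ⟨hv, h⟩)⟩
          obtain ⟨l, hl⟩ := ih (f v) h3 hk
          refine ⟨l + 1, ?_⟩
          rw [Function.iterate_succ_apply]
          simpa only [hvJ, if_false] using hl
  · rintro ⟨g, h⟩ hp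
    simp only [coe_product, Set.mem_prod, mem_coe, Fintype.mem_piFinset, mem_forestFns] at hp
    obtain ⟨hg, ha, hb, hc⟩ := hp
    have hg' : ∀ v ∈ J, g v ∈ R := by
      intro v hv; have := hg v; simpa [hv] using this
    have hb' : ∀ v ∈ U \ R, v ∉ J → h v ∈ U \ R := fun v h1 h2 => hb v (mem_sdiff.2 ⟨h1, h2⟩)
    simp only [coe_filter, Set.mem_ofPred_eq, mem_forestFns]
    refine ⟨⟨?_, ?_, ?_⟩, ?_⟩
    · intro v hv
      have hvJ : v ∉ J := fun h => hv (hJ h)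
      simp only [hvJ, if_false]
      exact ha v fun h => hv (mem_sdiff.1 h).1
    · intro v hv
      by_cases hvJ : v ∈ J
      · simp only [hvJ, if_true]; exact hR (hg' v hvJ)
      · simp only [hvJ, if_false]; exact (mem_sdiff.1 (hb' v hv hvJ)).1
    · intro v hvU
      by_cases hvR : v ∈ R
      · exact ⟨0, hvR⟩
      have hv : v ∈ U \ R := mem_sdiff.2 ⟨hvU, hvR⟩
      obtain ⟨k, hk⟩ := hc v hv
      clear hvU hvR
      induction k generalizing v with
      | zero =>
        refine ⟨1, ?_⟩
        have hvJ : v ∈ J := hk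
        simpa [hvJ] using hg' v hvJ
      | succ k ih =>
        by_cases hvJ : v ∈ J
        · refine ⟨1, ?_⟩
          simpa [hvJ] using hg' v hvJ
        · obtain ⟨l, hl⟩ := ih (h v) (hb' v hv hvJ) hk
          refine ⟨l + 1, ?_⟩
          rw [Function.iterate_succ_apply]
          simpa only [hvJ, if_false] using hl
    · ext v
      simp only [mem_filter]
      constructor
      · rintro ⟨h1, h2⟩
        by_contra hvJ
        simp only [hvJ, if_false] at h2
        exact (mem_sdiff.1 (hb' v h1 hvJ)).2 h2
      · intro hvJ
        refine ⟨hJ hvJ, ?_⟩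
        simp only [hvJ, if_true]
        exact hg' v hvJ
  · intro f hf
    funext v
    by_cases hv : v ∈ J <;> simp [hv]
  · rintro ⟨g, h⟩ hp
    simp only [coe_product, Set.mem_prod, mem_coe, Fintype.mem_piFinset, mem_forestFns] at hp
    obtain ⟨hg, ha, hb, hc⟩ := hp
    refine Prod.ext ?_ ?_
    · funext v
      by_cases hv : v ∈ J
      · simp [hv]
      · have := hg v
        simp [hv] at this
        simp [hv, this]
    · funext v
      by_cases hv : v ∈ J
      · have := ha v (fun h => (mem_sdiff.1 h).2 hv)
        simp [hv, this]
      · simp [hv]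

theorem forestFns_card_filter (U R A : Finset V) (hR : R ⊆ U) (hA : A ⊆ U \ R) :
    #{f ∈ forestFns U R | {v ∈ U \ R | f v ∈ R} ⊆ A} =
      ∑ J ∈ A.powerset, #R ^ #J * #(forestFns (U \ R) J) := by
  rw [Finset.card_eq_sum_card_fiberwise (f := fun f => {v ∈ U \ R | f v ∈ R}) (t := A.powerset)]
  · refine sum_congr rfl fun J hJ => ?_
    rw [mem_powerset] at hJ
    rw [← forestFns_fiber U R J hR (hJ.trans hA), filter_filter]
    congr 1
    ext f
    simp only [mem_filter]
    constructor
    · rintro ⟨h1, h2, h3⟩; exact ⟨h1, h3⟩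
    · rintro ⟨h1, h3⟩; exact ⟨h1, h3 ▸ hJ, h3⟩
  · intro f hf
    exact mem_coe.2 (mem_powerset.2 (mem_filter.1 hf).2)

theorem sum_choose_mul (M x y : ℕ) :
    ∑ i ∈ range (M + 1), M.choose i * (i * (x ^ i * y ^ (M - i))) =
      M * x * (x + y) ^ (M - 1) := by
  cases M with
  | zero => simp
  | succ M =>
    rw [sum_range_succ', add_pow, Nat.add_sub_cancel, mul_sum]
    simp only [zero_mul, mul_zero, add_zero]
    refine sum_congr rfl fun i hi => ?_
    have h := Nat.add_one_mul_choose_eq M i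
    rw [Nat.add_sub_add_right]
    calc _ = ((M + 1).choose (i + 1) * (i + 1)) * (x ^ (i + 1) * y ^ (M - i)) := by ring
      _ = _ := by rw [← h]; push_cast; ring

theorem card_forestFns (U R : Finset V) (hR : R ⊆ U) :
    #(forestFns U R) * #U = #R * #U ^ #(U \ R) := by
  induction hn : #U using Nat.strong_induction_on generalizing U R with
  | _ n ih =>
    subst hn
    rcases R.eq_empty_or_nonempty with rfl | hne
    · rcases U.eq_empty_or_nonempty with rfl | ⟨u, hu⟩
      · simp
      · have : forestFns U ∅ = ∅ := by
          ext f; simp only [mem_forestFns, notMem_empty, iff_false]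
          rintro ⟨-, -, h⟩
          obtain ⟨k, hk⟩ := h u hu
          exact hk
        simp [this]
    · have hcard : #(U \ R) + #R = #U := card_sdiff_add_card_eq_card hR
      have hRpos : 0 < #R := hne.card_pos
      have key : #(forestFns U R) = ∑ J ∈ (U \ R).powerset, #R ^ #J * #(forestFns (U \ R) J) := by
        rw [← forestFns_card_filter U R (U \ R) hR subset_rfl]
        congr 1
        symm
        exact filter_true_of_mem fun f _ => filter_subset _ _
      rcases Nat.eq_zero_or_pos #(U \ R) with h0 | hpos
      · have hE : U \ R = ∅ := card_eq_zero.1 h0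
        rw [key, hE]
        have : forestFns (∅ : Finset V) ∅ = {id} := by
          ext f; simp only [mem_forestFns, mem_singleton]
          constructor
          · rintro ⟨h, -⟩; funext v; exact h v (by simp)
          · rintro rfl; simp
        simp [this]; omega
      · have h2 : #(forestFns U R) * #(U \ R) =
            #(U \ R) * #R * (#R + #(U \ R)) ^ (#(U \ R) - 1) := by
          rw [key, ← sum_choose_mul, sum_mul]
          have : ∀ J ∈ (U \ R).powerset, #R ^ #J * #(forestFns (U \ R) J) * #(U \ R) =
              #J * (#R ^ #J * #(U \ R) ^ (#(U \ R) - #J)) := by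
            intro J hJ
            rw [mem_powerset] at hJ
            rw [mul_assoc, ih _ (by omega) (U \ R) J hJ rfl, card_sdiff_of_subset hJ]
            ring
          rw [sum_congr rfl this,
            sum_powerset_apply_card (fun j => j * (#R ^ j * #(U \ R) ^ (#(U \ R) - j)))]
          simp
        have h3 : #(forestFns U R) = #R * #U ^ (#(U \ R) - 1) := by
          rw [← hcard, add_comm _ #R]
          apply Nat.eq_of_mul_eq_mul_right hpos
          rw [h2]; ring
        rw [h3, mul_assoc, ← pow_succ]
        congr 2; omega

/-- The graph of a parent function. -/
def parentGraph (f : V → V) : SimpleGraph V := SimpleGraph.fromRel fun v w => f v = w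

theorem parentGraph_connected (f : V → V) (r : V) (hf : ∀ v, ∃ k : ℕ, f^[k] v = r) :
    (parentGraph f).Connected := by
  have h : ∀ v, (parentGraph f).Reachable v r := by
    intro v
    obtain ⟨k, hk⟩ := hf v
    induction k generalizing v with
    | zero => simp at hk; subst hk; rfl
    | succ k ih =>
      have h1 := ih (f v) hk
      by_cases hv : v = f v
      · rw [← hv] at h1; exact h1
      · refine SimpleGraph.Reachable.trans (SimpleGraph.Adj.reachable ?_) h1
        simp [parentGraph, SimpleGraph.fromRel_adj, hv]
  have : Nonempty V := ⟨r⟩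
  exact ⟨fun u v => (h u).trans (h v).symm⟩

theorem parentGraph_isTree (f : V → V) (r : V) (hr : f r = r) (hf : ∀ v, ∃ k : ℕ, f^[k] v = r) :
    (parentGraph f).IsTree := by
  classical
  have hc := parentGraph_connected f r hf
  rw [SimpleGraph.isTree_iff_connected_and_card]
  refine ⟨hc, le_antisymm ?_ hc.card_vert_le_card_edgeSet_add_one⟩
  have hsub : (parentGraph f).edgeSet ⊆
      (((univ.erase r).image fun v => s(v, f v) : Finset (Sym2 V)) : Set (Sym2 V)) := by
    intro e he
    induction e with
    | _ v w =>
      simp only [SimpleGraph.mem_edgeSet, parentGraph, SimpleGraph.fromRel_adj] at he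
      simp only [coe_image, Set.mem_image, mem_coe, mem_erase, mem_univ, and_true]
      obtain ⟨hne, h | h⟩ := he
      · exact ⟨v, by rintro rfl; exact hne (hr.symm.trans h), by rw [h]⟩
      · exact ⟨w, by rintro rfl; exact hne (h.symm.trans hr), by rw [h, Sym2.eq_swap]⟩
  have h1 := Set.ncard_le_ncard hsub (Finset.finite_toSet _)
  rw [Set.ncard_coe_finset] at h1
  have h2 := h1.trans card_image_le
  rw [card_erase_of_mem (mem_univ r), card_univ] at h2
  have : 0 < Fintype.card V := Fintype.card_pos_iff.2 ⟨r⟩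
  rw [Nat.card_eq_fintype_card (α := V)]
  change (parentGraph f).edgeSet.ncard + 1 ≤ _
  omega

theorem parentGraph_inj (f g : V → V) (r : V) (hrf : f r = r) (hrg : g r = r)
    (hf : ∀ v, ∃ k : ℕ, f^[k] v = r) (h : parentGraph f = parentGraph g) : f = g := by
  funext v
  obtain ⟨k, hk⟩ := hf v
  induction k generalizing v with
  | zero => simp at hk; subst hk; rw [hrf, hrg]
  | succ k ih =>
    by_cases hv : v = r
    · subst hv; rw [hrf, hrg]
    have hper : ∀ p : ℕ, p ≠ 0 → f^[p] v ≠ v := by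
      intro p hp hpv
      obtain ⟨l, hl⟩ := hf v
      have h1 : f^[p * l] v = v := by
        rw [Function.iterate_mul]
        exact Function.iterate_fixed hpv l
      obtain ⟨q, rfl⟩ := Nat.exists_eq_succ_of_ne_zero hp
      rw [show (q + 1) * l = q * l + l by ring, Function.iterate_add_apply, hl,
        Function.iterate_fixed hrf] at h1
      exact hv h1.symm
    have h1 := ih (f v) hk
    have hadj : (parentGraph f).Adj v (f v) := by
      simp only [parentGraph, SimpleGraph.fromRel_adj]
      exact ⟨fun h => hper 1 one_ne_zero h.symm, by simp⟩
    rw [h] at hadj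
    simp only [parentGraph, SimpleGraph.fromRel_adj] at hadj
    rcases hadj.2 with h2 | h2
    · exact h2.symm
    · exact absurd (h1.trans h2) (hper 2 two_ne_zero)

theorem parentGraph_surj (T : SimpleGraph V) (hT : T.IsTree) (r : V) :
    ∃ f : V → V, f r = r ∧ (∀ v, ∃ k : ℕ, f^[k] v = r) ∧ parentGraph f = T := by
  classical
  have hex : ∀ v, ∃ w, (v = r → w = r) ∧ (v ≠ r → T.Adj v w ∧ T.dist w r + 1 = T.dist v r) := by
    intro v
    by_cases hv : v = r
    · exact ⟨r, by simp [hv]⟩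
    · obtain ⟨p, hp⟩ := (hT.connected v r).exists_walk_length_eq_dist
      cases p with
      | nil => exact absurd rfl hv
      | @cons _ w _ hadj q =>
        refine ⟨w, fun h => absurd h hv, fun _ => ⟨hadj, ?_⟩⟩
        have h1 : T.dist w r ≤ q.length := SimpleGraph.dist_le q
        simp only [SimpleGraph.Walk.length_cons] at hp
        obtain ⟨q', hq'⟩ := (hT.connected w r).exists_walk_length_eq_dist
        have h2 := SimpleGraph.dist_le (SimpleGraph.Walk.cons hadj q')
        simp only [SimpleGraph.Walk.length_cons] at h2
        omega
  choose f hf1 hf2 using hex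
  have hreach : ∀ v, ∃ k : ℕ, f^[k] v = r := by
    intro v
    induction hd : T.dist v r using Nat.strong_induction_on generalizing v with
    | _ d ih =>
      by_cases hv : v = r
      · exact ⟨0, hv⟩
      · obtain ⟨-, h2⟩ := hf2 v hv
        obtain ⟨k, hk⟩ := ih _ (by omega) (f v) rfl
        exact ⟨k + 1, hk⟩
  refine ⟨f, hf1 r rfl, hreach, ?_⟩
  have hle : parentGraph f ≤ T := by
    intro v w hvw
    simp only [parentGraph, SimpleGraph.fromRel_adj] at hvw
    obtain ⟨hne, h | h⟩ := hvw
    · have : v ≠ r := by rintro rfl; exact hne ((hf1 _ rfl).symm.trans h)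
      exact h ▸ (hf2 v this).1
    · have : w ≠ r := by rintro rfl; exact hne (h.symm.trans (hf1 _ rfl))
      exact (h ▸ (hf2 w this).1).symm
  exact le_antisymm hle ((SimpleGraph.isTree_iff_minimal_connected.1 hT).2
    (parentGraph_connected f r hreach) hle)

theorem card_trees_root (r : V) (A : Finset V) :
    Nat.card {T : SimpleGraph V // T.IsTree ∧ ∀ w, T.Adj r w → w ∈ A} =
      #{f ∈ forestFns univ {r} | {v ∈ univ \ {r} | f v ∈ ({r} : Finset V)} ⊆ A} := by
  symm
  rw [← Nat.card_eq_finsetCard]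
  have hmem : ∀ f : V → V,
      f ∈ {f ∈ forestFns univ {r} | {v ∈ univ \ {r} | f v ∈ ({r} : Finset V)} ⊆ A} ↔
      (f r = r ∧ ∀ v, ∃ k : ℕ, f^[k] v = r) ∧ ∀ v, v ≠ r → f v = r → v ∈ A := by
    intro f
    simp [mem_forestFns, subset_iff]
  have hadj : ∀ f : V → V, f r = r → ((∀ w, (parentGraph f).Adj r w → w ∈ A) ↔
      ∀ v, v ≠ r → f v = r → v ∈ A) := by
    intro f hr
    refine forall_congr' fun w => ?_
    simp only [parentGraph, SimpleGraph.fromRel_adj, hr]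
    constructor
    · intro h h1 h2; exact h ⟨h1.symm, Or.inr h2⟩
    · rintro h ⟨h1, h2 | h2⟩
      · exact absurd h2 h1
      · exact h h1.symm h2
  refine Nat.card_congr (Equiv.ofBijective (fun f => ⟨parentGraph f.1, ?_, ?_⟩) ⟨?_, ?_⟩)
  · obtain ⟨⟨h1, h2⟩, h3⟩ := (hmem f.1).1 f.2
    exact parentGraph_isTree f.1 r h1 h2
  · obtain ⟨⟨h1, h2⟩, h3⟩ := (hmem f.1).1 f.2
    exact (hadj f.1 h1).2 h3
  · intro f g hfg
    obtain ⟨⟨h1, h2⟩, h3⟩ := (hmem f.1).1 f.2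
    obtain ⟨⟨h1', h2'⟩, h3'⟩ := (hmem g.1).1 g.2
    exact Subtype.ext (parentGraph_inj f.1 g.1 r h1 h1' h2 (congrArg Subtype.val hfg))
  · rintro ⟨T, hT, hTA⟩
    obtain ⟨f, h1, h2, rfl⟩ := parentGraph_surj T hT r
    exact ⟨⟨f, (hmem f).2 ⟨⟨h1, h2⟩, (hadj f h1).1 hTA⟩⟩, rfl⟩

end helpers

theorem final_sum (m : ℕ) (hm : 0 < m) (c : ℕ → ℕ)
    (hc : ∀ a ∈ range (m + 1), c a * m = ∑ J ∈ range (a + 1), a.choose J * (J * m ^ (m - J))) :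
    ∑ a ∈ range (m + 1), c a = m ^ m := by
  apply Nat.eq_of_mul_eq_mul_right hm
  rw [sum_mul, sum_congr rfl hc]
  have h1 : ∀ a ∈ range (m + 1), ∑ J ∈ range (a + 1), a.choose J * (J * m ^ (m - J)) =
      ∑ J ∈ range (m + 1), a.choose J * (J * m ^ (m - J)) := by
    intro a ha
    refine sum_subset (range_subset_range.2 (by simp at ha; omega)) fun J _ hJ => ?_
    rw [Nat.choose_eq_zero_of_lt (by simpa using hJ), zero_mul]
  rw [sum_congr rfl h1, sum_comm]
  simp_rw [← sum_mul]
  have h2 : ∀ J, ∑ a ∈ range (m + 1), a.choose J = (m + 1).choose (J + 1) := by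
    intro J
    have : ∀ N : ℕ, ∑ a ∈ range N, a.choose J = N.choose (J + 1) := by
      intro N
      induction N with
      | zero => simp
      | succ N ih => rw [sum_range_succ, ih, Nat.choose_succ_succ, add_comm]
    exact this (m + 1)
  simp_rw [h2]
  have h3 := sum_choose_mul (m + 1) 1 m
  have h4 := add_pow 1 m (m + 1)
  rw [sum_range_succ'] at h3 h4
  simp only [one_pow, one_mul, mul_one, Nat.add_sub_add_right, Nat.add_sub_cancel, zero_mul,
    mul_zero, add_zero, Nat.choose_zero_right, Nat.sub_zero, Nat.cast_one, Nat.cast_id] at h3 h4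
  have h5 : ∑ i ∈ range (m + 1), (m + 1).choose (i + 1) * ((i + 1) * m ^ (m - i)) =
      ∑ i ∈ range (m + 1), (m + 1).choose (i + 1) * (i * m ^ (m - i)) +
      ∑ i ∈ range (m + 1), m ^ (m - i) * (m + 1).choose (i + 1) := by
    rw [← sum_add_distrib]
    refine sum_congr rfl fun i _ => by ring
  have h6 : (1 + m) ^ (m + 1) = (m + 1) * (1 + m) ^ m := by ring
  rw [← pow_succ]
  omega

/-- The total number of uprooted spanning trees of the complete graph `K_n`
(pairs of a spanning tree `T` and a root `r` whose neighbors in `T` are all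
smaller than `r`) equals `(n-1)^(n-1)`. -/
theorem total_uprooted_spanning_trees_Kn (n : ℕ) (hn : 2 ≤ n) :
    Nat.card {p : SimpleGraph (Fin n) × Fin n //
        p.1 ≤ ⊤ ∧ p.1.IsTree ∧ ∀ w : Fin n, p.1.Adj p.2 w → w < p.2} =
      (n - 1) ^ (n - 1) := by
  obtain ⟨m, rfl⟩ : ∃ m, n = m + 1 := ⟨n - 1, by omega⟩
  rw [Nat.add_sub_cancel]
  let e : {p : SimpleGraph (Fin (m + 1)) × Fin (m + 1) //
        p.1 ≤ ⊤ ∧ p.1.IsTree ∧ ∀ w : Fin (m + 1), p.1.Adj p.2 w → w < p.2} ≃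
      Σ r : Fin (m + 1), {T : SimpleGraph (Fin (m + 1)) // T.IsTree ∧
        ∀ w, T.Adj r w → w ∈ Finset.Iio r} :=
    { toFun := fun p => ⟨p.1.2, p.1.1, p.2.2.1, fun w h => Finset.mem_Iio.2 (p.2.2.2 w h)⟩
      invFun := fun q => ⟨(q.2.1, q.1), le_top, q.2.2.1, fun w h => Finset.mem_Iio.1 (q.2.2.2 w h)⟩
      left_inv := fun _ => rfl
      right_inv := fun _ => rfl }
  rw [Nat.card_congr e, Nat.card_sigma]
  simp_rw [card_trees_root]
  have hA : ∀ r : Fin (m + 1), Finset.Iio r ⊆ univ \ {r} := by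
    intro r v hv
    simp only [mem_sdiff, mem_univ, mem_singleton, true_and]
    exact (Finset.mem_Iio.1 hv).ne
  have hU : ∀ r : Fin (m + 1), #(univ \ {r} : Finset (Fin (m + 1))) = m := by
    intro r
    rw [card_sdiff_of_subset (subset_univ _)]; simp
  simp_rw [fun r : Fin (m + 1) =>
    forestFns_card_filter univ {r} (Finset.Iio r) (subset_univ _) (hA r)]
  let c : ℕ → ℕ := fun a => if h : a < m + 1 then
    ∑ J ∈ (Finset.Iio (⟨a, h⟩ : Fin (m + 1))).powerset,
      #({⟨a, h⟩} : Finset (Fin (m + 1))) ^ #J * #(forestFns (univ \ {⟨a, h⟩}) J) else 0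
  rw [← final_sum m (by omega) c ?_, ← Fin.sum_univ_eq_sum_range]
  · refine sum_congr rfl fun r _ => ?_
    simp only [c, dif_pos r.2]
  · intro a ha
    rw [mem_range] at ha
    simp only [c, dif_pos ha, sum_mul]
    have : ∀ J ∈ (Finset.Iio (⟨a, ha⟩ : Fin (m + 1))).powerset,
        #({⟨a, ha⟩} : Finset (Fin (m + 1))) ^ #J * #(forestFns (univ \ {⟨a, ha⟩}) J) * m =
        #J * m ^ (m - #J) := by
      intro J hJ
      rw [mem_powerset] at hJ
      have h1 := card_forestFns (univ \ {⟨a, ha⟩}) J (hJ.trans (hA _))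
      rw [card_sdiff_of_subset (hJ.trans (hA _)), hU] at h1
      simpa using h1
    rw [sum_congr rfl this, sum_powerset_apply_card (fun j => j * m ^ (m - j))]
    simp
end

section
/- For all integers m ≥ 1 and n ≥ 1, the number of spanning trees of the complete bipartite graph K_{m,n} equals m^{n−1} · n^{m−1}. -/
namespace SpanBip

/-- No nonempty closed subset avoids the roots. -/
def Gd {X Y K : Type} (g : X → Y) (h : Y → X ⊕ K) : Prop :=
  ∀ (P : Set X) (Q : Set Y), (∀ x ∈ P, g x ∈ Q) → (∀ y ∈ Q, ∃ x ∈ P, h y = Sum.inl x) → Q = ∅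

/-- Bipartite rooted forests with roots `K`. -/
abbrev FF (X Y K : Type) := {p : (X → Y) × (Y → X ⊕ K) // Gd p.1 p.2}

open Classical in
/-- the set of vertices attached to a root -/
noncomputable def rootSet {X Y K : Type} [Fintype Y] (p : FF X Y K) : Finset Y :=
  Finset.univ.filter (fun y => (p.1.2 y).isRight)

open Classical in
/-- glue back the first layer -/
noncomputable def glue {X Y K : Type} (S : Finset Y)
    (q : ({y // y ∈ S} → K) × FF {y // y ∉ S} X {y // y ∈ S}) : (X → Y) × (Y → X ⊕ K) :=
  (fun x => Sum.elim Subtype.val Subtype.val (q.2.1.2 x),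
   fun y => if hy : y ∈ S then Sum.inr (q.1 ⟨y, hy⟩) else Sum.inl (q.2.1.1 ⟨y, hy⟩))

lemma glue_gd {X Y K : Type} (S : Finset Y)
    (q : ({y // y ∈ S} → K) × FF {y // y ∉ S} X {y // y ∈ S}) :
    Gd (glue S q).1 (glue S q).2 := by
  obtain ⟨k, ⟨⟨g, h⟩, hG⟩⟩ := q
  intro P Q h1 h2
  simp only [glue] at h1 h2 hG
  have hQS : ∀ y ∈ Q, y ∉ S := by
    intro y hy hS
    obtain ⟨x, hx, hxy⟩ := h2 y hy
    simp [hS] at hxy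
  have hP : P = ∅ := by
    apply hG {y | y.1 ∈ Q} P
    · intro y hy
      obtain ⟨x, hx, hxy⟩ := h2 y hy
      rw [dif_neg y.2] at hxy
      have : g y = x := Sum.inl.inj hxy
      rwa [this]
    · intro x hx
      have := h1 x hx
      rcases hh : h x with y | y
      · rw [hh] at this
        exact ⟨y, this, rfl⟩
      · rw [hh] at this
        exact absurd y.2 (hQS _ this)
  subst hP
  ext y
  simp only [Set.mem_empty_iff_false, iff_false]
  intro hy
  obtain ⟨x, hx, _⟩ := h2 y hy
  exact hx

lemma glue_rootSet {X Y K : Type} [Fintype Y] (S : Finset Y)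
    (q : ({y // y ∈ S} → K) × FF {y // y ∉ S} X {y // y ∈ S}) :
    rootSet ⟨glue S q, glue_gd S q⟩ = S := by
  ext y
  simp only [rootSet, Finset.mem_filter, Finset.mem_univ, true_and]
  by_cases hy : y ∈ S <;> simp [glue, hy]

lemma glue_inj {X Y K : Type} (S : Finset Y) :
    Function.Injective (glue (X := X) (K := K) S) := by
  rintro ⟨k, ⟨⟨g, h⟩, hG⟩⟩ ⟨k', ⟨⟨g', h'⟩, hG'⟩⟩ he
  simp only [glue, Prod.mk.injEq] at he
  obtain ⟨h1, h2⟩ := he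
  have hk : k = k' := by
    funext y
    have := congrFun h2 y.1
    simpa [y.2] using this
  have hg : g = g' := by
    funext y
    have := congrFun h2 y.1
    simpa [y.2] using this
  have hh : h = h' := by
    funext x
    have := congrFun h1 x
    rcases e : h x with y | y <;> rcases e' : h' x with z | z <;>
      simp only [e, e', Sum.elim_inl, Sum.elim_inr] at this
    · rw [Subtype.ext this]
    · exact absurd z.2 (this ▸ y.2)
    · exact absurd y.2 (this ▸ z.2)
    · rw [Subtype.ext this]
  subst hk hg hh
  rfl

lemma glue_surj {X Y K : Type} [Fintype Y] (p : FF X Y K) :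
    ∃ q, glue (rootSet p) q = p.1 := by
  classical
  obtain ⟨⟨g, h⟩, hG⟩ := p
  set S := rootSet (⟨⟨g, h⟩, hG⟩ : FF X Y K) with hS
  have h1 : ∀ y : {y // y ∈ S}, ∃ k, h y.1 = Sum.inr k := by
    rintro ⟨y, hy⟩
    simp only [hS, rootSet, Finset.mem_filter, Finset.mem_univ, true_and] at hy
    exact Sum.isRight_iff.1 hy
  have h2 : ∀ y : {y // y ∉ S}, ∃ x, h y.1 = Sum.inl x := by
    rintro ⟨y, hy⟩
    simp only [hS, rootSet, Finset.mem_filter, Finset.mem_univ, true_and] at hy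
    exact Sum.isLeft_iff.1 (by simpa using hy)
  choose k hk using h1
  choose g' hg' using h2
  let h' : X → {y // y ∉ S} ⊕ {y // y ∈ S} := fun x =>
    if hx : g x ∈ S then Sum.inr ⟨g x, hx⟩ else Sum.inl ⟨g x, hx⟩
  refine ⟨(k, ⟨(g', h'), ?_⟩), ?_⟩
  · intro P Q hPQ hQP
    have hP : (Subtype.val '' P : Set Y) = ∅ := by
      apply hG Q
      · intro x hx
        obtain ⟨y, hy, hxy⟩ := hQP x hx
        refine ⟨y, hy, ?_⟩
        simp only [h'] at hxy
        split_ifs at hxy with hc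
        rw [← Sum.inl.inj hxy]
      · rintro _ ⟨y, hy, rfl⟩
        exact ⟨g' y, hPQ y hy, hg' y⟩
    rw [Set.image_eq_empty] at hP
    subst hP
    ext x
    simp only [Set.mem_empty_iff_false, iff_false]
    intro hx
    obtain ⟨y, hy, _⟩ := hQP x hx
    exact hy
  · simp only [glue, Prod.mk.injEq]
    constructor
    · funext x
      by_cases hx : g x ∈ S <;> simp [h', hx]
    · funext y
      by_cases hy : y ∈ S
      · simp only [hy, dif_pos]; exact (hk ⟨y, hy⟩).symm
      · simp only [hy]; exact (hg' ⟨y, hy⟩).symm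

lemma card_rec (X Y K : Type) [Fintype X] [Fintype Y] [Fintype K] :
    Nat.card (FF X Y K) = ∑ S : Finset Y, Fintype.card K ^ S.card *
      Nat.card (FF {y // y ∉ S} X {y // y ∈ S}) := by
  classical
  rw [← Nat.card_congr (Equiv.sigmaFiberEquiv (rootSet (X := X) (Y := Y) (K := K))),
    Nat.card_sigma]
  refine Finset.sum_congr rfl fun S _ => ?_
  have : Nat.card ({y // y ∈ S} → K) = Fintype.card K ^ S.card := by simp
  rw [← this, ← Nat.card_prod]
  symm
  refine Nat.card_eq_of_bijective
    (fun q => (⟨⟨glue S q, glue_gd S q⟩, glue_rootSet S q⟩ : {p : FF X Y K // rootSet p = S}))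
    ⟨?_, ?_⟩
  · intro a b hab
    exact glue_inj S (congrArg (fun z => z.1.1) hab)
  · rintro ⟨p, rfl⟩
    obtain ⟨q, hq⟩ := glue_surj p
    exact ⟨q, Subtype.ext (Subtype.ext hq)⟩

lemma sum_aux (Y : Type) [Fintype Y] (k x : ℕ) :
    (∑ S : Finset Y, S.card * k ^ S.card * x ^ (Fintype.card Y - S.card)) * (x + k) =
      Fintype.card Y * k * (x + k) ^ Fintype.card Y := by
  classical
  have := Finset.sum_powerset_apply_card
    (fun j => j * k ^ j * x ^ (Fintype.card Y - j)) (x := (Finset.univ : Finset Y))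
  rw [Finset.powerset_univ] at this
  rw [this, Finset.card_univ]
  generalize Fintype.card Y = n
  cases n with
  | zero => simp
  | succ n =>
    have hs : ∑ j ∈ Finset.range (n + 1 + 1),
        (n + 1).choose j • (j * k ^ j * x ^ (n + 1 - j)) = (n + 1) * k * (k + x) ^ n := by
      rw [Finset.sum_range_succ', add_pow, Finset.mul_sum]
      simp only [zero_mul, mul_zero, add_zero, smul_eq_mul]
      refine Finset.sum_congr rfl fun j hj => ?_
      have h := Nat.add_one_mul_choose_eq n j
      have e : n + 1 - (j + 1) = n - j := by omega
      rw [e, pow_succ]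
      calc _ = ((n+1).choose (j+1) * (j+1)) * (k ^ j * k * x ^ (n-j)) := by ring
        _ = _ := by rw [← h]; push_cast; ring
    rw [hs]
    ring

lemma card_empty (X Y : Type) [Nonempty X] (K : Type) [IsEmpty K] :
    Nat.card (FF X Y K) = 0 := by
  have : IsEmpty (FF X Y K) := by
    refine ⟨fun ⟨⟨g, h⟩, hG⟩ => ?_⟩
    have := hG Set.univ Set.univ (by simp) (by
      intro y _
      rcases e : h y with x | k
      · exact ⟨x, trivial, e⟩
      · exact isEmptyElim k)
    obtain ⟨x⟩ := ‹Nonempty X›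
    have h2 : g x ∈ (Set.univ : Set Y) := trivial
    rw [this] at h2
    exact h2
  exact Nat.card_of_isEmpty

lemma card_main (N : ℕ) : ∀ (X Y K : Type) [Fintype X] [Fintype Y] [Fintype K],
    Fintype.card X + Fintype.card Y = N → 0 < Fintype.card K →
    (Fintype.card X + Fintype.card K) * Nat.card (FF X Y K) =
      Fintype.card K * Fintype.card Y ^ Fintype.card X *
        (Fintype.card X + Fintype.card K) ^ Fintype.card Y := by
  classical
  induction N using Nat.strong_induction_on with
  | _ N ih =>
  intro X Y K _ _ _ hN hK
  rcases isEmpty_or_nonempty Y with hY | hY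
  · have hY0 : Fintype.card Y = 0 := Fintype.card_eq_zero
    rcases isEmpty_or_nonempty X with hX | hX
    · have hX0 : Fintype.card X = 0 := Fintype.card_eq_zero
      have : Nat.card (FF X Y K) = 1 := by
        rw [Nat.card_eq_one_iff_unique]
        refine ⟨inferInstance, ⟨⟨(isEmptyElim, isEmptyElim), ?_⟩⟩⟩
        intro P Q _ _
        exact Set.eq_empty_of_isEmpty Q
      rw [this, hX0, hY0]; simp
    · have : IsEmpty (FF X Y K) := ⟨fun p => isEmptyElim (p.1.1 (Classical.arbitrary X))⟩
      rw [Nat.card_of_isEmpty, hY0, zero_pow Fintype.card_ne_zero]; simp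
  · have hY0 : 0 < Fintype.card Y := Fintype.card_pos
    apply Nat.eq_of_mul_eq_mul_left hY0
    have key : ∀ S : Finset Y, Fintype.card Y * Nat.card (FF {y // y ∉ S} X {y // y ∈ S}) =
        S.card * Fintype.card X ^ (Fintype.card Y - S.card) *
          Fintype.card Y ^ Fintype.card X := by
      intro S
      have c1 : Fintype.card {y // y ∈ S} = S.card := Fintype.card_coe S
      have c2 : Fintype.card {y // y ∉ S} = Fintype.card Y - S.card := by
        rw [Fintype.card_subtype_compl, c1]
      have c3 : S.card ≤ Fintype.card Y := Finset.card_le_univ S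
      rcases S.eq_empty_or_nonempty with hS | hS
      · have : IsEmpty {y // y ∈ S} := ⟨fun y => by have := y.2; simp [hS] at this⟩
        have : Nonempty {y // y ∉ S} := by
          subst hS; exact ⟨⟨Classical.arbitrary Y, by simp⟩⟩
        rw [card_empty, hS]; simp
      · have hS0 := hS.card_pos
        have := ih (Fintype.card {y // y ∉ S} + Fintype.card X) (by omega)
          {y // y ∉ S} X {y // y ∈ S} rfl (by omega)
        rw [c1, c2, Nat.sub_add_cancel c3] at this
        exact this
    rw [card_rec]
    have h := sum_aux Y (Fintype.card K) (Fintype.card X)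
    calc _ = (Fintype.card X + Fintype.card K) * ∑ S : Finset Y, Fintype.card K ^ S.card *
          (Fintype.card Y * Nat.card (FF {y // y ∉ S} X {y // y ∈ S})) := by
          rw [mul_left_comm, Finset.mul_sum]
          congr 1
          exact Finset.sum_congr rfl fun S _ => by ring
      _ = Fintype.card Y ^ Fintype.card X * ((∑ S : Finset Y, S.card * Fintype.card K ^ S.card *
            Fintype.card X ^ (Fintype.card Y - S.card)) *
              (Fintype.card X + Fintype.card K)) := by
          simp only [key]
          rw [mul_comm, Finset.sum_mul, Finset.sum_mul, Finset.mul_sum]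
          exact Finset.sum_congr rfl fun S _ => by ring
      _ = _ := by rw [h]; ring

/-- parent functions towards the root `r` -/
def Par {V : Type} (r : V) (f : V → V) : Prop :=
  f r = r ∧ ∀ s : Set V, (∀ v ∈ s, f v ∈ s) → s.Nonempty → r ∈ s

lemma Par.ne {V : Type} {r : V} {f : V → V} (h : Par r f) {v : V} (hv : v ≠ r) : f v ≠ v := by
  intro e
  have := h.2 {v} (by simp [e]) ⟨v, rfl⟩
  exact hv this.symm

/-- the graph of a function -/
def gr {V : Type} (f : V → V) : SimpleGraph V := SimpleGraph.fromRel (fun v w => f v = w)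

lemma gr_connected {V : Type} {r : V} {f : V → V} (h : Par r f) : (gr f).Connected := by
  have : ∀ v, (gr f).Reachable v r := by
    by_contra! hc
    have := h.2 {v | ¬ (gr f).Reachable v r} ?_ hc
    · exact this (SimpleGraph.Reachable.refl r)
    · intro v hv hr
      apply hv
      by_cases e : f v = v
      · rwa [e] at hr
      · refine SimpleGraph.Reachable.trans (SimpleGraph.Adj.reachable ?_) hr
        simp [gr, Ne.symm e]
  have : Nonempty V := ⟨r⟩
  exact ⟨fun u v => (‹∀ v, (gr f).Reachable v r› u).trans (‹∀ v, (gr f).Reachable v r› v).symm⟩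

lemma gr_isTree {V : Type} [Fintype V] {r : V} {f : V → V} (h : Par r f) : (gr f).IsTree := by
  classical
  rw [SimpleGraph.isTree_iff_connected_and_card]
  refine ⟨gr_connected h, le_antisymm ?_ (gr_connected h).card_vert_le_card_edgeSet_add_one⟩
  have hsub : (gr f).edgeSet ⊆ (((Finset.univ.erase r).image (fun v => s(v, f v)) :
      Finset (Sym2 V)) : Set (Sym2 V)) := by
    intro e he
    induction e using Sym2.ind with
    | _ v w =>
      have he : v ≠ w ∧ (f v = w ∨ f w = v) := by simpa [gr] using he
      simp only [Finset.coe_image, Set.mem_image, Finset.mem_coe, Finset.mem_erase,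
        Finset.mem_univ, and_true]
      rcases he with ⟨hne, e | e⟩
      · refine ⟨v, ?_, by rw [e]⟩
        rintro rfl
        exact hne (h.1.symm.trans e)
      · refine ⟨w, ?_, by rw [e, Sym2.eq_swap]⟩
        rintro rfl
        exact hne (e.symm.trans h.1)
  have h1 := Nat.card_mono (Finset.finite_toSet _) hsub
  have h2 : ((Finset.univ.erase r).image (fun v => s(v, f v))).card ≤ Fintype.card V - 1 := by
    refine Finset.card_image_le.trans ?_
    simp [Finset.card_erase_of_mem]
  have h3 : 0 < Fintype.card V := Fintype.card_pos_iff.2 ⟨r⟩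
  simp only [Nat.card_eq_fintype_card, SetLike.coe_sort_coe, Fintype.card_coe] at h1 ⊢
  omega

lemma gr_inj {V : Type} {r : V} {f f' : V → V} (h : Par r f) (h' : Par r f')
    (e : gr f = gr f') : f = f' := by
  by_contra hne
  obtain ⟨v, hv⟩ := Function.ne_iff.1 hne
  have := h'.2 {v | v ≠ r ∧ f v ≠ f' v} ?_ ⟨v, ?_, hv⟩
  · exact this.1 rfl
  · rintro v ⟨hvr, hv⟩
    have hadj : (gr f').Adj v (f' v) := by simp [gr, (h'.ne hvr).symm]
    rw [← e] at hadj
    have hfu : f (f' v) = v := by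
      simp only [gr, SimpleGraph.fromRel_adj] at hadj
      tauto
    have hur : f' v ≠ r := by
      intro e
      rw [e, h.1] at hfu
      exact hvr hfu.symm
    refine ⟨hur, fun e2 => ?_⟩
    have := h'.2 {v, f' v} (by
      rintro w (rfl | rfl)
      · simp
      · left; rw [← e2, hfu]) ⟨v, by simp⟩
    rcases this with e | e
    · exact hvr e.symm
    · exact hur e.symm
  · rintro rfl
    exact hv (h.1.trans h'.1.symm)

lemma gr_surj {V : Type} (r : V) (T : SimpleGraph V) (hT : T.IsTree) :
    ∃ f, Par r f ∧ gr f = T := by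
  classical
  have hex : ∀ v, ∃ w, (v = r → w = r) ∧ (v ≠ r → T.Adj v w ∧ T.dist w r < T.dist v r) := by
    intro v
    by_cases hv : v = r
    · exact ⟨r, fun _ => rfl, fun h => absurd hv h⟩
    · obtain ⟨p, hp⟩ := hT.connected.exists_walk_length_eq_dist v r
      cases p with
      | nil => exact absurd rfl hv
      | cons hadj q =>
        rename_i w
        refine ⟨w, fun h => absurd h hv, fun _ => ⟨hadj, ?_⟩⟩
        have := SimpleGraph.dist_le q
        simp at hp
        omega
  choose f hf1 hf2 using hex
  have hP : Par r f := by
    refine ⟨hf1 r rfl, fun s hs hne => ?_⟩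
    obtain ⟨v, hv, hmin⟩ := exists_minimalFor_of_wellFoundedLT (· ∈ s) (fun v => T.dist v r) hne
    by_cases e : v = r
    · exact e ▸ hv
    · have h1 := (hf2 v e).2
      have h2 := hmin (hs v hv) h1.le
      simp only at h2
      omega
  refine ⟨f, hP, ?_⟩
  have hle : gr f ≤ T := by
    have h : ∀ v, v ≠ f v → T.Adj v (f v) := by
      intro v hv
      refine (hf2 v ?_).1
      rintro rfl
      exact hv hP.1.symm
    intro v w hvw
    simp only [gr, SimpleGraph.fromRel_adj] at hvw
    obtain ⟨hne, rfl | rfl⟩ := hvw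
    · exact h _ hne
    · exact (h _ hne.symm).symm
  exact le_antisymm hle
    ((SimpleGraph.isTree_iff_minimal_connected.1 hT).2 (gr_connected hP) hle)

lemma card_tree (X Y : Type) [Fintype X] [Fintype Y] :
    Nat.card {T : SimpleGraph ((X ⊕ Unit) ⊕ Y) // T ≤ completeBipartiteGraph (X ⊕ Unit) Y ∧
      T.IsTree} = Nat.card (FF X Y Unit) := by
  symm
  let F : (X → Y) × (Y → X ⊕ Unit) → ((X ⊕ Unit) ⊕ Y → (X ⊕ Unit) ⊕ Y) := fun p =>
    Sum.elim (Sum.elim (fun x => Sum.inr (p.1 x)) (fun u => Sum.inl (Sum.inr u)))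
      (fun y => Sum.inl (p.2 y))
  let r : (X ⊕ Unit) ⊕ Y := Sum.inl (Sum.inr ())
  have hF : ∀ p, Gd p.1 p.2 ↔ Par r (F p) := by
    rintro ⟨g, h⟩
    constructor
    · intro hG
      refine ⟨rfl, fun s hs hne => ?_⟩
      by_contra hr
      have hQ := hG {x | Sum.inl (Sum.inl x) ∈ s} {y | Sum.inr y ∈ s}
        (fun x hx => hs _ hx) (by
          intro y hy
          have := hs _ hy
          rcases e : h y with x | u
          · refine ⟨x, ?_, e⟩
            simpa [F, e] using this
          · exact absurd (by simpa [F, e] using this) hr)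
      obtain ⟨(x | u) | y, hv⟩ := hne
      · have : g x ∈ {y | Sum.inr y ∈ s} := hs _ hv
        rw [hQ] at this; exact this
      · exact hr hv
      · have : y ∈ {y | Sum.inr y ∈ s} := hv
        rw [hQ] at this; exact this
    · intro hP P Q h1 h2
      by_contra hne
      obtain ⟨y, hy⟩ := Set.nonempty_iff_ne_empty.2 hne
      have := hP.2 (Sum.elim (Sum.elim P (fun _ => False)) Q) (by
        rintro ((x | u) | y) hv
        · exact h1 x hv
        · exact hv.elim
        · obtain ⟨x, hx, e⟩ := h2 y hv
          have e : h y = Sum.inl x := e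
          have : F (g, h) (Sum.inr y) = Sum.inl (Sum.inl x) := by simp [F, e]
          rw [this]
          exact hx) ⟨Sum.inr y, hy⟩
      exact this
  have hFinj : Function.Injective F := by
    rintro ⟨g, h⟩ ⟨g', h'⟩ e
    have e1 : g = g' := funext fun x => by
      simpa [F] using congrFun e (Sum.inl (Sum.inl x))
    have e2 : h = h' := funext fun y => by
      simpa [F] using congrFun e (Sum.inr y)
    rw [e1, e2]
  have hbip : ∀ p, gr (F p) ≤ completeBipartiteGraph (X ⊕ Unit) Y := by
    intro p v w hvw
    simp only [gr, SimpleGraph.fromRel_adj] at hvw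
    rcases v with (x | u) | y <;> rcases w with (x' | u') | y' <;> simp_all [F]
  refine Nat.card_eq_of_bijective (fun p : FF X Y Unit =>
    (⟨gr (F p.1), hbip p.1, gr_isTree ((hF p.1).1 p.2)⟩ :
      {T : SimpleGraph ((X ⊕ Unit) ⊕ Y) // T ≤ completeBipartiteGraph (X ⊕ Unit) Y ∧
      T.IsTree})) ⟨?_, ?_⟩
  · intro p q hpq
    exact Subtype.ext (hFinj (gr_inj ((hF p.1).1 p.2) ((hF q.1).1 q.2) (congrArg Subtype.val hpq)))
  · rintro ⟨T, hTle, hT⟩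
    obtain ⟨f, hf, rfl⟩ := gr_surj r T hT
    have hadj : ∀ v, v ≠ r → (completeBipartiteGraph (X ⊕ Unit) Y).Adj v (f v) := by
      intro v hv
      apply hTle
      simp [gr, (hf.ne hv).symm]
    have hg : ∀ x : X, ∃ y, f (Sum.inl (Sum.inl x)) = Sum.inr y := by
      intro x
      have := hadj (Sum.inl (Sum.inl x)) (by simp [r])
      rcases e : f (Sum.inl (Sum.inl x)) with z | y
      · simp [e] at this
      · exact ⟨y, rfl⟩
    have hh : ∀ y : Y, ∃ z, f (Sum.inr y) = Sum.inl z := by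
      intro y
      have := hadj (Sum.inr y) (by simp [r])
      rcases e : f (Sum.inr y) with z | y
      · exact ⟨z, rfl⟩
      · simp [e] at this
    choose g hg using hg
    choose h hh using hh
    have hFf : F (g, h) = f := by
      funext v
      rcases v with (x | u) | y
      · simp [F, hg]
      · simpa [F] using hf.1.symm
      · simp [F, hh]
    exact ⟨⟨(g, h), (hF _).2 (hFf ▸ hf)⟩, Subtype.ext (by simp [hFf])⟩

end SpanBip

theorem spanning_trees_complete_bipartite (m n : ℕ) (hm : 1 ≤ m) (hn : 1 ≤ n) :
    Nat.card {T : SimpleGraph (Fin (m + n)) //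
        T ≤ SimpleGraph.fromRel (fun i j : Fin (m + n) => i.val < m ∧ m ≤ j.val) ∧
        T.IsTree} =
      m ^ (n - 1) * n ^ (m - 1) := by
  obtain ⟨m, rfl⟩ : ∃ k, m = k + 1 := ⟨m - 1, by omega⟩
  let e0 : Fin m ⊕ Unit ≃ Fin (m + 1) :=
    (Equiv.sumCongr (Equiv.refl _) (Equiv.ofUnique Unit (Fin 1))).trans finSumFinEquiv
  let e : (Fin m ⊕ Unit) ⊕ Fin n ≃ Fin (m + 1 + n) :=
    (Equiv.sumCongr e0 (Equiv.refl _)).trans finSumFinEquiv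
  have he1 : ∀ a, (e (Sum.inl a)).val < m + 1 := by
    intro a
    have := (e0 a).2
    simpa [e] using Nat.lt_succ_iff.1 this
  have he2 : ∀ b, m + 1 ≤ (e (Sum.inr b)).val := by
    intro b
    simp [e]
  have h1 := SpanBip.card_tree (Fin m) (Fin n)
  have h2 := SpanBip.card_main _ (Fin m) (Fin n) Unit rfl (by simp)
  have h3 : Nat.card {T : SimpleGraph (Fin (m + 1 + n)) //
        T ≤ SimpleGraph.fromRel (fun i j : Fin (m + 1 + n) => i.val < m + 1 ∧ m + 1 ≤ j.val) ∧
        T.IsTree} = Nat.card (SpanBip.FF (Fin m) (Fin n) Unit) := by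
    rw [← h1]
    refine Nat.card_congr (Equiv.subtypeEquiv e.symm.simpleGraph fun T => ?_)
    refine and_congr ?_ (SimpleGraph.Iso.comap e T).isTree_iff.symm
    have hbip : ∀ a b, (SimpleGraph.fromRel (fun i j : Fin (m + 1 + n) =>
        i.val < m + 1 ∧ m + 1 ≤ j.val)).Adj (e a) (e b) ↔
        (completeBipartiteGraph (Fin m ⊕ Unit) (Fin n)).Adj a b := by
      intro a b
      simp only [SimpleGraph.fromRel_adj, completeBipartiteGraph_adj, ne_eq,
        EmbeddingLike.apply_eq_iff_eq]
      rcases a with a | a <;> rcases b with b | b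
      · have := he1 a; have := he1 b
        simp; omega
      · have := he1 a; have := he2 b
        simp; omega
      · have := he2 a; have := he1 b
        simp; omega
      · have := he2 a; have := he2 b
        simp; omega
    constructor
    · intro h a b hab
      exact (hbip a b).1 (h hab)
    · intro h i j hij
      have := (hbip (e.symm i) (e.symm j)).2 (h (by
        change T.Adj (e (e.symm i)) (e (e.symm j))
        simpa using hij))
      simpa using this
  rw [h3]
  simp only [Fintype.card_fin, Fintype.card_unit, one_mul] at h2
  obtain ⟨n, rfl⟩ : ∃ k, n = k + 1 := ⟨n - 1, by omega⟩
  apply Nat.eq_of_mul_eq_mul_left (Nat.succ_pos m)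
  rw [Nat.succ_eq_add_one, h2]
  simp only [Nat.add_sub_cancel]
  ring
end

section
/- Let m ≥ 1, n ≥ 2, and 1 ≤ k ≤ m. Let N_k be the number of spanning trees T of the complete bipartite graph K_{m,n} such that the largest neighbor of the vertex m+n in T equals m+1−k (i.e., the number of uprooted spanning trees of K_{m,n} with root m+n whose highest child equals m+1−k). Then n · N_k = m^{n−2} · n^{m−k} · (n−1)^{k−1} · (m+n−k). -/
open Finset

/-- iterate map -/
def stepO {B : Type*} (h : B → Option B) (o : Option B) : Option B := o.bind h

def AcycO {B : Type*} (h : B → Option B) : Prop := ∀ b, ∃ k, (stepO h)^[k] (some b) = none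

lemma det_acyc {B : Type*} [Fintype B] [DecidableEq B] (h : B → Option B) (ha : AcycO h) :
    Matrix.det (Matrix.of fun i j : B => (if i = j then (1:ℤ) else 0) - if h i = some j then 1 else 0) = 1 := by
  classical
  set M := (Matrix.of fun i j : B => (if i = j then (1:ℤ) else 0) - if h i = some j then 1 else 0) with hM
  let d : B → ℕ := fun b => Nat.find (ha b)
  have hd : ∀ i j, h i = some j → d j < d i := by
    intro i j hij
    have h1 := Nat.find_spec (ha i)
    change (stepO h)^[d i] (some i) = none at h1
    rcases hdi : d i with _ | k
    · rw [hdi] at h1; simp at h1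
    · rw [hdi, Function.iterate_succ_apply] at h1
      have : stepO h (some i) = some j := by simp [stepO, hij]
      rw [this] at h1
      exact Nat.lt_succ_of_le (Nat.find_min' (ha j) h1)
  have hbt : M.BlockTriangular (fun i => OrderDual.toDual (d i)) := by
    intro i j hij
    have hij' : d i < d j := hij
    have h1 : i ≠ j := by rintro rfl; exact lt_irrefl _ hij'
    have h2 : h i ≠ some j := fun h => by have := hd i j h; omega
    simp [hM, h1, h2]
  rw [hbt.det]
  apply Finset.prod_eq_one
  intro a _
  have : M.toSquareBlock (fun i => OrderDual.toDual (d i)) a = 1 := by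
    ext ⟨i, hi⟩ ⟨j, hj⟩
    have h2 : h i ≠ some j := fun h => by
      have := hd i j h
      have e : OrderDual.toDual (d i) = OrderDual.toDual (d j) := hi.trans hj.symm
      have e' : d i = d j := e
      omega
    simp [Matrix.toSquareBlock_def, hM, h2, Matrix.one_apply]
  rw [this, Matrix.det_one]

lemma det_not_acyc {B : Type*} [Fintype B] [DecidableEq B] (h : B → Option B) (ha : ¬ AcycO h) :
    Matrix.det (Matrix.of fun i j : B => (if i = j then (1:ℤ) else 0) - if h i = some j then 1 else 0) = 0 := by
  classical
  rw [← Matrix.exists_mulVec_eq_zero_iff]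
  simp only [AcycO, not_forall] at ha
  obtain ⟨b0, hb0⟩ := ha
  refine ⟨fun b => if ∃ k, (stepO h)^[k] (some b) = none then 0 else 1, ?_, ?_⟩
  · intro h0
    have := congrFun h0 b0
    simp only [if_neg hb0] at this
    simp at this
  · ext i
    simp only [Matrix.mulVec, dotProduct, Matrix.of_apply, sub_mul, Finset.sum_sub_distrib, ite_mul, one_mul, zero_mul, Finset.sum_ite_eq, Finset.mem_univ, if_true, Pi.zero_apply]
    rcases hi : h i with _ | j
    · have : ∃ k, (stepO h)^[k] (some i) = none := ⟨1, by simp [stepO, hi]⟩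
      simp [this]
    · have e : (∃ k, (stepO h)^[k] (some i) = none) ↔ ∃ k, (stepO h)^[k] (some j) = none := by
        have hs : stepO h (some i) = some j := by simp [stepO, hi]
        constructor
        · rintro ⟨k, hk⟩
          rcases k with _ | k
          · simp at hk
          · rw [Function.iterate_succ_apply, hs] at hk; exact ⟨k, hk⟩
        · rintro ⟨k, hk⟩
          exact ⟨k+1, by rw [Function.iterate_succ_apply, hs, hk]⟩
      simp only [Option.some.injEq, Finset.sum_ite_eq, Finset.mem_univ, if_true, e, sub_self]

open Classical in
lemma weighted_cayley {B X : Type*} [Fintype B] [Fintype X] [Nonempty B] (π : X → Option B) :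
    #{g : B → X | AcycO (fun b => π (g b))} = #{x | π x = none} * Fintype.card X ^ (Fintype.card B - 1) := by
  zify
  have h1 : ((#{g : B → X | AcycO (fun b => π (g b))} : ℕ) : ℤ) =
     ∑ g : B → X, Matrix.det (Matrix.of fun i j : B => (if i = j then (1:ℤ) else 0) - if π (g i) = some j then 1 else 0) := by
    rw [Finset.card_filter, Nat.cast_sum]
    refine Finset.sum_congr rfl fun g _ => ?_
    by_cases ha : AcycO (fun b => π (g b))
    · rw [det_acyc _ ha]; simp [ha]
    · rw [det_not_acyc _ ha]; simp [ha]
  have h2 := (Matrix.detRowAlternating (R := ℤ) (n := B)).toMultilinearMap.map_sum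
    (fun (i : B) (x : X) => (fun j : B => (if i = j then (1:ℤ) else 0) - if π x = some j then 1 else 0))
  rw [h1]
  refine Eq.trans h2.symm ?_
  let w : B → ℤ := fun j => ∑ x, if π x = some j then 1 else 0
  have h3 : (Matrix.of fun i => ∑ x : X, (fun j : B => (if i = j then (1:ℤ) else 0) - if π x = some j then 1 else 0)) =
     (Matrix.scalar B (Fintype.card X : ℤ) - Matrix.vecMulVec (fun _ => 1) w) := by
    ext i j
    rw [Matrix.sub_apply, Matrix.vecMulVec_apply, Matrix.of_apply, Finset.sum_apply]
    rw [Matrix.scalar_apply, Matrix.diagonal_apply]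
    simp [w]
  have h4 : (∑ j, w j) + (#{x | π x = none} : ℕ) = (Fintype.card X : ℤ) := by
    simp only [w]
    rw [Finset.sum_comm, Finset.card_filter, Nat.cast_sum, ← Finset.sum_add_distrib]
    rw [Finset.sum_congr rfl (g := fun _ => (1:ℤ))]
    · simp
    · intro x _
      rcases π x with _ | j <;> simp
  change Matrix.det (Matrix.of fun i => ∑ x : X, (fun j : B => (if i = j then (1:ℤ) else 0) - if π x = some j then 1 else 0)) = _
  rw [h3]
  rw [← Matrix.eval_charpoly, Matrix.charpoly_vecMulVec]
  have h5 : (fun _ => (1:ℤ)) ⬝ᵥ w = ∑ j, w j := by simp [dotProduct]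
  rw [h5]
  obtain ⟨b, hb⟩ : ∃ b, Fintype.card B = b + 1 := ⟨Fintype.card B - 1, by have := Fintype.card_pos (α := B); omega⟩
  rw [hb]
  have h6 : ∑ j, w j = (Fintype.card X : ℤ) - (#{x | π x = none} : ℕ) := by linarith
  rw [h6]
  generalize (Fintype.card X : ℤ) = c
  generalize ((#{x | π x = none} : ℕ) : ℤ) = d
  simp
  ring

def pGraph {V : Type*} (p : V → V) : SimpleGraph V := SimpleGraph.fromRel (fun u v => p u = v)

lemma pGraph_adj {V : Type*} (p : V → V) (u v : V) :
    (pGraph p).Adj u v ↔ u ≠ v ∧ (p u = v ∨ p v = u) := SimpleGraph.fromRel_adj _ _ _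

def Rooted {V : Type*} (r : V) (p : V → V) : Prop := p r = r ∧ ∀ v, ∃ k, p^[k] v = r

lemma Rooted.ne {V : Type*} {r : V} {p : V → V} (h : Rooted r p) {v : V} (hv : v ≠ r) : p v ≠ v := by
  intro e
  obtain ⟨k, hk⟩ := h.2 v
  rw [Function.iterate_fixed e] at hk
  exact hv hk

lemma Rooted.ne2 {V : Type*} {r : V} {p : V → V} (h : Rooted r p) {v : V} (hv : v ≠ r) : p (p v) ≠ v := by
  intro e
  obtain ⟨k, hk⟩ := h.2 v
  have h1 : p^[2 * k] v = v := by
    rw [Function.iterate_mul]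
    exact Function.iterate_fixed (f := p^[2]) e k
  rw [two_mul, Function.iterate_add_apply, hk, Function.iterate_fixed h.1] at h1
  exact hv h1.symm

lemma Rooted.connected {V : Type*} {r : V} {p : V → V} (h : Rooted r p) : (pGraph p).Connected := by
  have key : ∀ k v, p^[k] v = r → (pGraph p).Reachable v r := by
    intro k
    induction k with
    | zero => intro v hv; simp at hv; subst hv; exact SimpleGraph.Reachable.refl _
    | succ k ih =>
      intro v hv
      rw [Function.iterate_succ_apply] at hv
      by_cases e : v = p v
      · rw [e]; exact ih _ hv
      · have : (pGraph p).Adj v (p v) := (pGraph_adj _ _ _).2 ⟨e, Or.inl rfl⟩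
        exact this.reachable.trans (ih _ hv)
  have : Nonempty V := ⟨r⟩
  refine SimpleGraph.Connected.mk fun u v => ?_
  obtain ⟨k, hk⟩ := h.2 u
  obtain ⟨l, hl⟩ := h.2 v
  exact (key k u hk).trans (key l v hl).symm

lemma Rooted.isTree {V : Type*} [Fintype V] {r : V} {p : V → V} (h : Rooted r p) : (pGraph p).IsTree := by
  classical
  rw [SimpleGraph.isTree_iff_connected_and_card]
  refine ⟨h.connected, le_antisymm ?_ h.connected.card_vert_le_card_edgeSet_add_one⟩
  have h1 : (pGraph p).edgeSet ⊆ ((Finset.univ.erase r).image (fun v => s(v, p v)) : Finset (Sym2 V)) := by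
    intro e
    induction e using Sym2.ind with
    | _ u v =>
      intro huv
      rw [SimpleGraph.mem_edgeSet, pGraph_adj] at huv
      obtain ⟨hne, e | e⟩ := huv
      · subst e
        simp only [coe_image, Set.mem_image]
        refine ⟨u, ?_, rfl⟩
        have : u ≠ r := by rintro rfl; exact hne h.1.symm
        simp [this]
      · subst e
        simp only [coe_image, Set.mem_image]
        refine ⟨v, ?_, Sym2.eq_swap⟩
        have : v ≠ r := by rintro rfl; exact hne h.1
        simp [this]
  have h2 : Nat.card (pGraph p).edgeSet ≤ (Finset.univ.erase r).card := by
    rw [Nat.card_coe_set_eq]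
    refine (Set.ncard_le_ncard h1 (Finset.finite_toSet _)).trans ?_
    rw [Set.ncard_coe_finset]
    exact Finset.card_image_le
  rw [Finset.card_erase_of_mem (Finset.mem_univ _), Finset.card_univ] at h2
  have : 0 < Fintype.card V := Fintype.card_pos_iff.2 ⟨r⟩
  rw [Nat.card_eq_fintype_card (α := V)]
  omega

lemma Rooted.inj {V : Type*} {r : V} {p q : V → V} (hp : Rooted r p) (hq : Rooted r q)
    (h : pGraph p = pGraph q) : p = q := by
  have key : ∀ k v, p^[k] v = r → p v = q v := by
    intro k
    induction k with
    | zero => intro v hv; simp at hv; subst hv; rw [hp.1, hq.1]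
    | succ k ih =>
      intro v hv
      by_cases hvr : v = r
      · subst hvr; rw [hp.1, hq.1]
      rw [Function.iterate_succ_apply] at hv
      have h1 := ih _ hv
      have hadj : (pGraph p).Adj v (p v) := (pGraph_adj _ _ _).2 ⟨(hp.ne hvr).symm, Or.inl rfl⟩
      rw [h, pGraph_adj] at hadj
      rcases hadj.2 with e | e
      · exact e.symm
      · rw [← h1] at e
        exact absurd e (hp.ne2 hvr)
  funext v
  obtain ⟨k, hk⟩ := hp.2 v
  exact key k v hk

lemma exists_rooted {V : Type*} [Fintype V] (r : V) (T : SimpleGraph V) (hT : T.IsTree) :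
    ∃ p, Rooted r p ∧ pGraph p = T := by
  classical
  have h0 : ∀ v, ∃ u, (v = r ∧ u = r) ∨ (v ≠ r ∧ T.Adj v u ∧ T.dist u r + 1 = T.dist v r) := by
    intro v
    by_cases hv : v = r
    · exact ⟨r, Or.inl ⟨hv, rfl⟩⟩
    obtain ⟨w, hw⟩ := hT.connected.exists_walk_length_eq_dist v r
    cases w with
    | nil => exact absurd rfl hv
    | @cons _ u _ ha w' =>
      refine ⟨u, Or.inr ⟨hv, ha, ?_⟩⟩
      rw [SimpleGraph.Walk.length_cons] at hw
      have h1 := SimpleGraph.dist_le w'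
      have h2 := hT.connected.dist_triangle (u := v) (v := u) (w := r)
      have h3 := SimpleGraph.dist_eq_one_iff_adj.2 ha
      omega
  choose p hp using h0
  have hr : p r = r := by
    rcases hp r with h | h
    · exact h.2
    · exact absurd rfl h.1
  have hroot : Rooted r p := by
    refine ⟨hr, ?_⟩
    have : ∀ d v, T.dist v r = d → ∃ k, p^[k] v = r := by
      intro d
      induction d with
      | zero =>
        intro v hv
        exact ⟨0, (hT.connected.dist_eq_zero_iff).1 hv⟩
      | succ d ih =>
        intro v hv
        rcases hp v with h | h
        · exact ⟨0, h.1⟩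
        · obtain ⟨k, hk⟩ := ih (p v) (by omega)
          exact ⟨k+1, hk⟩
    exact fun v => this _ v rfl
  refine ⟨p, hroot, ?_⟩
  have hle : pGraph p ≤ T := by
    intro u v huv
    rw [pGraph_adj] at huv
    have : ∀ u, u ≠ p u → T.Adj u (p u) := by
      intro u hu
      rcases hp u with h | h
      · exact absurd (h.1.trans h.2.symm) hu
      · exact h.2.1
    obtain ⟨hne, e | e⟩ := huv
    · subst e; exact this _ hne
    · subst e; exact (this _ hne.symm).symm
  exact ((SimpleGraph.isTree_iff_minimal_connected.1 hT).eq_of_le hroot.connected hle)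

def eL {m : ℕ} (N : ℕ) (i : Fin m) : Fin (m + (N + 1)) := ⟨i.val, by omega⟩

def eR (m : ℕ) {N : ℕ} (o : Option (Fin N)) : Fin (m + (N + 1)) :=
  match o with
  | none => ⟨m + N, by omega⟩
  | some j => ⟨m + j.val, by omega⟩

lemma eR_inj (m : ℕ) {N : ℕ} : Function.Injective (eR m (N := N)) := by
  intro a b h
  rcases a with _ | a <;> rcases b with _ | b <;> simp [eR, Fin.ext_iff] at h ⊢ <;> omega

lemma eL_inj {m : ℕ} (N : ℕ) : Function.Injective (eL (m := m) N) := by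
  intro a b h
  simpa [eL, Fin.ext_iff] using h

lemma eL_or_eR {m N : ℕ} (v : Fin (m + (N + 1))) : (∃ i, v = eL N i) ∨ ∃ o, v = eR m o := by
  by_cases h : v.val < m
  · exact Or.inl ⟨⟨v, h⟩, rfl⟩
  · right
    by_cases h2 : v.val < m + N
    · exact ⟨some ⟨v - m, by omega⟩, by simp [eR, Fin.ext_iff]; omega⟩
    · exact ⟨none, by simp [eR, Fin.ext_iff]; omega⟩

lemma eL_val {m N : ℕ} (i : Fin m) : (eL N i).val < m := i.2
lemma eR_val {m N : ℕ} (o : Option (Fin N)) : m ≤ (eR m o).val := by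
  rcases o with _ | o <;> simp [eR]

lemma eL_ne_eR {m N : ℕ} (i : Fin m) (o : Option (Fin N)) : eL N i ≠ eR m o := by
  intro h
  have h1 := eL_val (N := N) i
  rw [h] at h1
  have := eR_val (m := m) o
  omega

def par {m N : ℕ} (f : Fin m → Option (Fin N)) (g : Fin N → Fin m) (v : Fin (m + (N + 1))) :
    Fin (m + (N + 1)) :=
  if h : v.val < m then eR m (f ⟨v, h⟩)
  else if h2 : v.val < m + N then eL N (g ⟨v - m, by omega⟩) else eR m none

lemma par_eL {m N : ℕ} (f : Fin m → Option (Fin N)) (g : Fin N → Fin m) (i : Fin m) :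
    par f g (eL N i) = eR m (f i) := by simp [par, eL]

lemma par_some {m N : ℕ} (f : Fin m → Option (Fin N)) (g : Fin N → Fin m) (j : Fin N) :
    par f g (eR m (some j)) = eL N (g j) := by simp [par, eR]

lemma par_none {m N : ℕ} (f : Fin m → Option (Fin N)) (g : Fin N → Fin m) :
    par f g (eR m none) = eR m none := by simp [par, eR]

lemma rooted_par_iff {m N : ℕ} (f : Fin m → Option (Fin N)) (g : Fin N → Fin m) :
    Rooted (eR m none) (par f g) ↔ AcycO (fun j => f (g j)) := by
  have hs : Function.Semiconj (eR m) (stepO fun j => f (g j)) ((par f g)^[2]) := by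
    intro o
    rcases o with _ | j
    · simp [stepO, par_none]
    · simp [stepO, par_some, par_eL]
  have hk : ∀ k o, ((par f g)^[2])^[k] (eR m o) = eR m ((stepO fun j => f (g j))^[k] o) :=
    fun k o => ((hs.iterate_right k) o).symm
  constructor
  · intro h j
    obtain ⟨k, hk'⟩ := h.2 (eR m (some j))
    refine ⟨k, eR_inj m ?_⟩
    rw [← hk, ← Function.iterate_mul, two_mul, Function.iterate_add_apply, hk',
      Function.iterate_fixed h.1]
  · intro h
    refine ⟨par_none f g, ?_⟩
    have hR : ∀ o, ∃ k, (par f g)^[k] (eR m o) = eR m none := by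
      intro o
      rcases o with _ | j
      · exact ⟨0, rfl⟩
      · obtain ⟨k, hk'⟩ := h j
        exact ⟨2 * k, by rw [Function.iterate_mul, hk, hk']⟩
    intro v
    rcases eL_or_eR v with ⟨i, rfl⟩ | ⟨o, rfl⟩
    · obtain ⟨k, hk'⟩ := hR (f i)
      exact ⟨k + 1, by rw [Function.iterate_succ_apply, par_eL, hk']⟩
    · exact hR o

lemma adj_root_iff {m N : ℕ} (f : Fin m → Option (Fin N)) (g : Fin N → Fin m)
    (w : Fin (m + (N + 1))) :
    (pGraph (par f g)).Adj (eR m none) w ↔ ∃ i, w = eL N i ∧ f i = none := by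
  rw [pGraph_adj, par_none]
  constructor
  · rintro ⟨h1, h2⟩
    rcases h2 with h2 | h2
    · exact absurd h2 h1
    rcases eL_or_eR w with ⟨i, rfl⟩ | ⟨o, rfl⟩
    · rw [par_eL] at h2
      exact ⟨i, rfl, eR_inj m h2⟩
    · rcases o with _ | j
      · exact absurd rfl h1
      · rw [par_some] at h2
        exact absurd h2 (eL_ne_eR _ _)
  · rintro ⟨i, rfl, hi⟩
    exact ⟨(eL_ne_eR _ _).symm, Or.inr (by rw [par_eL, hi])⟩

lemma par_le {m N : ℕ} (f : Fin m → Option (Fin N)) (g : Fin N → Fin m) :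
    pGraph (par f g) ≤
      SimpleGraph.fromRel (fun i j : Fin (m + (N + 1)) => i.val < m ∧ m ≤ j.val) := by
  intro u v huv
  rw [pGraph_adj] at huv
  rw [SimpleGraph.fromRel_adj]
  have key : ∀ u, u ≠ par f g u → (u.val < m ∧ m ≤ (par f g u).val) ∨
      ((par f g u).val < m ∧ m ≤ u.val) := by
    intro u hu
    rcases eL_or_eR u with ⟨i, rfl⟩ | ⟨o, rfl⟩
    · left; rw [par_eL]; exact ⟨eL_val _, eR_val _⟩
    · rcases o with _ | j
      · rw [par_none] at hu; exact absurd rfl hu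
      · right; rw [par_some]; exact ⟨eL_val _, eR_val _⟩
  refine ⟨huv.1, ?_⟩
  obtain ⟨hne, e | e⟩ := huv
  · subst e; exact key _ hne
  · subst e; exact (key _ hne.symm).symm

lemma exists_par {m N : ℕ} (p : Fin (m + (N + 1)) → Fin (m + (N + 1)))
    (hp : Rooted (eR m none) p)
    (hle : pGraph p ≤
      SimpleGraph.fromRel (fun i j : Fin (m + (N + 1)) => i.val < m ∧ m ≤ j.val)) :
    ∃ f g, p = par f g := by
  have key : ∀ u, u ≠ eR m none → (u.val < m ∧ m ≤ (p u).val) ∨ ((p u).val < m ∧ m ≤ u.val) := by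
    intro u hu
    have := hle ((pGraph_adj p u (p u)).2 ⟨(hp.ne hu).symm, Or.inl rfl⟩)
    rw [SimpleGraph.fromRel_adj] at this
    exact this.2
  have hf : ∀ i : Fin m, ∃ o, p (eL N i) = eR m o := by
    intro i
    have h1 := key _ (eL_ne_eR i none)
    have h2 := eL_val (N := N) i
    rcases eL_or_eR (p (eL N i)) with ⟨i', h⟩ | h
    · have := eL_val (N := N) i'
      rw [h] at h1; omega
    · exact h
  have hg : ∀ j : Fin N, ∃ i, p (eR m (some j)) = eL N i := by
    intro j
    have h1 := key (eR m (some j)) (fun h => by simpa using eR_inj m h)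
    have h2 := eR_val (m := m) (some j)
    rcases eL_or_eR (p (eR m (some j))) with h | ⟨o, h⟩
    · exact h
    · have := eR_val (m := m) o
      rw [h] at h1; omega
  choose f hf using hf
  choose g hg using hg
  refine ⟨f, g, ?_⟩
  funext v
  rcases eL_or_eR v with ⟨i, rfl⟩ | ⟨o, rfl⟩
  · rw [hf, par_eL]
  · rcases o with _ | j
    · rw [par_none, hp.1]
    · rw [hg, par_some]

lemma par_inj {m N : ℕ} {f f' : Fin m → Option (Fin N)} {g g' : Fin N → Fin m}
    (h : par f g = par f' g') : f = f' ∧ g = g' := by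
  constructor
  · funext i
    have := congrFun h (eL N i)
    rw [par_eL, par_eL] at this
    exact eR_inj m this
  · funext j
    have := congrFun h (eR m (some j))
    rw [par_some, par_some] at this
    exact eL_inj N this

lemma card_trees {m N : ℕ} (a : Fin m) :
    Nat.card {T : SimpleGraph (Fin (m + (N + 1))) //
        T ≤ SimpleGraph.fromRel (fun i j : Fin (m + (N + 1)) => i.val < m ∧ m ≤ j.val) ∧
        T.IsTree ∧ T.Adj (eR m none) (eL N a) ∧
        ∀ w : Fin (m + (N + 1)), T.Adj (eR m none) w → w ≤ eL N a} =
    Nat.card {x : (Fin m → Option (Fin N)) × (Fin N → Fin m) //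
      (x.1 a = none ∧ ∀ v, x.1 v = none → v ≤ a) ∧ AcycO (fun j => x.1 (x.2 j))} := by
  symm
  refine Nat.card_congr (Equiv.ofBijective (fun x => ⟨pGraph (par x.1.1 x.1.2), par_le _ _,
    ((rooted_par_iff _ _).2 x.2.2).isTree, (adj_root_iff _ _ _).2 ⟨a, rfl, x.2.1.1⟩, ?_⟩) ⟨?_, ?_⟩)
  · intro w hw
    obtain ⟨i, rfl, hi⟩ := (adj_root_iff _ _ _).1 hw
    exact x.2.1.2 i hi
  · rintro ⟨⟨f, g⟩, hx⟩ ⟨⟨f', g'⟩, hy⟩ h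
    have h1 : pGraph (par f g) = pGraph (par f' g') := congrArg Subtype.val h
    have h2 := par_inj (Rooted.inj ((rooted_par_iff _ _).2 hx.2) ((rooted_par_iff _ _).2 hy.2) h1)
    exact Subtype.ext (Prod.ext h2.1 h2.2)
  · rintro ⟨T, hT1, hT2, hT3, hT4⟩
    obtain ⟨p, hp, rfl⟩ := exists_rooted (eR m none) T hT2
    obtain ⟨f, g, rfl⟩ := exists_par p hp hT1
    refine ⟨⟨(f, g), ⟨?_, ?_⟩, (rooted_par_iff _ _).1 hp⟩, rfl⟩
    · obtain ⟨i, hi, hi'⟩ := (adj_root_iff _ _ _).1 hT3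
      rw [eL_inj N hi]; exact hi'
    · intro v hv
      exact hT4 (eL N v) ((adj_root_iff _ _ _).2 ⟨v, rfl, hv⟩)

open Classical in
lemma card_pairs {m N : ℕ} (hN : 1 ≤ N) (a : Fin m) :
    Nat.card {x : (Fin m → Option (Fin N)) × (Fin N → Fin m) //
      (x.1 a = none ∧ ∀ v, x.1 v = none → v ≤ a) ∧ AcycO (fun j => x.1 (x.2 j))} =
    (∑ f : Fin m → Option (Fin N) with (f a = none ∧ ∀ v, f v = none → v ≤ a),
      #{v | f v = none}) * m ^ (N - 1) := by
  have : Nonempty (Fin N) := ⟨⟨0, hN⟩⟩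
  rw [Nat.card_eq_fintype_card, Fintype.card_subtype, Finset.card_filter, Fintype.sum_prod_type,
    Finset.sum_mul, Finset.sum_filter]
  refine Finset.sum_congr rfl fun f _ => ?_
  by_cases hf : f a = none ∧ ∀ v, f v = none → v ≤ a
  · rw [if_pos hf]
    have hf' : (f a = none ∧ ∀ v, f v = none → v ≤ a) = True := eq_true hf
    simp only [hf', true_and]
    rw [← Finset.card_filter]
    have := weighted_cayley (B := Fin N) (X := Fin m) f
    simp only [Fintype.card_fin] at this
    convert this using 2
    ext g
    simp only [mem_filter, mem_univ]
  · simp only [hf, false_and, if_false, Finset.sum_const_zero]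

open Classical in
lemma sum_roots {m N : ℕ} (a : Fin m) :
    (N + 1) * (∑ f : Fin m → Option (Fin N) with (f a = none ∧ ∀ v, f v = none → v ≤ a),
      #{v | f v = none}) = (N + 1) ^ a.val * N ^ (m - 1 - a.val) * (N + 1 + a.val) := by
  let S : Fin m → Finset (Option (Fin N)) := fun v =>
    if v < a then univ else if v = a then {none} else {none}ᶜ
  have hS : (Finset.univ.filter fun f : Fin m → Option (Fin N) =>
      (f a = none ∧ ∀ v, f v = none → v ≤ a)) = Fintype.piFinset S := by
    ext f
    simp only [mem_filter, mem_univ, true_and, Fintype.mem_piFinset, S]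
    constructor
    · rintro ⟨h1, h2⟩ v
      rcases lt_trichotomy v a with h | h | h
      · simp [h]
      · subst h; simp [h1]
      · simp only [h.not_gt, h.ne', if_false, mem_compl, mem_singleton]
        intro hv; exact absurd (h2 v hv) (not_le.2 h)
    · intro h
      refine ⟨by simpa using h a, fun v hv => ?_⟩
      by_contra hlt
      rw [not_le] at hlt
      have := h v
      simp [hlt.not_gt, hlt.ne', hv] at this
  have hc : ∀ v, #(S v) = if v < a then N + 1 else if v = a then 1 else N := by
    intro v
    simp only [S]
    split_ifs <;> simp [Finset.card_compl]
  have hP : ∏ v, #(S v) = (N + 1) ^ a.val * N ^ (m - 1 - a.val) := by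
    simp only [hc]
    rw [Finset.prod_ite, Finset.prod_const, Finset.prod_ite, Finset.prod_const, Finset.prod_const,
      one_pow, one_mul]
    congr 2
    · rw [Finset.filter_gt_eq_Iio, Fin.card_Iio]
    · have : ({x ∈ ({x | ¬ x < a} : Finset (Fin m)) | ¬ x = a}) = Finset.Ioi a := by
        ext x
        simp only [mem_filter, mem_univ, true_and, mem_Ioi, not_lt]
        exact ⟨fun h => lt_of_le_of_ne h.1 (Ne.symm h.2), fun h => ⟨h.le, h.ne'⟩⟩
      rw [this, Fin.card_Ioi]
  rw [hS]
  simp only [Finset.card_filter]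
  rw [Finset.sum_comm, Finset.mul_sum]
  have hv : ∀ v, (N + 1) * ∑ f ∈ Fintype.piFinset S, (if f v = none then 1 else 0) =
      if v < a then ∏ v, #(S v) else if v = a then (N + 1) * ∏ v, #(S v) else 0 := by
    intro v
    rw [← Finset.card_filter]
    rcases lt_trichotomy v a with h | h | h
    · rw [if_pos h]
      have : (Fintype.piFinset S).filter (fun f => f v = none) =
          Fintype.piFinset (Function.update S v {none}) := by
        ext f
        simp only [mem_filter, Fintype.mem_piFinset]
        constructor
        · rintro ⟨h1, h2⟩ u
          by_cases hu : u = v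
          · subst hu; simp [h2]
          · simp [hu, h1 u]
        · intro h1
          refine ⟨fun u => ?_, by simpa using h1 v⟩
          by_cases hu : u = v
          · subst hu; simp [S, h]
          · simpa [hu] using h1 u
      rw [this, Fintype.card_piFinset, ← Finset.mul_prod_erase univ _ (Finset.mem_univ v),
        ← Finset.mul_prod_erase univ (fun v => #(S v)) (Finset.mem_univ v), hc v, if_pos h]
      simp only [Function.update_self, card_singleton, one_mul]
      congr 1
      refine Finset.prod_congr rfl fun u hu => ?_
      rw [Function.update_of_ne (Finset.ne_of_mem_erase hu)]
    · subst h
      simp only [lt_irrefl, if_false, if_true]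
      rw [Finset.filter_true_of_mem, Fintype.card_piFinset]
      intro f hf
      rw [← hS] at hf
      simp only [mem_filter] at hf
      exact hf.2.1
    · rw [if_neg h.not_gt, if_neg h.ne', Finset.filter_false_of_mem]
      · simp
      intro f hf
      rw [← hS] at hf
      simp only [mem_filter] at hf
      exact fun e => absurd (hf.2.2 v e) (not_le.2 h)
  rw [Finset.sum_congr rfl fun v _ => hv v, hP]
  have h1 : ∀ P : ℕ, (∑ v : Fin m, if v < a then P else if v = a then (N + 1) * P else 0) =
      P * (N + 1 + a.val) := by
    intro P
    have : ∀ v : Fin m, (if v < a then P else if v = a then (N + 1) * P else 0) =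
        (if v < a then P else 0) + (if v = a then (N + 1) * P else 0) := by
      intro v
      by_cases h : v < a
      · simp [h, h.ne]
      · simp [h]
    simp only [this, Finset.sum_add_distrib]
    rw [Finset.sum_ite_eq' univ a, ← Finset.sum_filter, Finset.sum_const, Finset.filter_gt_eq_Iio,
      Fin.card_Iio]
    simp
    ring
  exact h1 _


/-- The number `N_k` of spanning trees of `K_{m,n}` in which the largest neighbor of the
vertex `m+n` (index `m+n-1` in `Fin (m+n)`) equals `m+1-k` (index `m-k`) satisfies
`n * N_k = m^(n-2) * n^(m-k) * (n-1)^(k-1) * (m+n-k)`. -/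
theorem uprooted_spanning_trees_Kmn_highest_child (m n k : ℕ)
    (hm : 1 ≤ m) (hn : 2 ≤ n) (hk1 : 1 ≤ k) (hk2 : k ≤ m) :
    n * Nat.card {T : SimpleGraph (Fin (m + n)) //
        T ≤ SimpleGraph.fromRel (fun i j : Fin (m + n) => i.val < m ∧ m ≤ j.val) ∧
        T.IsTree ∧
        T.Adj ⟨m + n - 1, by omega⟩ ⟨m - k, by omega⟩ ∧
        ∀ w : Fin (m + n), T.Adj ⟨m + n - 1, by omega⟩ w → w ≤ ⟨m - k, by omega⟩} =
      m ^ (n - 2) * n ^ (m - k) * (n - 1) ^ (k - 1) * (m + n - k) := by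
  obtain ⟨N, rfl⟩ : ∃ N, n = N + 1 := ⟨n - 1, by omega⟩
  have h1 := card_trees (m := m) (N := N) ⟨m - k, by omega⟩
  rw [card_pairs (by omega)] at h1
  have h2 := sum_roots (m := m) (N := N) ⟨m - k, by omega⟩
  refine (congrArg (fun x => (N + 1) * x) h1).trans ?_
  rw [← mul_assoc, h2]
  have e1 : m - 1 - (m - k) = k - 1 := by omega
  have e2 : N + 1 + (m - k) = m + (N + 1) - k := by omega
  have e3 : N + 1 - 2 = N - 1 := by omega
  simp only [e1, e2, e3, Nat.add_sub_cancel]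
  ring
end

section
/- Let n ≥ 2, 0 ≤ k ≤ n−2, and 1 ≤ j ≤ n−k−1. Let N_{k,j} be the number of spanning trees T of the complete graph K_n such that the largest neighbor of the vertex n−k in T equals n−k−j (i.e., the number of uprooted spanning trees of K_n with root n−k whose highest child equals n−k−j). Then n(n−1) · N_{k,j} = n^{n−k−j−1} · (n−1)^{k+j−1} · (2n−k−j−1). -/
namespace UprootedTrees

inductive Reach {V : Type*} (f : V → V) (R : Finset V) : V → Prop
  | base (x : V) : x ∈ R → Reach f R x
  | step (x : V) : Reach f R (f x) → Reach f R x

lemma Reach.mem_of_fixed {V : Type*} {f : V → V} {R : Finset V} {x : V}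
    (h : Reach f R x) : f x = x → x ∈ R := by
  induction h with
  | base x hx => intro _; exact hx
  | step x _ ih =>
    intro hx
    rw [hx] at ih
    exact ih hx

open Classical in
noncomputable def FS {V : Type*} [Fintype V] (R Q : Finset V) : Finset (V → V) :=
  Finset.univ.filter fun f => (∀ x, x ∉ Q → f x = x) ∧ ∀ x ∈ Q, Reach f R x

lemma mem_FS {V : Type*} [Fintype V] {R Q : Finset V} {f : V → V} :
    f ∈ FS R Q ↔ (∀ x, x ∉ Q → f x = x) ∧ ∀ x ∈ Q, Reach f R x := by
  simp [FS]

lemma card_fiber {V : Type*} [Fintype V] [DecidableEq V] (R Q C : Finset V) (a : V)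
    (ha : a ∈ R) (hd : Disjoint R Q) (hC : C ⊆ Q) :
    ((FS R Q).filter fun f => Q.filter (fun x => f x = a) = C).card =
      (FS (R.erase a ∪ C) (Q \ C)).card := by
  have haQ : a ∉ Q := Finset.disjoint_left.1 hd ha
  have haC : a ∉ C := fun h => haQ (hC h)
  refine Finset.card_nbij' (fun f x => if x ∈ C then x else f x)
    (fun g x => if x ∈ C then a else g x) ?_ ?_ ?_ ?_
  · intro f hf
    simp only [Finset.coe_filter, Set.mem_ofPred_eq, mem_FS] at hf
    obtain ⟨⟨h1, h2⟩, h3⟩ := hf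
    have hCm : ∀ x, x ∈ C ↔ x ∈ Q ∧ f x = a := by intro x; rw [← h3]; simp
    simp only [Finset.mem_coe, mem_FS]
    have key : ∀ x, Reach f R x → x = a ∨
        Reach (fun x => if x ∈ C then x else f x) (R.erase a ∪ C) x := by
      intro x hx
      induction hx with
      | base x hx =>
        by_cases hxa : x = a
        · exact Or.inl hxa
        · exact Or.inr (Reach.base _ (by simp [hxa, hx]))
      | step x _ ih =>
        by_cases hxC : x ∈ C
        · exact Or.inr (Reach.base _ (by simp [hxC]))
        · rcases ih with h | h
          · left
            by_cases hxQ : x ∈ Q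
            · exact absurd ((hCm x).2 ⟨hxQ, h⟩) hxC
            · rw [← h, h1 x hxQ]
          · right
            apply Reach.step
            simpa [hxC] using h
    refine ⟨?_, ?_⟩
    · intro x hx
      by_cases hxC : x ∈ C
      · simp [hxC]
      · simp only [hxC, if_false]
        apply h1
        intro h; exact hx (by simp [h, hxC])
    · intro x hx
      rw [Finset.mem_sdiff] at hx
      rcases key x (h2 x hx.1) with h | h
      · subst h; exact absurd hx.1 haQ
      · exact h
  · intro g hg
    simp only [Finset.mem_coe, mem_FS] at hg
    obtain ⟨h1, h2⟩ := hg
    simp only [Finset.coe_filter, Set.mem_ofPred_eq, mem_FS]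
    have hstepC : ∀ x ∈ C, Reach (fun x => if x ∈ C then a else g x) R x := by
      intro x hx
      apply Reach.step
      simp only [hx, if_true]
      exact Reach.base _ ha
    have key : ∀ x, Reach g (R.erase a ∪ C) x →
        Reach (fun x => if x ∈ C then a else g x) R x := by
      intro x hx
      induction hx with
      | base x hx =>
        rcases Finset.mem_union.1 hx with h | h
        · exact Reach.base _ (Finset.mem_of_mem_erase h)
        · exact hstepC x h
      | step x _ ih =>
        by_cases hxC : x ∈ C
        · exact hstepC x hxC
        · apply Reach.step
          simpa [hxC] using ih
    refine ⟨⟨?_, ?_⟩, ?_⟩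
    · intro x hx
      have hxC : x ∉ C := fun h => hx (hC h)
      simp only [hxC, if_false]
      exact h1 x (by simp [hx])
    · intro x hx
      by_cases hxC : x ∈ C
      · exact hstepC x hxC
      · exact key x (h2 x (by simp [hx, hxC]))
    · ext x
      simp only [Finset.mem_filter]
      constructor
      · rintro ⟨hxQ, hx⟩
        by_contra hxC
        simp only [hxC, if_false] at hx
        have hr := h2 x (by simp [hxQ, hxC])
        have hga : g a = a := h1 a (by simp [haQ])
        have hra : Reach g (R.erase a ∪ C) a := by
          cases hr with
          | base _ h =>
            rcases Finset.mem_union.1 h with h | h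
            · exact absurd hxQ (Finset.disjoint_left.1 hd (Finset.mem_of_mem_erase h))
            · exact absurd h hxC
          | step _ h => rwa [hx] at h
        have := hra.mem_of_fixed hga
        simp [haC] at this
      · intro hx
        exact ⟨hC hx, by simp [hx]⟩
  · intro f hf
    simp only [Finset.coe_filter, Set.mem_ofPred_eq, mem_FS] at hf
    obtain ⟨⟨h1, h2⟩, h3⟩ := hf
    have hCm : ∀ x, x ∈ C ↔ x ∈ Q ∧ f x = a := by intro x; rw [← h3]; simp
    funext x
    by_cases hxC : x ∈ C
    · simp [hxC, ((hCm x).1 hxC).2]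
    · simp [hxC]
  · intro g hg
    simp only [Finset.mem_coe, mem_FS] at hg
    funext x
    by_cases hxC : x ∈ C
    · simp [hxC, hg.1 x (by simp [hxC])]
    · simp [hxC]

lemma sum_identity {V : Type*} [DecidableEq V] (s : ℕ) (Q : Finset V) : ∀ b : ℕ,
    (s + 1) * ∑ C ∈ Q.powerset, (b + C.card) * s ^ (Q.card - C.card) =
      (b * (s + 1) + Q.card) * (s + 1) ^ Q.card := by
  induction Q using Finset.induction_on with
  | empty => intro b; simp; ring
  | insert a Q ha ih =>
    intro b
    rw [Finset.sum_powerset_insert ha, Finset.card_insert_of_notMem ha]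
    have e1 : ∑ C ∈ Q.powerset, (b + C.card) * s ^ (Q.card + 1 - C.card) =
        s * ∑ C ∈ Q.powerset, (b + C.card) * s ^ (Q.card - C.card) := by
      rw [Finset.mul_sum]
      refine Finset.sum_congr rfl fun C hC => ?_
      have := Finset.card_le_card (Finset.mem_powerset.1 hC)
      rw [Nat.sub_add_comm this, pow_succ]; ring
    have e2 : ∑ C ∈ Q.powerset, (b + (insert a C).card) * s ^ (Q.card + 1 - (insert a C).card) =
        ∑ C ∈ Q.powerset, (b + 1 + C.card) * s ^ (Q.card - C.card) := by
      refine Finset.sum_congr rfl fun C hC => ?_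
      rw [Finset.card_insert_of_notMem (fun h => ha (Finset.mem_powerset.1 hC h)),
        Nat.add_sub_add_right]
      ring
    rw [e1, e2, mul_add, ih (b + 1), mul_left_comm, ih b]
    ring

lemma card_FS {V : Type*} [Fintype V] [DecidableEq V] : ∀ (s : ℕ) (R Q : Finset V),
    Disjoint R Q → R.card + Q.card = s → s * (FS R Q).card = R.card * s ^ Q.card := by
  intro s
  induction s with
  | zero => intro R Q _ h; have : R.card = 0 := by omega
            simp [this]
  | succ s ih =>
    intro R Q hd hs
    rcases R.eq_empty_or_nonempty with rfl | ⟨a, ha⟩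
    · have : FS (∅ : Finset V) Q = ∅ := by
        rw [Finset.eq_empty_iff_forall_notMem]
        intro f hf
        rw [mem_FS] at hf
        have hQ : 0 < Q.card := by simp at hs; omega
        obtain ⟨x, hx⟩ := Finset.card_pos.1 hQ
        have hno : ∀ x, Reach f (∅ : Finset V) x → False := by
          intro x hx
          induction hx with
          | base x hx => simp at hx
          | step x _ ih => exact ih
        exact hno x (hf.2 x hx)
      simp [this]
    · have hR : 0 < R.card := Finset.card_pos.2 ⟨a, ha⟩
      have hsum : (FS R Q).card =
          ∑ C ∈ Q.powerset, (FS (R.erase a ∪ C) (Q \ C)).card := by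
        rw [Finset.card_eq_sum_card_fiberwise (t := Q.powerset)
          (f := fun f : V → V => Q.filter (fun x => f x = a))]
        · exact Finset.sum_congr rfl fun C hC =>
            card_fiber R Q C a ha hd (Finset.mem_powerset.1 hC)
        · intro f _
          exact Finset.mem_coe.2 (Finset.mem_powerset.2 (Finset.filter_subset _ _))
      have hterm : ∀ C ∈ Q.powerset, s * (FS (R.erase a ∪ C) (Q \ C)).card =
          ((R.card - 1) + C.card) * s ^ (Q.card - C.card) := by
        intro C hC
        have hCQ := Finset.mem_powerset.1 hC
        have hle := Finset.card_le_card hCQ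
        have hdis : Disjoint (R.erase a) C :=
          (hd.mono_left (Finset.erase_subset _ _)).mono_right hCQ
        have c1 : (R.erase a ∪ C).card = (R.card - 1) + C.card := by
          rw [Finset.card_union_of_disjoint hdis, Finset.card_erase_of_mem ha]
        have c2 : (Q \ C).card = Q.card - C.card := Finset.card_sdiff_of_subset hCQ
        have := ih (R.erase a ∪ C) (Q \ C) (by
          rw [Finset.disjoint_union_left]
          exact ⟨(hd.mono_left (Finset.erase_subset _ _)).mono_right Finset.sdiff_subset,
            Finset.disjoint_sdiff⟩) (by rw [c1, c2]; omega)
        rw [this, c1, c2]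
      rcases Nat.eq_zero_or_pos s with rfl | hspos
      · have hQ : Q = ∅ := by rw [← Finset.card_eq_zero]; omega
        have hR1 : R.card = 1 := by omega
        subst hQ
        have : FS R ∅ = {id} := by
          ext f
          simp only [mem_FS, Finset.mem_singleton]
          constructor
          · intro h; funext x; exact h.1 x (by simp)
          · rintro rfl; simp
        simp [this, hR1]
      · have h1 := sum_identity s Q (R.card - 1)
        rw [← Finset.sum_congr rfl hterm, ← Finset.mul_sum, ← hsum] at h1
        have h2 : (R.card - 1) * (s + 1) + Q.card = R.card * s := by
          obtain ⟨r, hr⟩ : ∃ r, R.card = r + 1 := ⟨R.card - 1, by omega⟩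
          rw [hr] at hs ⊢
          have : Q.card = s - r := by omega
          have hrs : r ≤ s := by omega
          simp only [Nat.add_sub_cancel]
          obtain ⟨t, rfl⟩ := Nat.exists_eq_add_of_le hrs
          rw [this]; simp; ring
        rw [h2] at h1
        apply Nat.eq_of_mul_eq_mul_left hspos
        linarith


def gr {V : Type*} (f : V → V) : SimpleGraph V := SimpleGraph.fromRel (fun x y => f x = y)

lemma gr_adj {V : Type*} (f : V → V) (x y : V) :
    (gr f).Adj x y ↔ x ≠ y ∧ (f x = y ∨ f y = x) := by
  simp [gr]

lemma gr_connected {V : Type*} (f : V → V) (r : V)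
    (h : ∀ x, Reach f {r} x) : (gr f).Connected := by
  have key : ∀ x, (gr f).Reachable x r := by
    intro x
    induction h x with
    | base x hx => rw [Finset.mem_singleton.1 hx]
    | step x _ ih =>
      by_cases hx : f x = x
      · rwa [hx] at ih
      · exact (SimpleGraph.Adj.reachable ((gr_adj f x (f x)).2 ⟨fun h => hx h.symm, Or.inl rfl⟩)).trans ih
  have : Nonempty V := ⟨r⟩
  exact SimpleGraph.Connected.mk fun x y => (key x).trans (key y).symm

lemma reach_all {V : Type*} [Fintype V] [DecidableEq V] {r : V} {f : V → V}
    (hf : f ∈ FS {r} {r}ᶜ) (x : V) : Reach f {r} x := by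
  by_cases hx : x = r
  · exact Reach.base _ (by simp [hx])
  · exact (mem_FS.1 hf).2 x (by simp [hx])

lemma FS_root {V : Type*} [Fintype V] [DecidableEq V] {r : V} {f : V → V}
    (hf : f ∈ FS {r} {r}ᶜ) : f r = r := (mem_FS.1 hf).1 r (by simp)

lemma gr_isTree {V : Type*} [Fintype V] [DecidableEq V] {r : V} {f : V → V}
    (hf : f ∈ FS {r} {r}ᶜ) : (gr f).IsTree := by
  have hc := gr_connected f r (reach_all hf)
  rw [SimpleGraph.isTree_iff_connected_and_card]
  refine ⟨hc, le_antisymm ?_ hc.card_vert_le_card_edgeSet_add_one⟩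
  have hsub : (gr f).edgeSet ⊆
      (((({r}ᶜ : Finset V)).image (fun x => s(x, f x)) : Finset (Sym2 V)) : Set (Sym2 V)) := by
    intro e he
    induction e using Sym2.ind with
    | _ x y =>
      rw [SimpleGraph.mem_edgeSet, gr_adj] at he
      obtain ⟨hne, h | h⟩ := he
      · simp only [Finset.coe_image, Set.mem_image, Finset.mem_coe]
        refine ⟨x, ?_, by rw [h]⟩
        simp only [Finset.mem_compl, Finset.mem_singleton]
        rintro rfl
        exact hne ((FS_root hf).symm.trans h)
      · simp only [Finset.coe_image, Set.mem_image, Finset.mem_coe]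
        refine ⟨y, ?_, by rw [h, Sym2.eq_swap]⟩
        simp only [Finset.mem_compl, Finset.mem_singleton]
        rintro rfl
        exact hne (h.symm.trans (FS_root hf))
  have h1 : Nat.card (gr f).edgeSet ≤ (({r}ᶜ : Finset V)).card := by
    rw [Nat.card_coe_set_eq]
    refine (Set.ncard_le_ncard hsub (Finset.finite_toSet _)).trans ?_
    rw [Set.ncard_coe_finset]
    exact Finset.card_image_le
  have h2 : (({r}ᶜ : Finset V)).card + 1 = Fintype.card V := by
    rw [Finset.card_compl, Finset.card_singleton]
    have : 0 < Fintype.card V := Fintype.card_pos_iff.2 ⟨r⟩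
    omega
  rw [Nat.card_eq_fintype_card (α := V)]
  omega

lemma gr_injOn {V : Type*} [Fintype V] [DecidableEq V] {r : V} {f g : V → V}
    (hf : f ∈ FS {r} {r}ᶜ) (hg : g ∈ FS {r} {r}ᶜ) (h : gr f = gr g) : f = g := by
  have nofix : ∀ x, f x = x → x = r := fun x hx => by
    simpa using (reach_all hf x).mem_of_fixed hx
  have no2 : ∀ x, Reach f {r} x → ∀ y, f x = y → f y = x → x = r ∨ y = r := by
    intro x hx
    induction hx with
    | base x hx => intro y _ _; left; simpa using hx
    | step x _ ih =>
      intro y h1 h2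
      subst h1
      exact (ih x h2 rfl).symm
  funext x
  induction reach_all hf x with
  | base x hx =>
    rw [Finset.mem_singleton.1 hx, FS_root hf, FS_root hg]
  | step x _ ih =>
    by_cases hx : f x = x
    · rw [nofix x hx, FS_root hf, FS_root hg]
    · have hadj : (gr f).Adj x (f x) := (gr_adj f x (f x)).2 ⟨fun h => hx h.symm, Or.inl rfl⟩
      rw [h, gr_adj] at hadj
      rcases hadj.2 with h' | h'
      · exact h'.symm
      · rw [← ih] at h'
        rcases no2 x (reach_all hf x) _ rfl h' with h3 | h3
        · subst h3; exact absurd (FS_root hf) hx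
        · rw [h3, FS_root hf] at h'
          rw [h3] at hx
          exact absurd h' hx

lemma exists_fn {V : Type*} [Fintype V] [DecidableEq V] (r : V) (T : SimpleGraph V)
    (hT : T.IsTree) : ∃ f ∈ FS {r} {r}ᶜ, gr f = T := by
  have hpar : ∀ x, ∃ y, (x = r → y = r) ∧ (x ≠ r → T.Adj x y ∧ T.dist y r < T.dist x r) := by
    intro x
    by_cases hx : x = r
    · exact ⟨r, fun _ => rfl, fun h => absurd hx h⟩
    · obtain ⟨p, hp⟩ := hT.connected.exists_walk_length_eq_dist x r
      cases p with
      | nil => exact absurd rfl hx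
      | cons hadj q =>
        rename_i y
        refine ⟨y, fun h => absurd h hx, fun _ => ⟨hadj, ?_⟩⟩
        have := SimpleGraph.dist_le q
        rw [SimpleGraph.Walk.length_cons] at hp
        omega
  choose f hf1 hf2 using hpar
  have hreach : ∀ d x, T.dist x r = d → Reach f {r} x := by
    intro d
    induction d using Nat.strong_induction_on with
    | _ d ih =>
      intro x hx
      by_cases hxr : x = r
      · exact Reach.base _ (by simp [hxr])
      · apply Reach.step
        exact ih _ (hx ▸ (hf2 x hxr).2) _ rfl
  have hmem : f ∈ FS {r} {r}ᶜ := by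
    rw [mem_FS]
    refine ⟨fun x hx => ?_, fun x _ => hreach _ x rfl⟩
    have : x = r := by simpa using hx
    rw [hf1 x this, this]
  refine ⟨f, hmem, ?_⟩
  have hle : gr f ≤ T := by
    intro x y hxy
    rw [gr_adj] at hxy
    obtain ⟨hne, h | h⟩ := hxy
    · have hx : x ≠ r := fun hx => hne (by rw [← h, hf1 x hx, hx])
      exact h ▸ (hf2 x hx).1
    · have hy : y ≠ r := fun hy => hne (by rw [← h, hf1 y hy, hy])
      exact (h ▸ (hf2 y hy).1).symm
  have hmin := SimpleGraph.isTree_iff_minimal_connected.1 hT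
  exact le_antisymm hle (hmin.2 (gr_connected f r (fun x => hreach _ x rfl)) hle)

lemma card_trees (n : ℕ) (r s : Fin n) (hsr : s < r) :
    n * (n - 1) * Nat.card {T : SimpleGraph (Fin n) // T ≤ ⊤ ∧ T.IsTree ∧
        T.Adj r s ∧ ∀ w : Fin n, T.Adj r w → w ≤ s} =
      n ^ (s : ℕ) * (n - 1) ^ (n - 2 - (s : ℕ)) * (n + (s : ℕ)) := by
  classical
  set Q : Finset (Fin n) := {r}ᶜ with hQ
  set F := (FS {r} Q).filter (fun f => f s = r ∧ ∀ w, w ≠ r → f w = r → w ≤ s) with hF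
  have hadj : ∀ f ∈ FS {r} Q, ∀ w, (gr f).Adj r w ↔ w ≠ r ∧ f w = r := by
    intro f hf w
    rw [gr_adj, FS_root hf]
    constructor
    · rintro ⟨h1, h2 | h2⟩
      · exact absurd h2 h1
      · exact ⟨h1.symm, h2⟩
    · rintro ⟨h1, h2⟩
      exact ⟨h1.symm, Or.inr h2⟩
  have hcard : Nat.card {T : SimpleGraph (Fin n) // T ≤ ⊤ ∧ T.IsTree ∧
        T.Adj r s ∧ ∀ w : Fin n, T.Adj r w → w ≤ s} = F.card := by
    rw [← Set.ncard_coe_finset F, ← Nat.card_coe_set_eq]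
    symm
    refine Nat.card_congr (Equiv.ofBijective
      (fun f => ⟨gr f.1, le_top, ?_, ?_, ?_⟩) ⟨?_, ?_⟩)
    · have := f.2
      simp only [hF, Finset.coe_filter, Set.mem_ofPred_eq] at this
      exact gr_isTree this.1
    · have := f.2
      simp only [hF, Finset.coe_filter, Set.mem_ofPred_eq] at this
      exact (hadj _ this.1 s).2 ⟨hsr.ne, this.2.1⟩
    · have := f.2
      simp only [hF, Finset.coe_filter, Set.mem_ofPred_eq] at this
      intro w hw
      have hw' := (hadj _ this.1 w).1 hw
      exact this.2.2 w hw'.1 hw'.2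
    · rintro ⟨f, hf⟩ ⟨g, hg⟩ h
      simp only [hF, Finset.coe_filter, Set.mem_ofPred_eq] at hf hg
      simp only [Subtype.mk.injEq] at h ⊢
      exact gr_injOn hf.1 hg.1 h
    · rintro ⟨T, _, hT, h1, h2⟩
      obtain ⟨f, hf, rfl⟩ := exists_fn r T hT
      refine ⟨⟨f, ?_⟩, rfl⟩
      simp only [hF, Finset.coe_filter, Set.mem_ofPred_eq]
      exact ⟨hf, ((hadj f hf s).1 h1).2, fun w hw hw' => h2 w ((hadj f hf w).2 ⟨hw, hw'⟩)⟩
  have hrQ : r ∉ Q := by simp [hQ]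
  have hsQ : s ∈ Q := by simp [hQ, hsr.ne]
  have hQc : Q.card = n - 1 := by simp [hQ, Finset.card_compl]
  have hIQ : Finset.Iio s ⊆ Q := by
    intro x hx
    have := Finset.mem_Iio.1 hx
    simp [hQ, (this.trans hsr).ne]
  have hIc : (Finset.Iio s).card = (s : ℕ) := by simp
  have hsum : F.card = ∑ C ∈ (Finset.Iio s).powerset,
      (FS (insert s C) (Q \ insert s C)).card := by
    rw [Finset.card_eq_sum_card_fiberwise (t := (Finset.Iio s).powerset)
      (f := fun f : Fin n → Fin n => (Q.filter (fun x => f x = r)).erase s)]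
    · refine Finset.sum_congr rfl fun C hC => ?_
      have hCI := Finset.mem_powerset.1 hC
      have hsC : s ∉ C := fun h => by simpa using hCI h
      have hfib := card_fiber {r} Q (insert s C) r (by simp) (by simpa using hrQ)
        (Finset.insert_subset hsQ (hCI.trans hIQ))
      simp only [Finset.erase_singleton, Finset.empty_union] at hfib
      rw [← hfib]
      congr 1
      ext f
      simp only [hF, Finset.mem_filter]
      constructor
      · rintro ⟨⟨h1, h2, h3⟩, h4⟩
        refine ⟨h1, ?_⟩
        rw [← h4, Finset.insert_erase]
        simp [hsQ, h2]
      · rintro ⟨h1, h2⟩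
        have hm : ∀ x, x ∈ Q ∧ f x = r ↔ x = s ∨ x ∈ C := by
          intro x
          rw [← Finset.mem_insert, ← h2, Finset.mem_filter]
        refine ⟨⟨h1, ((hm s).2 (Or.inl rfl)).2, ?_⟩, ?_⟩
        · intro w hw hfw
          rcases (hm w).1 ⟨by simp [hQ, hw], hfw⟩ with h | h
          · exact h.le
          · exact (Finset.mem_Iio.1 (hCI h)).le
        · rw [h2, Finset.erase_insert hsC]
    · intro f hf
      simp only [hF, Finset.coe_filter, Set.mem_ofPred_eq] at hf
      rw [Finset.mem_coe, Finset.mem_powerset]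
      intro x hx
      simp only [Finset.mem_erase, Finset.mem_filter] at hx
      rw [Finset.mem_Iio]
      exact lt_of_le_of_ne (hf.2.2 x (fun h => hrQ (h ▸ hx.2.1)) hx.2.2) hx.1
  have hs2 : (s : ℕ) + 2 ≤ n := by
    have := r.2
    have : (s : ℕ) < r := hsr
    omega
  have hterm : ∀ C ∈ (Finset.Iio s).powerset,
      (n - 1) * (FS (insert s C) (Q \ insert s C)).card =
        (n - 1) ^ (n - 2 - (s : ℕ)) *
          ((1 + C.card) * (n - 1) ^ ((Finset.Iio s).card - C.card)) := by
    intro C hC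
    have hCI := Finset.mem_powerset.1 hC
    have hsC : s ∉ C := fun h => by simpa using hCI h
    have hle := Finset.card_le_card hCI
    have hsub : insert s C ⊆ Q := Finset.insert_subset hsQ (hCI.trans hIQ)
    have c1 : (insert s C).card = C.card + 1 := Finset.card_insert_of_notMem hsC
    have c2 : (Q \ insert s C).card = n - 1 - (C.card + 1) := by
      rw [Finset.card_sdiff_of_subset hsub, hQc, c1]
    rw [hIc] at hle ⊢
    rw [card_FS (n - 1) _ _ Finset.disjoint_sdiff (by rw [c1, c2]; omega), c1, c2,
      mul_left_comm, ← pow_add, add_comm 1]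
    congr 2
    omega
  have hid := sum_identity (n - 1) (Finset.Iio s) 1
  have hn1 : n - 1 + 1 = n := by omega
  rw [hIc, hn1] at hid
  have h5 : (n - 1) * F.card = (n - 1) ^ (n - 2 - (s : ℕ)) *
      ∑ C ∈ (Finset.Iio s).powerset, (1 + C.card) * (n - 1) ^ ((s : ℕ) - C.card) := by
    rw [hsum, Finset.mul_sum, Finset.sum_congr rfl hterm, hIc, Finset.mul_sum]
  rw [hcard, mul_assoc, h5, mul_left_comm, hid]
  ring

end UprootedTrees


/-- Refined enumeration: the number `N_{k,j}` of spanning trees of `K_n` in which the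
largest neighbor of vertex `n-k` (index `n-k-1`) equals `n-k-j` (index `n-k-j-1`)
satisfies `n(n-1) N_{k,j} = n^(n-k-j-1) (n-1)^(k+j-1) (2n-k-j-1)`. -/
theorem refined_uprooted_spanning_trees_Kn (n k j : ℕ) (hn : 2 ≤ n)
    (hk : k ≤ n - 2) (hj1 : 1 ≤ j) (hj2 : j ≤ n - k - 1) :
    n * (n - 1) * Nat.card {T : SimpleGraph (Fin n) // T ≤ ⊤ ∧ T.IsTree ∧
        T.Adj ⟨n - k - 1, by omega⟩ ⟨n - k - j - 1, by omega⟩ ∧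
        ∀ w : Fin n, T.Adj ⟨n - k - 1, by omega⟩ w → w ≤ ⟨n - k - j - 1, by omega⟩} =
      n ^ (n - k - j - 1) * (n - 1) ^ (k + j - 1) * (2 * n - k - j - 1) := by
  have hs : (⟨n - k - j - 1, by omega⟩ : Fin n) < ⟨n - k - 1, by omega⟩ := by
    rw [Fin.mk_lt_mk]; omega
  have h := UprootedTrees.card_trees n ⟨n - k - 1, by omega⟩ ⟨n - k - j - 1, by omega⟩ hs
  rw [h]
  have e1 : n - 2 - (n - k - j - 1) = k + j - 1 := by omega
  have e2 : n + (n - k - j - 1) = 2 * n - k - j - 1 := by omega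
  simp only [e1, e2]
end

section
/- Let n ≥ 3 and 1 ≤ k ≤ n−2. Let N'_k be the number of spanning trees T of the graph K_n∖{e_{1,n}} (the complete graph K_n with the edge {1,n} deleted) such that every neighbor of the vertex n−k in T is smaller than n−k (i.e., the number of uprooted spanning trees of K_n∖{e_{1,n}} with root n−k). Then, as an identity of rational numbers, N'_k = n^{n−2−k} · (n−1)^{k−1} · ( (n−3−k) + (2nk+n−k−2)/(n(n−1)) ), where n−3−k is computed in ℚ (it equals −1 when k = n−2). -/
namespace UprootedAux

open Matrix Finset

variable {V : Type*} [Fintype V] [DecidableEq V]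

/-- `f` is a parent function of a tree rooted at `r`. -/
def IsParent (r : V) (f : V → V) : Prop := f r = r ∧ ∀ v, ∃ m, f^[m] v = r

lemma IsParent.depth {r : V} {f : V → V} (h : IsParent r f) :
    ∃ d : V → ℕ, ∀ v, v ≠ r → d (f v) < d v := by
  classical
  refine ⟨fun v => Nat.find (h.2 v), fun v hv => ?_⟩
  have hs := Nat.find_spec (h.2 v)
  rcases hm : Nat.find (h.2 v) with _ | m
  · rw [hm] at hs
    exact absurd hs hv
  · rw [hm] at hs
    have h3 : Nat.find (h.2 (f v)) ≤ m := Nat.find_min' (h.2 (f v)) hs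
    show Nat.find (h.2 (f v)) < Nat.find (h.2 v)
    omega

lemma isParent_of_depth {r : V} {f : V → V} (hr : f r = r) (d : V → ℕ)
    (hd : ∀ v, v ≠ r → d (f v) < d v) : IsParent r f := by
  refine ⟨hr, fun v => ?_⟩
  induction hn : d v using Nat.strong_induction_on generalizing v with
  | _ n ih =>
    by_cases hv : v = r
    · exact ⟨0, hv⟩
    · obtain ⟨m, hm⟩ := ih _ (hn ▸ hd v hv) (f v) rfl
      exact ⟨m + 1, hm⟩

/-- The matrix `1 - P_f`. -/
def pm (r : V) (f : V → V) : Matrix V V ℚ :=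
  fun v w => (if v = w then 1 else 0) - (if f v = w ∧ w ≠ r then 1 else 0)

lemma det_pm_one {r : V} {f : V → V} (h : IsParent r f) : (pm r f).det = 1 := by
  obtain ⟨d, hd⟩ := h.depth
  have hb : BlockTriangular (pm r f) (fun v => OrderDual.toDual (d v)) := by
    intro i j hij
    have hij' : d i < d j := hij
    have h1 : i ≠ j := by rintro rfl; omega
    have h2 : ¬ (f i = j ∧ j ≠ r) := by
      rintro ⟨rfl, hj⟩
      have : i ≠ r := by rintro rfl; exact hj h.1
      have := hd i this
      omega
    simp [pm, h1, h2]
  rw [hb.det]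
  refine Finset.prod_eq_one fun k _ => ?_
  have : (pm r f).toSquareBlock (fun v => OrderDual.toDual (d v)) k = 1 := by
    ext ⟨i, hi⟩ ⟨j, hj⟩
    have hij : d i = d j := OrderDual.toDual.injective (hi.trans hj.symm)
    have h2 : ¬ (f i = j ∧ j ≠ r) := by
      rintro ⟨rfl, hj⟩
      have : i ≠ r := by rintro rfl; exact hj h.1
      have := hd i this
      omega
    simp [toSquareBlock_def, pm, h2, Matrix.one_apply]
  rw [this, det_one]

lemma det_pm_zero {r : V} {f : V → V} (hr : f r = r) (h : ¬ IsParent r f) :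
    (pm r f).det = 0 := by
  classical
  have h' : ∃ v, ∀ m, f^[m] v ≠ r := by
    by_contra hc
    push Not at hc
    exact h ⟨hr, hc⟩
  obtain ⟨v₀, hv₀⟩ := h'
  rw [← exists_mulVec_eq_zero_iff]
  refine ⟨fun v => if ∀ m, f^[m] v ≠ r then 1 else 0, ?_, ?_⟩
  · intro hc
    have := congrFun hc v₀
    rw [if_pos hv₀] at this
    simp at this
  · ext v
    have hiff : (∀ m, f^[m] v ≠ r) ↔ (∀ m, f^[m] (f v) ≠ r) := by
      constructor
      · intro hh m
        exact hh (m + 1)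
      · intro hh m
        rcases m with _ | m
        · rintro hv
          have hv' : v = r := hv
          exact hh 0 (by simp [hv', hr])
        · exact hh m
    simp only [mulVec, dotProduct, pm, sub_mul, Finset.sum_sub_distrib, ite_mul, one_mul, zero_mul,
      Finset.sum_ite_eq, Finset.mem_univ, if_true, Pi.zero_apply]
    have hx : ∀ x, (if f v = x ∧ x ≠ r then (if ∀ m, f^[m] x ≠ r then (1:ℚ) else 0) else 0) =
        if f v = x then (if ∀ m, f^[m] x ≠ r then (1:ℚ) else 0) else 0 := by
      intro x
      by_cases hxr : x = r
      · have : ¬ ∀ m, f^[m] x ≠ r := fun hh => hh 0 hxr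
        simp [this]
      · simp [hxr]
    simp only [hx, Finset.sum_ite_eq, Finset.mem_univ, if_true, hiff, sub_self]

/-- Directed matrix-tree theorem. -/
lemma matrix_tree (r : V) (G : V → V → Prop) [DecidableRel G] (hG : ∀ u, G r u ↔ u = r) :
    (Nat.card {f : V → V // IsParent r f ∧ ∀ v, G v (f v)} : ℚ) =
    (Matrix.of fun v w => (if v = w then ∑ u, (if G v u then (1 : ℚ) else 0) else 0) -
      (if G v w ∧ w ≠ r then 1 else 0)).det := by
  classical
  have e1 : (Matrix.of fun v w => (if v = w then ∑ u, (if G v u then (1 : ℚ) else 0) else 0) -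
      (if G v w ∧ w ≠ r then 1 else 0)) =
      (fun v => ∑ u, (if G v u then (1 : ℚ) else 0) •
        (fun w => (if v = w then (1:ℚ) else 0) - (if u = w ∧ w ≠ r then 1 else 0)) :
        V → V → ℚ) := by
    funext v w
    simp only [Matrix.of_apply, Finset.sum_apply, Pi.smul_apply, smul_eq_mul, mul_sub,
      Finset.sum_sub_distrib]
    congr 1
    · split_ifs <;> simp
    · by_cases hw : w = r
      · simp [hw]
      · simp [hw]
  have e2 : ∀ M : V → V → ℚ, Matrix.det (M : Matrix V V ℚ) =
      (detRowAlternating (n := V) (R := ℚ)).toMultilinearMap M := fun M => rfl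
  rw [e1, e2, MultilinearMap.map_sum]
  have e3 : ∀ f : V → V, (detRowAlternating (n := V) (R := ℚ)).toMultilinearMap
      (fun v => (if G v (f v) then (1 : ℚ) else 0) •
        (fun w => (if v = w then (1:ℚ) else 0) - (if f v = w ∧ w ≠ r then 1 else 0))) =
      if IsParent r f ∧ ∀ v, G v (f v) then 1 else 0 := by
    intro f
    rw [MultilinearMap.map_smul_univ]
    have : (detRowAlternating (n := V) (R := ℚ)).toMultilinearMap
      (fun v => (fun w => (if v = w then (1:ℚ) else 0) - (if f v = w ∧ w ≠ r then 1 else 0)))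
        = (pm r f).det := rfl
    rw [this]
    by_cases ha : ∀ v, G v (f v)
    · have hr : f r = r := (hG _).1 (ha r)
      by_cases hp : IsParent r f
      · simp [ha, hp, det_pm_one hp]
      · simp [hp, det_pm_zero hr hp]
    · rw [if_neg (fun h => ha h.2)]
      push Not at ha
      obtain ⟨v, hv⟩ := ha
      rw [Finset.prod_eq_zero (Finset.mem_univ v) (by simp [hv]), zero_smul]
  simp only [e3]
  rw [Nat.card_eq_fintype_card, Fintype.card_subtype]
  simp

/-- The graph of a parent function. -/
def tg (f : V → V) : SimpleGraph V := SimpleGraph.fromRel fun v w => f v = w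

lemma tg_adj (f : V → V) (v w : V) : (tg f).Adj v w ↔ v ≠ w ∧ (f v = w ∨ f w = v) := by
  simp [tg]

lemma tg_adj_self {r : V} {f : V → V} (h : IsParent r f) {v : V} (hv : v ≠ r) :
    (tg f).Adj v (f v) := by
  obtain ⟨d, hd⟩ := h.depth
  rw [tg_adj]
  refine ⟨fun hc => ?_, Or.inl rfl⟩
  have := hd v hv
  rw [← hc] at this
  omega

lemma tg_connected {r : V} {f : V → V} (h : IsParent r f) : (tg f).Connected := by
  have key : ∀ v, (tg f).Reachable v r := by
    obtain ⟨d, hd⟩ := h.depth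
    intro v
    induction hn : d v using Nat.strong_induction_on generalizing v with
    | _ n ih =>
      by_cases hv : v = r
      · rw [hv]
      · exact (tg_adj_self h hv).reachable.trans (ih _ (hn ▸ hd v hv) (f v) rfl)
  have : Nonempty V := ⟨r⟩
  exact ⟨fun u v => (key u).trans (key v).symm⟩

lemma tg_tree {r : V} {f : V → V} (h : IsParent r f) : (tg f).IsTree := by
  classical
  rw [SimpleGraph.isTree_iff_connected_and_card]
  refine ⟨tg_connected h, le_antisymm ?_ (tg_connected h).card_vert_le_card_edgeSet_add_one⟩
  have hsub : (tg f).edgeSet ⊆ (((Finset.univ.erase r).image fun v => s(v, f v) : Finset (Sym2 V)) :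
      Set (Sym2 V)) := by
    intro e
    induction e using Sym2.ind with
    | _ a b =>
      intro hab
      rw [SimpleGraph.mem_edgeSet, tg_adj] at hab
      simp only [Finset.coe_image, Set.mem_image, Finset.mem_coe, Finset.mem_erase,
        Finset.mem_univ, and_true]
      rcases hab with ⟨hne, hab | hab⟩
      · refine ⟨a, ?_, by rw [hab]⟩
        rintro rfl
        exact hne (h.1.symm.trans hab)
      · refine ⟨b, ?_, by rw [hab, Sym2.eq_swap]⟩
        rintro rfl
        exact hne (hab.symm.trans h.1)
  have h1 := Set.ncard_le_ncard hsub (Finset.finite_toSet _)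
  rw [Set.ncard_coe_finset] at h1
  have h2 := (Finset.card_image_le (s := Finset.univ.erase r) (f := fun v => s(v, f v)))
  rw [Finset.card_erase_of_mem (Finset.mem_univ r), Finset.card_univ] at h2
  have h3 : 0 < Fintype.card V := Fintype.card_pos_iff.2 ⟨r⟩
  rw [Nat.card_eq_fintype_card (α := V), Nat.card_coe_set_eq]
  omega

lemma tg_inj {r : V} {f g : V → V} (hf : IsParent r f) (hg : IsParent r g) (h : tg f = tg g) :
    f = g := by
  obtain ⟨d, hd⟩ := hf.depth
  funext v
  induction hn : d v using Nat.strong_induction_on generalizing v with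
  | _ n ih =>
    by_cases hv : v = r
    · rw [hv, hf.1, hg.1]
    · have had := tg_adj_self hf hv
      rw [h, tg_adj] at had
      rcases had.2 with h1 | h1
      · exact h1.symm
      · exfalso
        have h2 := ih _ (hn ▸ hd v hv) (f v) rfl
        by_cases hfr : f v = r
        · rw [hfr, hg.1] at h1
          exact hv h1.symm
        · have h3 := hd _ hfr
          have h4 := hd v hv
          rw [h2, h1] at h3
          omega

lemma tg_surj (r : V) {T : SimpleGraph V} (hT : T.IsTree) : ∃ f, IsParent r f ∧ tg f = T := by
  have hex : ∀ v, ∃ w, (v = r → w = r) ∧ (v ≠ r → T.Adj v w ∧ T.dist w r < T.dist v r) := by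
    intro v
    by_cases hv : v = r
    · exact ⟨r, fun _ => rfl, fun h => absurd hv h⟩
    · obtain ⟨p, hp⟩ := hT.connected.exists_walk_length_eq_dist v r
      cases p with
      | nil => exact absurd rfl hv
      | cons hadj q =>
        refine ⟨_, fun h => absurd h hv, fun _ => ⟨hadj, ?_⟩⟩
        have := SimpleGraph.dist_le q
        rw [SimpleGraph.Walk.length_cons] at hp
        omega
  choose f hf using hex
  have hp : IsParent r f := isParent_of_depth ((hf r).1 rfl) (fun v => T.dist v r)
    (fun v hv => ((hf v).2 hv).2)
  have hle : tg f ≤ T := by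
    intro a b hab
    rw [tg_adj] at hab
    rcases hab with ⟨hne, hab | hab⟩
    · have : a ≠ r := by
        rintro rfl
        exact hne (hp.1.symm.trans hab)
      exact hab ▸ ((hf a).2 this).1
    · have : b ≠ r := by
        rintro rfl
        exact hne (hab.symm.trans hp.1)
      exact (hab ▸ ((hf b).2 this).1).symm
  refine ⟨f, hp, ?_⟩
  exact ((SimpleGraph.isTree_iff_minimal_connected.1 hT).eq_of_le (tg_connected hp) hle)

lemma card_trees (r : V) (H : SimpleGraph V) :
    Nat.card {T : SimpleGraph V // T ≤ H ∧ T.IsTree} =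
    Nat.card {f : V → V // IsParent r f ∧ ∀ v, (if v = r then f v = r else H.Adj v (f v))} := by
  symm
  refine Nat.card_eq_of_bijective (fun f => ⟨tg f.1, ?_, tg_tree f.2.1⟩) ⟨?_, ?_⟩
  · obtain ⟨f, hp, hf⟩ := f
    intro a b hab
    replace hab : a ≠ b ∧ (f a = b ∨ f b = a) := (tg_adj _ _ _).1 hab
    rcases hab with ⟨hne, hab | hab⟩
    · have : a ≠ r := by
        rintro rfl
        exact hne (hp.1.symm.trans hab)
      have h2 := hf a
      rw [if_neg this, hab] at h2
      exact h2
    · have : b ≠ r := by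
        rintro rfl
        exact hne (hab.symm.trans hp.1)
      have h2 := hf b
      rw [if_neg this, hab] at h2
      exact h2.symm
  · intro f g h
    exact Subtype.ext (tg_inj f.2.1 g.2.1 (congrArg Subtype.val h))
  · rintro ⟨T, hle, hT⟩
    obtain ⟨f, hp, hfT⟩ := tg_surj r hT
    refine ⟨⟨f, hp, fun v => ?_⟩, Subtype.ext hfT⟩
    split_ifs with hv
    · rw [hv, hp.1]
    · exact hle (hfT ▸ tg_adj_self hp hv)


section Eval
variable (s t : ℕ)

/-- The root. -/
def rt : Fin (s + t + 3) := ⟨s + 1, by omega⟩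
/-- The last vertex. -/
def lt : Fin (s + t + 3) := ⟨s + t + 2, by omega⟩

/-- The graph with all forbidden edges removed. -/
def HH : SimpleGraph (Fin (s + t + 3)) where
  Adj v w := v ≠ w ∧ ¬ (v = rt s t ∧ rt s t < w) ∧ ¬ (w = rt s t ∧ rt s t < v) ∧
    ¬ (v = 0 ∧ w = lt s t) ∧ ¬ (v = lt s t ∧ w = 0)
  symm := ⟨fun _ _ h => ⟨h.1.symm, h.2.2.1, h.2.1, fun hh => h.2.2.2.2 hh.symm,
    fun hh => h.2.2.2.1 hh.symm⟩⟩
  loopless := ⟨fun _ h => h.1 rfl⟩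

/-- Diagonal entries. -/
def dg (v : ℕ) : ℚ :=
  if v = s + 1 then 1 else (s + t + 3 : ℚ) - (if v = 0 then 1 else 0)
    - (if s + 1 < v then 1 else 0) - (if v = s + t + 2 then 1 else 0)

lemma dg_ne (v : ℕ) : dg s t v ≠ 0 := by
  have hs : (0:ℚ) ≤ s := by positivity
  have ht : (0:ℚ) ≤ t := by positivity
  unfold dg
  split_ifs <;> first | (exfalso; omega) | (apply ne_of_gt; linarith)

lemma sum_F (F : ℚ → ℚ) : ∑ v : Fin (s + t + 3), F (dg s t v) =
    F (s + t + 2) + s * F (s + t + 3) + F 1 + t * F (s + t + 2) + F (s + t + 1) := by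
  rw [Fin.sum_univ_eq_sum_range (fun v => F (dg s t v))]
  have : s + t + 3 = (1 + s + 1 + t) + 1 := by ring
  rw [this, Finset.sum_range_succ, Finset.sum_range_add, Finset.sum_range_succ,
    Finset.sum_range_add, Finset.sum_range_one]
  have h1 : ∀ x ∈ Finset.range s, F (dg s t (1 + x)) = F (s + t + 3) := by
    intro x hx
    rw [Finset.mem_range] at hx
    congr 1
    unfold dg
    split_ifs <;> first | (exfalso; omega) | ring
  have h2 : ∀ x ∈ Finset.range t, F (dg s t (1 + s + 1 + x)) = F (s + t + 2) := by
    intro x hx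
    rw [Finset.mem_range] at hx
    congr 1
    unfold dg
    split_ifs <;> first | (exfalso; omega) | ring
  have h3 : dg s t 0 = s + t + 2 := by
    unfold dg
    split_ifs <;> first | (exfalso; omega) | ring
  have h4 : dg s t (1 + s) = 1 := by
    unfold dg
    split_ifs <;> first | (exfalso; omega) | ring
  have h5 : dg s t (1 + s + 1 + t) = s + t + 1 := by
    unfold dg
    split_ifs <;> first | (exfalso; omega) | ring
  rw [Finset.sum_congr rfl h1, Finset.sum_congr rfl h2, h3, h4, h5]
  simp

lemma prod_dg : ∏ v : Fin (s + t + 3), dg s t v =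
    (s + t + 2) * (s + t + 3) ^ s * (s + t + 2) ^ t * (s + t + 1) := by
  rw [Fin.prod_univ_eq_prod_range (fun v => dg s t v)]
  have : s + t + 3 = (1 + s + 1 + t) + 1 := by ring
  rw [this, Finset.prod_range_succ, Finset.prod_range_add, Finset.prod_range_succ,
    Finset.prod_range_add, Finset.prod_range_one]
  have h1 : ∀ x ∈ Finset.range s, dg s t (1 + x) = s + t + 3 := by
    intro x hx
    rw [Finset.mem_range] at hx
    unfold dg
    split_ifs <;> first | (exfalso; omega) | ring
  have h2 : ∀ x ∈ Finset.range t, dg s t (1 + s + 1 + x) = s + t + 2 := by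
    intro x hx
    rw [Finset.mem_range] at hx
    unfold dg
    split_ifs <;> first | (exfalso; omega) | ring
  have h3 : dg s t 0 = s + t + 2 := by
    unfold dg
    split_ifs <;> first | (exfalso; omega) | ring
  have h4 : dg s t (1 + s) = 1 := by
    unfold dg
    split_ifs <;> first | (exfalso; omega) | ring
  have h5 : dg s t (1 + s + 1 + t) = s + t + 1 := by
    unfold dg
    split_ifs <;> first | (exfalso; omega) | ring
  rw [Finset.prod_congr rfl h1, Finset.prod_congr rfl h2, h3, h4, h5]
  simp

/-- Low-rank factor. -/
def UU : Matrix (Fin (s + t + 3)) (Fin 3) ℚ := Matrix.of fun v j =>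
  ![if v = 0 then 1 else 0, if v = lt s t then 1 else 0, if v = rt s t then 0 else 1] j

/-- Low-rank factor. -/
def VV : Matrix (Fin 3) (Fin (s + t + 3)) ℚ := Matrix.of fun j v =>
  ![if v = lt s t then 1 else 0, if v = 0 then 1 else 0, if v = rt s t then 0 else -1] j

/-- Rooted relation. -/
def GG (v u : Fin (s + t + 3)) : Prop := if v = rt s t then u = rt s t else (HH s t).Adj v u

lemma GG_val [DecidableRel (GG s t)] (v u : Fin (s + t + 3)) (hv : v ≠ rt s t) :
    (if GG s t v u then (1:ℚ) else 0) =
    1 - (if u = v then 1 else 0) - (if u = rt s t then (if rt s t < v then 1 else 0) else 0)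
      - (if u = lt s t then (if v = 0 then 1 else 0) else 0)
      - (if u = 0 then (if v = lt s t then 1 else 0) else 0) := by
  have h0l : lt s t ≠ 0 := by simp [lt, Fin.ext_iff]
  have h0r : rt s t ≠ 0 := by simp [rt, Fin.ext_iff]
  have hlr : rt s t < lt s t := by simp [rt, lt, Fin.lt_def]
  simp only [GG, hv, if_false, HH]
  grind

lemma deg_val [DecidableRel (GG s t)] (v : Fin (s + t + 3)) (hv : v ≠ rt s t) :
    ∑ u, (if GG s t v u then (1:ℚ) else 0) = dg s t v - 1 := by
  simp only [GG_val s t v _ hv, Finset.sum_sub_distrib, Finset.sum_ite_eq', Finset.mem_univ,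
    if_true]
  have hv' : (v : ℕ) ≠ s + 1 := fun h => hv (Fin.ext h)
  have e1 : (v = 0) = ((v : ℕ) = 0) := propext Fin.ext_iff
  have e2 : (v = lt s t) = ((v : ℕ) = s + t + 2) := propext Fin.ext_iff
  have e3 : (rt s t < v) = (s + 1 < (v : ℕ)) := propext Fin.lt_def
  simp only [e1, e2, e3, dg, hv', if_false]
  simp only [Finset.sum_const, Finset.card_univ, Fintype.card_fin, nsmul_eq_mul]
  push_cast
  ring

lemma mat_eq [DecidableRel (GG s t)] :
    (Matrix.of fun v w => (if v = w then ∑ u, (if GG s t v u then (1 : ℚ) else 0) else 0) -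
      (if GG s t v w ∧ w ≠ rt s t then 1 else 0)) =
    Matrix.diagonal (fun v : Fin (s + t + 3) => dg s t v) + UU s t * VV s t := by
  have h0l : lt s t ≠ 0 := by simp [lt, Fin.ext_iff]
  have h0r : rt s t ≠ 0 := by simp [rt, Fin.ext_iff]
  have hlr : rt s t ≠ lt s t := by
    intro h
    have := congrArg Fin.val h
    simp [rt, lt] at this
    omega
  have hdr : dg s t (rt s t) = 1 := if_pos rfl
  ext v w
  simp only [Matrix.of_apply, Matrix.add_apply, Matrix.diagonal_apply, Matrix.mul_apply,
    Fin.sum_univ_three, UU, VV]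
  by_cases hv : v = rt s t
  · subst hv
    have hg : ∀ u, GG s t (rt s t) u ↔ u = rt s t := by simp [GG]
    simp only [hg, h0r, hlr, if_true, if_false, Finset.sum_ite_eq', Finset.mem_univ, hdr]
    simp
  · rw [deg_val s t v hv]
    have hg := GG_val s t v w hv
    by_cases hw : w = rt s t
    · subst hw
      simp [h0r, hlr, hv]
    · simp only [ne_eq, hw, not_false_eq_true, and_true, hg, hv, if_false]
      simp
      grind

lemma det_eval [DecidableRel (GG s t)] :
    (Matrix.of fun v w => (if v = w then ∑ u, (if GG s t v u then (1 : ℚ) else 0) else 0) -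
      (if GG s t v w ∧ w ≠ rt s t then 1 else 0)).det =
    ((s + t + 2) * (s + t + 3) ^ s * (s + t + 2) ^ t * (s + t + 1)) *
      ((1 - 1 / ((s + t + 2) * (s + t + 1))) *
        (1 - ((s + t + 2 : ℚ)⁻¹ + s * (s + t + 3 : ℚ)⁻¹ + t * (s + t + 2 : ℚ)⁻¹
          + (s + t + 1 : ℚ)⁻¹)) + (2 - (s + t + 2 : ℚ)⁻¹ - (s + t + 1 : ℚ)⁻¹)
            / ((s + t + 2) * (s + t + 1))) := by
  have h0l : lt s t ≠ 0 := by simp [lt, Fin.ext_iff]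
  have h0r : rt s t ≠ 0 := by simp [rt, Fin.ext_iff]
  have hlr : rt s t ≠ lt s t := by
    intro h
    have := congrArg Fin.val h
    simp [rt, lt] at this
    omega
  have hd0 : dg s t 0 = s + t + 2 := by
    unfold dg
    split_ifs <;> first | (exfalso; omega) | ring
  have hdl : dg s t (lt s t) = s + t + 1 := by
    have : ((lt s t : Fin (s + t + 3)) : ℕ) = s + t + 2 := rfl
    rw [this]
    unfold dg
    split_ifs <;> first | (exfalso; omega) | ring
  have hdr : dg s t (rt s t) = 1 := by simp [dg, rt]
  have hdet : (Matrix.diagonal (fun v : Fin (s + t + 3) => dg s t v)).det =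
      (s + t + 2) * (s + t + 3) ^ s * (s + t + 2) ^ t * (s + t + 1) := by
    rw [Matrix.det_diagonal, prod_dg]
  have hu : IsUnit (Matrix.diagonal (fun v : Fin (s + t + 3) => dg s t v)).det := by
    rw [Matrix.det_diagonal]
    exact (Finset.prod_ne_zero_iff.2 fun (v : Fin (s + t + 3)) _ => dg_ne s t v).isUnit
  have hinv : (Matrix.diagonal (fun v : Fin (s + t + 3) => dg s t v))⁻¹ =
      Matrix.diagonal (fun v : Fin (s + t + 3) => (dg s t v)⁻¹) := by
    apply Matrix.inv_eq_right_inv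
    rw [Matrix.diagonal_mul_diagonal, ← Matrix.diagonal_one]
    congr 1
    funext v
    exact mul_inv_cancel₀ (dg_ne s t v)
  have hS : ∑ v : Fin (s + t + 3), (if v = rt s t then 0 else (dg s t v)⁻¹) =
      (s + t + 2 : ℚ)⁻¹ + s * (s + t + 3 : ℚ)⁻¹ + t * (s + t + 2 : ℚ)⁻¹
          + (s + t + 1 : ℚ)⁻¹ := by
    have h1 := sum_F s t (fun x => x⁻¹)
    have h2 : ∀ v : Fin (s + t + 3), (if v = rt s t then 0 else (dg s t v)⁻¹) =
        (dg s t v)⁻¹ - (if v = rt s t then 1 else 0) := by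
      intro v
      split_ifs with h
      · rw [h, hdr]; norm_num
      · ring
    simp only [h2, Finset.sum_sub_distrib, Finset.sum_ite_eq', Finset.mem_univ, if_true]
    rw [h1]
    ring
  have hW : VV s t * Matrix.diagonal (fun v : Fin (s + t + 3) => (dg s t v)⁻¹) * UU s t =
      !![0, (s + t + 1 : ℚ)⁻¹, (s + t + 1 : ℚ)⁻¹;
         (s + t + 2 : ℚ)⁻¹, 0, (s + t + 2 : ℚ)⁻¹;
         -(s + t + 2 : ℚ)⁻¹, -(s + t + 1 : ℚ)⁻¹,
          -((s + t + 2 : ℚ)⁻¹ + s * (s + t + 3 : ℚ)⁻¹ + t * (s + t + 2 : ℚ)⁻¹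
          + (s + t + 1 : ℚ)⁻¹)] := by
    rw [← hS]
    ext i j
    rw [Matrix.mul_apply]
    simp only [Matrix.mul_diagonal]
    fin_cases i <;> fin_cases j <;>
      simp [UU, VV, h0l, h0r, hlr, h0l.symm, h0r.symm,
        hlr.symm, hd0, hdl, ← Finset.sum_neg_distrib]
    · rw [Finset.sum_eq_single (lt s t)]
      · simp [hlr.symm, hdl]
      · intro b _ hb
        simp [hb]
      · simp
    · rw [Finset.sum_eq_single 0]
      · simp [h0r.symm, hd0]
      · intro b _ hb
        simp [hb]
      · simp
    · refine Finset.sum_congr rfl fun x _ => ?_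
      split_ifs <;> simp
  rw [mat_eq, Matrix.det_add_mul _ _ hu, hinv, hdet, hW]
  congr 1
  rw [Matrix.det_fin_three]
  simp [Matrix.one_apply]
  have a1 : (s + t + 1 : ℚ) ≠ 0 := by positivity
  have a2 : (s + t + 2 : ℚ) ≠ 0 := by positivity
  have a3 : (s + t + 3 : ℚ) ≠ 0 := by positivity
  field_simp
  ring

lemma final_count : (Nat.card {T : SimpleGraph (Fin (s + t + 3)) // T ≤ HH s t ∧ T.IsTree} : ℚ) =
    (s + t + 3 : ℚ) ^ s * (s + t + 2 : ℚ) ^ t * ((s - 1 : ℚ) +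
      (2 * (s + t + 3) * (t + 1) + (s + t + 3) - (t + 1) - 2) / ((s + t + 3) * (s + t + 2))) := by
  classical
  rw [card_trees (rt s t)]
  have := matrix_tree (rt s t) (GG s t) (fun u => by simp [GG])
  unfold GG at this
  rw [this]
  refine (det_eval s t).trans ?_
  have a1 : (s + t + 1 : ℚ) ≠ 0 := by positivity
  have a2 : (s + t + 2 : ℚ) ≠ 0 := by positivity
  have a3 : (s + t + 3 : ℚ) ≠ 0 := by positivity
  field_simp
  ring

end Eval

end UprootedAux

theorem uprooted_spanning_trees_Kn_minus_edge_root (n k : ℕ) (hn : 3 ≤ n)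
    (hk1 : 1 ≤ k) (hk2 : k ≤ n - 2) :
    (Nat.card {T : SimpleGraph (Fin n) //
        T ≤ (⊤ : SimpleGraph (Fin n)).deleteEdges
              {s((⟨0, by omega⟩ : Fin n), (⟨n - 1, by omega⟩ : Fin n))} ∧
        T.IsTree ∧
        ∀ w : Fin n, T.Adj ⟨n - k - 1, by omega⟩ w → w < ⟨n - k - 1, by omega⟩} : ℚ) =
      (n : ℚ) ^ (n - 2 - k) * ((n : ℚ) - 1) ^ (k - 1) *
        (((n : ℚ) - 3 - (k : ℚ)) +
          (2 * (n : ℚ) * (k : ℚ) + (n : ℚ) - (k : ℚ) - 2) /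
            ((n : ℚ) * ((n : ℚ) - 1))) := by
  obtain ⟨t, rfl⟩ : ∃ t, k = t + 1 := ⟨k - 1, by omega⟩
  obtain ⟨s, rfl⟩ : ∃ s, n = s + t + 3 := ⟨n - t - 3, by omega⟩
  have hl : (⟨s + t + 3 - 1, by omega⟩ : Fin (s + t + 3)) = UprootedAux.lt s t :=
    Fin.ext (by simp [UprootedAux.lt])
  have hr : (⟨s + t + 3 - (t + 1) - 1, by omega⟩ : Fin (s + t + 3)) = UprootedAux.rt s t :=
    Fin.ext (by simp [UprootedAux.rt]; omega)
  have hz : (⟨0, by omega⟩ : Fin (s + t + 3)) = 0 := rfl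
  have e1 : s + t + 3 - 2 - (t + 1) = s := by omega
  have e2 : t + 1 - 1 = t := by omega
  rw [hl, hr, hz, e1, e2]
  have hiff : ∀ T : SimpleGraph (Fin (s + t + 3)),
      (T ≤ (⊤ : SimpleGraph (Fin (s + t + 3))).deleteEdges {s(0, UprootedAux.lt s t)} ∧
        T.IsTree ∧ ∀ w, T.Adj (UprootedAux.rt s t) w → w < UprootedAux.rt s t) ↔
      (T ≤ UprootedAux.HH s t ∧ T.IsTree) := by
    intro T
    constructor
    · rintro ⟨h1, h2, h3⟩
      refine ⟨fun a b hab => ?_, h2⟩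
      have h4 := h1 hab
      simp only [SimpleGraph.deleteEdges_adj, SimpleGraph.top_adj, Set.mem_singleton_iff,
        Sym2.eq_iff] at h4
      refine ⟨hab.ne, ?_, ?_, fun h => h4.2 (Or.inl h), fun h => h4.2 (Or.inr h)⟩
      · rintro ⟨rfl, h⟩
        exact lt_asymm h (h3 _ hab)
      · rintro ⟨rfl, h⟩
        exact lt_asymm h (h3 _ hab.symm)
    · rintro ⟨h1, h2⟩
      refine ⟨fun a b hab => ?_, h2, fun w hw => ?_⟩
      · have h4 := h1 hab
        simp only [SimpleGraph.deleteEdges_adj, SimpleGraph.top_adj, Set.mem_singleton_iff,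
          Sym2.eq_iff]
        exact ⟨hab.ne, fun h => h.elim h4.2.2.2.1 h4.2.2.2.2⟩
      · have h4 := h1 hw
        exact lt_of_le_of_ne (not_lt.1 fun h => h4.2.1 ⟨rfl, h⟩) h4.1.symm
  rw [Nat.card_congr (Equiv.subtypeEquivRight hiff), UprootedAux.final_count]
  push_cast
  have e3 : (s + t + 3 : ℚ) - 1 = s + t + 2 := by ring
  have e4 : (s + t + 3 : ℚ) - 3 - (t + 1) = s - 1 := by ring
  rw [e3, e4]
end

section
/- For every integer n ≥ 3, the number of pairs (T, r), where T is a spanning tree of the graph K_n∖{e_{1,n}} (the complete graph K_n with the edge {1,n} deleted) and r ∈ {1,…,n} is a vertex such that every neighbor of r in T is smaller than r (i.e., the total number of uprooted spanning trees of K_n∖{e_{1,n}} over all roots), equals (n−1)^{n−3} · (n−2)². -/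
namespace UpTree
open Matrix

variable {V : Type*} [Fintype V] [DecidableEq V]

/-- Parent functions of trees rooted at `r`. -/
def Good (r : V) (f : V → V) : Prop := f r = r ∧ ∀ v, ∃ k : ℕ, f^[k] v = r

lemma iter_root {r : V} {f : V → V} (h : f r = r) (k : ℕ) : f^[k] r = r :=
  Function.iterate_fixed h k

/-- The graph of a parent function. -/
def gr (f : V → V) : SimpleGraph V := SimpleGraph.fromRel (fun a b => f a = b)

lemma gr_adj (f : V → V) (a b : V) : (gr f).Adj a b ↔ a ≠ b ∧ (f a = b ∨ f b = a) := by
  simp [gr]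

lemma Good.ne {r : V} {f : V → V} (h : Good r f) {v : V} (hv : v ≠ r) : f v ≠ v := by
  intro e
  obtain ⟨k, hk⟩ := h.2 v
  rw [Function.iterate_fixed e k] at hk
  exact hv hk

lemma Good.ne2 {r : V} {f : V → V} (h : Good r f) {v : V} (hv : v ≠ r) : f (f v) ≠ v := by
  intro e
  have key : ∀ k : ℕ, f^[k] v ≠ r := by
    have : ∀ k : ℕ, f^[k] v = v ∨ f^[k] v = f v := by
      intro k
      induction k with
      | zero => simp
      | succ k ih =>
        rw [Function.iterate_succ_apply']
        rcases ih with ih | ih <;> rw [ih] <;> simp [e]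
    intro k hk
    rcases this k with h1 | h1
    · exact hv (h1.symm.trans hk)
    · have : f v = r := h1.symm.trans hk
      rw [this, h.1] at e
      exact hv e.symm
  obtain ⟨k, hk⟩ := h.2 v
  exact key k hk

lemma gr_inj {r : V} {f g : V → V} (hf : Good r f) (hg : Good r g) (h : gr f = gr g) :
    f = g := by
  have key : ∀ (k : ℕ) (v : V), f^[k] v = r → f v = g v := by
    intro k
    induction k with
    | zero => intro v hv; simp at hv; rw [hv, hf.1, hg.1]
    | succ k ih =>
      intro v hv
      by_cases hvr : v = r
      · rw [hvr, hf.1, hg.1]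
      rw [Function.iterate_succ_apply] at hv
      have h1 := ih _ hv
      have h2 : (gr f).Adj v (f v) := by
        rw [gr_adj]; exact ⟨(hf.ne hvr).symm, Or.inl rfl⟩
      rw [h, gr_adj] at h2
      rcases h2.2 with h3 | h3
      · exact h3.symm
      · exact absurd (h1.trans h3) (hf.ne2 hvr)
  funext v
  obtain ⟨k, hk⟩ := hf.2 v
  exact key k v hk

lemma gr_tree {r : V} {f : V → V} (hf : Good r f) : (gr f).IsTree := by
  classical
  have hconn : (gr f).Connected := by
    have key : ∀ (k : ℕ) (v : V), f^[k] v = r → (gr f).Reachable v r := by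
      intro k
      induction k with
      | zero => intro v hv; simp at hv; rw [hv]
      | succ k ih =>
        intro v hv
        by_cases hvr : v = r
        · rw [hvr]
        rw [Function.iterate_succ_apply] at hv
        have h2 : (gr f).Adj v (f v) := by
          rw [gr_adj]; exact ⟨(hf.ne hvr).symm, Or.inl rfl⟩
        exact h2.reachable.trans (ih _ hv)
    have : Nonempty V := ⟨r⟩
    refine SimpleGraph.Connected.mk ?_
    intro a b
    obtain ⟨k, hk⟩ := hf.2 a
    obtain ⟨l, hl⟩ := hf.2 b
    exact (key k a hk).trans (key l b hl).symm
  rw [SimpleGraph.isTree_iff_connected_and_card]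
  refine ⟨hconn, le_antisymm ?_ hconn.card_vert_le_card_edgeSet_add_one⟩
  have hsub : (gr f).edgeSet ⊆ (((Finset.univ.erase r).image (fun v => s(v, f v)) : Finset (Sym2 V)) : Set (Sym2 V)) := by
    intro e
    induction e using Sym2.ind with
    | _ a b =>
      rw [SimpleGraph.mem_edgeSet, gr_adj]
      rintro ⟨hab, h | h⟩
      · simp only [Finset.coe_image, Set.mem_image, Finset.mem_coe, Finset.mem_erase]
        refine ⟨a, ⟨?_, Finset.mem_univ _⟩, by rw [h]⟩
        rintro rfl
        exact hab (hf.1.symm.trans h)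
      · simp only [Finset.coe_image, Set.mem_image, Finset.mem_coe, Finset.mem_erase]
        refine ⟨b, ⟨?_, Finset.mem_univ _⟩, by rw [h, Sym2.eq_swap]⟩
        rintro rfl
        exact hab (h.symm.trans hf.1)
  have h1 : Nat.card (gr f).edgeSet ≤ Fintype.card V - 1 := by
    rw [Nat.card_coe_set_eq]
    refine (Set.ncard_le_ncard hsub (Finset.finite_toSet _)).trans ?_
    rw [Set.ncard_coe_finset]
    refine Finset.card_image_le.trans ?_
    rw [Finset.card_erase_of_mem (Finset.mem_univ _), Finset.card_univ]
  have h2 : 0 < Fintype.card V := Fintype.card_pos_iff.2 ⟨r⟩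
  rw [Nat.card_eq_fintype_card (α := V)]
  omega

lemma gr_surj (r : V) {T : SimpleGraph V} (hT : T.IsTree) : ∃ f, Good r f ∧ gr f = T := by
  classical
  have hstep : ∀ v, v ≠ r → ∃ u, T.Adj v u ∧ T.dist u r + 1 ≤ T.dist v r := by
    intro v hv
    obtain ⟨p, hp⟩ := hT.connected.exists_walk_length_eq_dist v r
    cases p with
    | nil => exact absurd rfl hv
    | cons h q =>
      refine ⟨_, h, ?_⟩
      rw [← hp, SimpleGraph.Walk.length_cons]
      have := SimpleGraph.dist_le q
      omega
  choose! g hg1 hg2 using hstep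
  let f : V → V := fun v => if v = r then r else g v
  have hfr : f r = r := by simp [f]
  have hfv : ∀ v, v ≠ r → f v = g v := by intro v hv; simp [f, hv]
  have hgood : Good r f := by
    refine ⟨hfr, ?_⟩
    have key : ∀ (d : ℕ) (v : V), T.dist v r ≤ d → ∃ k : ℕ, f^[k] v = r := by
      intro d
      induction d with
      | zero =>
        intro v hv
        exact ⟨0, (hT.connected.dist_eq_zero_iff (u := v) (v := r)).1 (by omega)⟩
      | succ d ih =>
        intro v hv
        by_cases hvr : v = r
        · exact ⟨0, hvr⟩
        obtain ⟨k, hk⟩ := ih (f v) (by rw [hfv v hvr]; have := hg2 v hvr; omega)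
        exact ⟨k + 1, by rw [Function.iterate_succ_apply]; exact hk⟩
    exact fun v => key _ v le_rfl
  refine ⟨f, hgood, ?_⟩
  have hle : gr f ≤ T := by
    intro a b hab
    rw [gr_adj] at hab
    obtain ⟨hne, h | h⟩ := hab
    · have : a ≠ r := by rintro rfl; exact hne (hfr.symm.trans h)
      rw [← h, hfv a this]; exact hg1 a this
    · have : b ≠ r := by rintro rfl; exact hne (h.symm.trans hfr)
      rw [← h, hfv b this]; exact (hg1 b this).symm
  exact le_antisymm hle ((SimpleGraph.isTree_iff_minimal_connected.1 hT).2 (gr_tree hgood).connected hle)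

lemma card_trees (r : V) (G : SimpleGraph V) :
    Nat.card {T : SimpleGraph V // T ≤ G ∧ T.IsTree} =
      Nat.card {f : V → V // Good r f ∧ ∀ v, v ≠ r → G.Adj v (f v)} := by
  symm
  have hle : ∀ f, Good r f → ((∀ v, v ≠ r → G.Adj v (f v)) ↔ gr f ≤ G) := by
    intro f hf
    constructor
    · intro h a b hab
      rw [gr_adj] at hab
      obtain ⟨hne, e | e⟩ := hab
      · have : a ≠ r := by rintro rfl; exact hne (hf.1.symm.trans e)
        rw [← e]; exact h a this
      · have : b ≠ r := by rintro rfl; exact hne (e.symm.trans hf.1)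
        rw [← e]; exact (h b this).symm
    · intro h v hv
      apply h
      rw [gr_adj]; exact ⟨(hf.ne hv).symm, Or.inl rfl⟩
  refine Nat.card_congr (Equiv.ofBijective
    (fun f => ⟨gr f.1, (hle f.1 f.2.1).1 f.2.2, gr_tree f.2.1⟩) ⟨?_, ?_⟩)
  · rintro ⟨f, hf⟩ ⟨g, hg⟩ h
    simp only [Subtype.mk.injEq] at h ⊢
    exact gr_inj hf.1 hg.1 h
  · rintro ⟨T, hT1, hT2⟩
    obtain ⟨f, hf, rfl⟩ := gr_surj r hT2
    exact ⟨⟨f, hf, (hle f hf).2 hT1⟩, rfl⟩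

/-- the matrix with a one at `(v, f v)` unless `f v = r`. -/
def Nm (r : V) (f : V → V) : Matrix V V ℚ := fun v u => if f v = u ∧ u ≠ r then 1 else 0

lemma Nm_mulVec (r : V) (f : V → V) (x : V → ℚ) (v : V) :
    (Nm r f *ᵥ x) v = if f v = r then 0 else x (f v) := by
  simp only [Matrix.mulVec, dotProduct, Nm]
  rw [Finset.sum_eq_single (f v)]
  · by_cases h : f v = r <;> simp [h]
  · intro b _ hb
    simp [hb.symm]
  · simp

lemma det_bad (r : V) (f : V → V) (hr : f r = r) (h : ¬ Good r f) : (1 - Nm r f).det = 0 := by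
  classical
  obtain ⟨v0, hv0⟩ : ∃ v, ∀ k : ℕ, f^[k] v ≠ r := by
    by_contra hc
    push Not at hc
    exact h ⟨hr, hc⟩
  let x : V → ℚ := fun v => if ∃ k : ℕ, f^[k] v = r then 0 else 1
  rw [← Matrix.exists_mulVec_eq_zero_iff]
  refine ⟨x, ?_, ?_⟩
  · intro hx
    have := congrFun hx v0
    have h2 : ¬ ∃ k : ℕ, f^[k] v0 = r := by push Not; exact hv0
    simp [x, h2] at this
  · funext v
    rw [Matrix.sub_mulVec, Matrix.one_mulVec, Pi.sub_apply, Nm_mulVec]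
    by_cases hfv : f v = r
    · have : ∃ k : ℕ, f^[k] v = r := ⟨1, hfv⟩
      simp [hfv, x, this]
    · have : (∃ k : ℕ, f^[k] v = r) ↔ ∃ k : ℕ, f^[k] (f v) = r := by
        constructor
        · rintro ⟨k, hk⟩
          exact ⟨k, by rw [← Function.iterate_succ_apply, Function.iterate_succ_apply', hk, hr]⟩
        · rintro ⟨k, hk⟩
          exact ⟨k + 1, by rw [Function.iterate_succ_apply, hk]⟩
      simp [hfv, x, this]

lemma det_good (r : V) (f : V → V) (h : Good r f) : (1 - Nm r f).det = 1 := by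
  classical
  obtain ⟨K, hK⟩ : ∃ K : ℕ, ∀ v, f^[K] v = r := by
    choose k hk using h.2
    refine ⟨Finset.univ.sup k, fun v => ?_⟩
    have : k v ≤ Finset.univ.sup k := Finset.le_sup (Finset.mem_univ v)
    obtain ⟨d, hd⟩ := Nat.exists_eq_add_of_le this
    rw [hd, add_comm, Function.iterate_add_apply, hk, iter_root h.1]
  have hpow : ∀ (k : ℕ) (x : V → ℚ) (v : V), x r = 0 →
      ((Nm r f) ^ k *ᵥ x) v = x (f^[k] v) := by
    intro k
    induction k with
    | zero => intro x v hx; simp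
    | succ k ih =>
      intro x v hx
      rw [pow_succ, ← Matrix.mulVec_mulVec, ih, Nm_mulVec, Function.iterate_succ_apply']
      · split_ifs with h1
        · rw [h1, hx]
        · rfl
      · rw [Nm_mulVec, if_pos h.1]
  have hnil : IsNilpotent (Nm r f) := by
    refine ⟨K + 1, ?_⟩
    apply Matrix.mulVec_injective
    funext x
    rw [pow_succ, ← Matrix.mulVec_mulVec]
    funext v
    rw [hpow _ _ _ (by rw [Nm_mulVec, if_pos h.1]), hK, Nm_mulVec, if_pos h.1]
    simp
  have h1 := (Matrix.isNilpotent_charpoly_sub_pow_of_isNilpotent hnil).eq_zero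
  have h2 := congrArg (Polynomial.eval 1) h1
  rw [Polynomial.eval_sub, Matrix.eval_charpoly] at h2
  simp at h2
  linarith

/-- Matrix tree theorem (rooted version). -/
lemma matrix_tree (r : V) (G : SimpleGraph V) [DecidableRel G.Adj] :
    (Nat.card {T : SimpleGraph V // T ≤ G ∧ T.IsTree} : ℚ) =
      (Matrix.of fun v u : V => if v = r then (if u = r then (1 : ℚ) else 0)
        else (if v = u then (G.degree v : ℚ) else 0) -
          (if u ≠ r ∧ G.Adj v u then 1 else 0)).det := by
  classical
  let w : V → V → ℚ := fun v u => if v = r then (if u = r then 1 else 0)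
    else if G.Adj v u then 1 else 0
  let g : V → V → V → ℚ := fun v u x => (if v = x then 1 else 0) - (if u = x ∧ x ≠ r then 1 else 0)
  have hM : (Matrix.of fun v u : V => if v = r then (if u = r then (1 : ℚ) else 0)
        else (if v = u then (G.degree v : ℚ) else 0) -
          (if u ≠ r ∧ G.Adj v u then 1 else 0)) = fun v => ∑ u, w v u • g v u := by
    funext v x
    simp only [Matrix.of_apply, Finset.sum_apply, Pi.smul_apply, smul_eq_mul, w, g]
    by_cases hv : v = r
    · subst hv
      simp [eq_comm]
    · simp only [if_neg hv, mul_sub, Finset.sum_sub_distrib, ← Finset.sum_mul]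
      congr 1
      · rw [Finset.sum_boole, ← SimpleGraph.card_neighborFinset_eq_degree,
          SimpleGraph.neighborFinset_eq_filter]
        split_ifs <;> simp
      · rw [Finset.sum_eq_single x]
        · by_cases hx : x = r <;> simp [hx]
        · intro b _ hb; simp [hb]
        · simp
  rw [hM]
  have h1 : (Matrix.det (fun v => ∑ u, w v u • g v u : Matrix V V ℚ)) =
      ∑ f : V → V, (∏ v, w v (f v)) * (1 - Nm r f).det := by
    have := (Matrix.detRowAlternating (R := ℚ) (n := V)).toMultilinearMap.map_sum
      (fun v u => w v u • g v u)
    refine this.trans (Finset.sum_congr rfl fun f _ => ?_)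
    have h2 := (Matrix.detRowAlternating (R := ℚ) (n := V)).toMultilinearMap.map_smul_univ
      (fun v => w v (f v)) (fun v => g v (f v))
    refine h2.trans ?_
    rw [smul_eq_mul]
    congr 1
  rw [h1, card_trees r G, Nat.card_eq_fintype_card, Fintype.card_subtype, ← Finset.sum_boole]
  refine Finset.sum_congr rfl fun f _ => ?_
  by_cases hr : f r = r
  · by_cases hg : Good r f
    · rw [det_good r f hg, mul_one]
      have : ∀ v, w v (f v) = if (v ≠ r → G.Adj v (f v)) then 1 else 0 := by
        intro v
        by_cases hv : v = r
        · subst hv; simp [w, hr]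
        · simp [w, hv]
      simp only [this, Finset.prod_boole, hg, true_and, Finset.mem_univ, true_imp_iff]
    · rw [det_bad r f hr hg]; simp [hg]
  · have h3 : w r (f r) = 0 := by simp [w, hr]
    rw [Finset.prod_eq_zero (Finset.mem_univ r) h3]
    simp [Good, hr]

lemma detU (d x y : V → ℚ) (hd : ∀ v, d v ≠ 0) :
    (Matrix.of fun v u : V => (if v = u then d v else 0) - x v * x u - y v * y u).det =
      (∏ v, d v) * ((1 - ∑ v, x v * x v / d v) * (1 - ∑ v, y v * y v / d v)
        - (∑ v, x v * y v / d v) ^ 2) := by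
  let A : Matrix V (Fin 2) ℚ := Matrix.of fun v i => (if i = 0 then x v else y v) / d v
  let B : Matrix (Fin 2) V ℚ := Matrix.of fun i v => if i = 0 then x v else y v
  have h : (Matrix.of fun v u : V => (if v = u then d v else 0) - x v * x u - y v * y u) =
      Matrix.diagonal d * (1 - A * B) := by
    ext v u
    rw [Matrix.diagonal_mul, Matrix.sub_apply, Matrix.mul_apply, Fin.sum_univ_two]
    simp only [Matrix.of_apply, A, B, Matrix.one_apply]
    have := hd v
    simp only [if_true, Fin.isValue, one_ne_zero, if_false]
    split_ifs <;> field_simp <;> ring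
  rw [h, Matrix.det_mul, Matrix.det_diagonal, Matrix.det_one_sub_mul_comm, Matrix.det_fin_two]
  congr 1
  simp only [Matrix.sub_apply, Matrix.mul_apply, A, B, Matrix.of_apply, Matrix.one_apply]
  have e : ∑ v, y v * (x v / d v) = ∑ v, x v * y v / d v :=
    Finset.sum_congr rfl fun v _ => by ring
  simp [e, mul_div_assoc]
  ring

lemma card_gt {n : ℕ} (r : Fin n) :
    ((Finset.univ.filter fun v : Fin n => ¬ v < r).filter fun v => ¬ v = r) = Finset.Ioi r := by
  ext v
  simp
  constructor
  · rintro ⟨h1, h2⟩; exact lt_of_le_of_ne h1 (Ne.symm h2)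
  · intro h; exact ⟨h.le, h.ne'⟩

lemma card_eqq {n : ℕ} (r : Fin n) :
    ((Finset.univ.filter fun v : Fin n => ¬ v < r).filter fun v => v = r) = {r} := by
  ext v
  simp
  rintro rfl; exact le_rfl

lemma card_ltt {n : ℕ} (r : Fin n) :
    (Finset.univ.filter fun v : Fin n => v < r) = Finset.Iio r := by
  ext v
  simp

lemma prod3 {n : ℕ} (r : Fin n) (a b c : ℚ) :
    (∏ v : Fin n, if v < r then a else if v = r then b else c) =
      a ^ (r : ℕ) * b * c ^ (n - 1 - (r : ℕ)) := by
  rw [Finset.prod_ite, Finset.prod_ite, card_gt, card_eqq, card_ltt]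
  simp [mul_assoc]

lemma sum3 {n : ℕ} (r : Fin n) (a b c : ℚ) :
    (∑ v : Fin n, if v < r then a else if v = r then b else c) =
      (r : ℕ) * a + b + ((n : ℚ) - 1 - (r : ℕ)) * c := by
  rw [Finset.sum_ite, Finset.sum_ite, card_gt, card_eqq, card_ltt]
  have : ((n - 1 - (r : ℕ) : ℕ) : ℚ) = (n : ℚ) - 1 - (r : ℕ) := by
    have := r.2
    rw [Nat.cast_sub (by omega), Nat.cast_sub (by omega)]; simp
  simp [this]
  ring

/-- The graph of edges allowed for trees uprooted at `r`. -/
def Gr {n : ℕ} (a z r : Fin n) : SimpleGraph (Fin n) where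
  Adj v u := v ≠ u ∧ s(v, u) ≠ s(a, z) ∧ (v = r → u < r) ∧ (u = r → v < r)
  symm := ⟨by
    rintro v u ⟨h1, h2, h3, h4⟩
    exact ⟨h1.symm, by rwa [Sym2.eq_swap], h4, h3⟩⟩
  loopless := ⟨by rintro v ⟨h, _⟩; exact h rfl⟩

instance {n : ℕ} (a z r : Fin n) : DecidableRel (Gr a z r).Adj := fun v u =>
  inferInstanceAs (Decidable (v ≠ u ∧ s(v, u) ≠ s(a, z) ∧ (v = r → u < r) ∧ (u = r → v < r)))

lemma Gr_adj {n : ℕ} (a z r v u : Fin n) : (Gr a z r).Adj v u ↔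
    v ≠ u ∧ s(v, u) ≠ s(a, z) ∧ (v = r → u < r) ∧ (u = r → v < r) := Iff.rfl

lemma degree_sum {n : ℕ} (G : SimpleGraph (Fin n)) [DecidableRel G.Adj] (v : Fin n) :
    (G.degree v : ℚ) = ∑ u, if G.Adj v u then 1 else 0 := by
  rw [Finset.sum_boole, ← SimpleGraph.card_neighborFinset_eq_degree,
          SimpleGraph.neighborFinset_eq_filter]

lemma mid {n : ℕ} (a z r : Fin n) (h1 : a < r) (h2 : r < z) :
    (Nat.card {T : SimpleGraph (Fin n) // T ≤ Gr a z r ∧ T.IsTree} : ℚ) =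
      (n : ℚ) ^ (r : ℕ) * ((n : ℚ) - 1) ^ (n - 1 - (r : ℕ)) *
        ((r : ℕ) * ((n : ℚ) ^ 2 - 3 * n + 1) - 1) / ((n : ℚ) ^ 2 * ((n : ℚ) - 1) ^ 2) := by
  have hn : (3 : ℚ) ≤ n := by
    have : 3 ≤ n := by have := z.2; rw [Fin.lt_def] at h1 h2; omega
    exact_mod_cast this
  have hn0 : (n : ℚ) ≠ 0 := by linarith
  have hn1 : (n : ℚ) - 1 ≠ 0 := by linarith
  have haz : a ≠ z := (h1.trans h2).ne
  have har := h1.ne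
  have hrz := h2.ne
  have hadj : ∀ v u, v ≠ r → (if (Gr a z r).Adj v u then (1 : ℚ) else 0) =
      1 - (if v = u then 1 else 0) - (if r = u then (if r < v then 1 else 0) else 0)
        - (if z = u then (if v = a then 1 else 0) else 0)
        - (if a = u then (if v = z then 1 else 0) else 0) := by
    intro v u hv
    simp only [Gr_adj]
    grind
  have hdeg : ∀ v, v ≠ r → ((Gr a z r).degree v : ℚ) = n - 1 - (if r < v then 1 else 0)
      - (if v = a then 1 else 0) - (if v = z then 1 else 0) := by
    intro v hv
    rw [degree_sum, Finset.sum_congr rfl fun u _ => hadj v u hv]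
    simp [Finset.sum_sub_distrib]
  let d : Fin n → ℚ := fun v => if v < r then (n : ℚ) else if v = r then 1 else (n : ℚ) - 1
  let x : Fin n → ℚ := fun v => if v = r then 0 else 1
  let y : Fin n → ℚ := fun v => (if v = a then 1 else 0) - (if v = z then 1 else 0)
  have hd : ∀ v, d v ≠ 0 := by
    intro v; simp only [d]; split_ifs <;> simp [hn0, hn1]
  rw [matrix_tree r]
  have hM : (Matrix.of fun v u : Fin n => if v = r then (if u = r then (1 : ℚ) else 0)
        else (if v = u then ((Gr a z r).degree v : ℚ) else 0) -
          (if u ≠ r ∧ (Gr a z r).Adj v u then 1 else 0)) =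
      Matrix.of fun v u : Fin n => (if v = u then d v else 0) - x v * x u - y v * y u := by
    ext v u
    simp only [Matrix.of_apply]
    by_cases hv : v = r
    · subst hv
      by_cases hu : u = v
      · subst hu; simp [d, x, y, har.symm, hrz]
      · simp [x, y, har.symm, hrz, hu, Ne.symm hu]
    · rw [hdeg v hv]
      by_cases hu : u = r
      · subst hu
        simp [x, y, har.symm, hrz, hv]
      · simp only [hv, hu, ne_eq, not_false_eq_true, true_and, if_false]
        rw [hadj v u hv]
        simp only [d, x, y, hv, hu, if_false, Ne.symm hu]
        grind
  rw [hM, detU d x y hd]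
  have s0 : ∏ v, d v = (n : ℚ) ^ (r : ℕ) * ((n : ℚ) - 1) ^ (n - 1 - (r : ℕ)) := by
    simp only [d]; rw [prod3]; ring
  have s1 : ∑ v, x v * x v / d v = (r : ℕ) / (n : ℚ) + ((n : ℚ) - 1 - (r : ℕ)) / ((n : ℚ) - 1) := by
    have : ∀ v, x v * x v / d v = if v < r then 1 / (n : ℚ) else if v = r then 0 else 1 / ((n : ℚ) - 1) := by
      intro v
      simp only [x, d]
      split_ifs with p q <;> simp_all
    rw [Finset.sum_congr rfl fun v _ => this v, sum3]; ring
  have da : d a = n := by simp [d, h1]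
  have dz : d z = (n : ℚ) - 1 := by simp [d, h2.not_gt, hrz.symm]
  have s2 : ∑ v, y v * y v / d v = 1 / (n : ℚ) + 1 / ((n : ℚ) - 1) := by
    have : ∀ v, y v * y v / d v = (if v = a then 1 / (n : ℚ) else 0) + (if v = z then 1 / ((n : ℚ) - 1) else 0) := by
      intro v
      by_cases va : v = a
      · subst va; simp [y, da, haz]
      by_cases vz : v = z
      · subst vz; simp [y, dz, haz.symm]
      simp [y, va, vz]
    rw [Finset.sum_congr rfl fun v _ => this v, Finset.sum_add_distrib]; simp
  have s3 : ∑ v, x v * y v / d v = 1 / (n : ℚ) - 1 / ((n : ℚ) - 1) := by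
    have : ∀ v, x v * y v / d v = (if v = a then 1 / (n : ℚ) else 0) - (if v = z then 1 / ((n : ℚ) - 1) else 0) := by
      intro v
      by_cases va : v = a
      · subst va; simp [x, y, da, haz, har]
      by_cases vz : v = z
      · subst vz; simp [x, y, dz, haz.symm, hrz.symm]; ring
      simp [y, va, vz]
    rw [Finset.sum_congr rfl fun v _ => this v, Finset.sum_sub_distrib]; simp
  rw [s0, s1, s2, s3, mul_div_assoc]
  congr 1
  field_simp
  ring

lemma top_root {n : ℕ} (a z : Fin n) (hn3 : 3 ≤ n) (h1 : a < z) (hz : (z : ℕ) = n - 1) :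
    (Nat.card {T : SimpleGraph (Fin n) // T ≤ Gr a z z ∧ T.IsTree} : ℚ) =
      (n : ℚ) ^ (n - 3) * ((n : ℚ) - 2) := by
  have hn : (3 : ℚ) ≤ n := by exact_mod_cast hn3
  have hn0 : (n : ℚ) ≠ 0 := by linarith
  have haz : a ≠ z := h1.ne
  have hlt : ∀ v, v ≠ z → v < z := by
    intro v hv
    rw [Fin.lt_def, hz]; have := v.2
    have : (v : ℕ) ≠ z := fun h => hv (Fin.ext h)
    omega
  have hadj : ∀ v u, v ≠ z → (if (Gr a z z).Adj v u then (1 : ℚ) else 0) =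
      1 - (if v = u then 1 else 0) - (if z = u then (if v = a then 1 else 0) else 0) := by
    intro v u hv
    have := hlt v hv
    simp only [Gr_adj]
    grind
  have hdeg : ∀ v, v ≠ z → ((Gr a z z).degree v : ℚ) = n - 1 - (if v = a then 1 else 0) := by
    intro v hv
    rw [degree_sum, Finset.sum_congr rfl fun u _ => hadj v u hv]
    simp [Finset.sum_sub_distrib]
  let d : Fin n → ℚ := fun v => if v < z then (n : ℚ) else if v = z then 1 else 1
  let x : Fin n → ℚ := fun v => if v = z then 0 else 1
  let y : Fin n → ℚ := fun v => if v = a then 1 else 0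
  have hd : ∀ v, d v ≠ 0 := by
    intro v; simp only [d]; split_ifs <;> simp [hn0]
  rw [matrix_tree z]
  have hM : (Matrix.of fun v u : Fin n => if v = z then (if u = z then (1 : ℚ) else 0)
        else (if v = u then ((Gr a z z).degree v : ℚ) else 0) -
          (if u ≠ z ∧ (Gr a z z).Adj v u then 1 else 0)) =
      Matrix.of fun v u : Fin n => (if v = u then d v else 0) - x v * x u - y v * y u := by
    ext v u
    simp only [Matrix.of_apply]
    by_cases hv : v = z
    · subst hv
      by_cases hu : u = v
      · subst hu; simp [d, x, y, haz.symm]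
      · simp [x, y, haz.symm, hu, Ne.symm hu]
    · rw [hdeg v hv]
      by_cases hu : u = z
      · subst hu
        simp [x, y, haz.symm, hv]
      · simp only [hv, hu, ne_eq, not_false_eq_true, true_and, if_false]
        rw [hadj v u hv]
        simp only [d, x, y, hv, hu, if_false, Ne.symm hu, hlt v hv, if_true]
        grind
  rw [hM, detU d x y hd]
  have s0 : ∏ v, d v = (n : ℚ) ^ (n - 1) := by
    simp only [d]; rw [prod3, hz]; simp
  have s1 : ∑ v, x v * x v / d v = ((n : ℚ) - 1) / (n : ℚ) := by
    have : ∀ v, x v * x v / d v = if v < z then 1 / (n : ℚ) else if v = z then 0 else 0 := by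
      intro v
      by_cases hv : v = z
      · simp [x, hv]
      · simp [x, d, hv, hlt v hv]
    rw [Finset.sum_congr rfl fun v _ => this v, sum3, hz, Nat.cast_sub (by omega)]; simp; ring
  have da : d a = n := by simp [d, h1]
  have s2 : ∑ v, y v * y v / d v = 1 / (n : ℚ) := by
    have : ∀ v, y v * y v / d v = (if v = a then 1 / (n : ℚ) else 0) := by
      intro v
      by_cases va : v = a
      · subst va; simp [y, da]
      simp [y, va]
    rw [Finset.sum_congr rfl fun v _ => this v]; simp
  have s3 : ∑ v, x v * y v / d v = 1 / (n : ℚ) := by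
    have : ∀ v, x v * y v / d v = (if v = a then 1 / (n : ℚ) else 0) := by
      intro v
      by_cases va : v = a
      · subst va; simp [x, y, da, haz]
      simp [y, va]
    rw [Finset.sum_congr rfl fun v _ => this v]; simp
  rw [s0, s1, s2, s3]
  obtain ⟨k, rfl⟩ := Nat.exists_eq_add_of_le hn3
  rw [show 3 + k - 1 = k + 2 by omega, show 3 + k - 3 = k by omega, pow_add, mul_assoc]
  congr 1
  field_simp
  ring

lemma bot_root {n : ℕ} (a z : Fin n) (h1 : a < z) (ha : (a : ℕ) = 0) :
    Nat.card {T : SimpleGraph (Fin n) // T ≤ Gr a z a ∧ T.IsTree} = 0 := by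
  have : IsEmpty {T : SimpleGraph (Fin n) // T ≤ Gr a z a ∧ T.IsTree} := by
    refine ⟨?_⟩
    rintro ⟨T, hle, hT⟩
    obtain ⟨p⟩ := hT.connected.preconnected a z
    cases p with
    | nil => exact lt_irrefl _ h1
    | cons h q =>
      have h2 := (hle h).2.2.1 rfl
      rw [Fin.lt_def] at h2
      omega
  exact Nat.card_of_isEmpty

lemma telescope (k j e : ℕ) (he : k + 1 = j + e) (N M A : ℚ) (hN : N = k + 3) (hM : M = k + 2) :
    ∑ i ∈ Finset.range j, N ^ (i + 1) * M ^ (k + 1 - i) * (((i + 1 : ℕ) : ℚ) * A - 1) =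
      N ^ (j + 1) * M ^ (k + 2 - j) * (A * (j - k - 2) - 1) + N * M ^ (k + 2) * (A * (k + 2) + 1) := by
  induction j generalizing e with
  | zero => simp; ring
  | succ j ih =>
    rw [Finset.sum_range_succ, ih (e + 1) (by omega)]
    rw [show k + 2 - j = e + 2 by omega, show k + 1 - j = e + 1 by omega,
      show k + 2 - (j + 1) = e + 1 by omega]
    have : (k : ℚ) = j + e := by
      have : k = j + e := by omega
      exact_mod_cast this
    subst hN hM
    push_cast
    ring

lemma total (k : ℕ) (a z : Fin (k + 3)) (ha : a = 0) (hz : z = Fin.last _) :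
    (∑ r : Fin (k + 3), Nat.card {T : SimpleGraph (Fin (k + 3)) // T ≤ Gr a z r ∧ T.IsTree}) =
      (k + 2) ^ k * (k + 1) ^ 2 := by
  have haz : a < z := by subst ha hz; exact Fin.last_pos
  have hza : (z : ℕ) = k + 3 - 1 := by subst hz; simp
  have key : (∑ r : Fin (k + 3), (Nat.card {T : SimpleGraph (Fin (k + 3)) // T ≤ Gr a z r ∧ T.IsTree} : ℚ)) =
      ((k : ℚ) + 2) ^ k * ((k : ℚ) + 1) ^ 2 := by
    rw [Fin.sum_univ_succ, Fin.sum_univ_castSucc]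
    have e1 := bot_root a z haz (by subst ha; rfl)
    have e2 := top_root a z (by omega) haz hza
    have e3 : (Fin.last (k + 1)).succ = z := by rw [hz]; rfl
    rw [e3, e2, ← ha, e1]
    let F : ℕ → ℚ := fun i => ((k : ℚ) + 3) ^ (i + 1) * ((k : ℚ) + 2) ^ (k + 1 - i) *
          (((i + 1 : ℕ) : ℚ) * (((k : ℚ) + 3) ^ 2 - 3 * ((k : ℚ) + 3) + 1) - 1) /
            (((k : ℚ) + 3) ^ 2 * ((k : ℚ) + 2) ^ 2)
    have e4 : ∀ i : Fin (k + 1), (Nat.card {T : SimpleGraph (Fin (k + 3)) //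
        T ≤ Gr a z (i.castSucc.succ) ∧ T.IsTree} : ℚ) =
        F i := by
      intro i
      rw [mid a z]
      · simp only [Fin.val_succ, Fin.val_castSucc, F]
        rw [show k + 3 - 1 - ((i : ℕ) + 1) = k + 1 - i by omega]
        push_cast
        rw [show (k : ℚ) + 3 - 1 = k + 2 by ring]
      · subst ha; exact Fin.succ_pos _
      · rw [Fin.lt_def, hza]; have := i.2; simp; omega
    rw [Finset.sum_congr rfl fun i _ => e4 i, Fin.sum_univ_eq_sum_range F (k + 1)]
    simp only [F]
    rw [← Finset.sum_div,
      telescope k (k + 1) 0 rfl _ _ _ rfl rfl]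
    rw [show k + 2 - (k + 1) = 1 by omega, show k + 3 - 3 = k by omega]
    have p1 : (k : ℚ) + 3 ≠ 0 := by positivity
    have p2 : (k : ℚ) + 2 ≠ 0 := by positivity
    push_cast
    field_simp
    ring
  exact_mod_cast key

end UpTree

/-- The total number of uprooted spanning trees of `K_n ∖ {e_{1,n}}` over all roots
equals `(n-1)^(n-3) (n-2)^2`. -/
theorem total_uprooted_spanning_trees_Kn_minus_edge (n : ℕ) (hn : 3 ≤ n) :
    Nat.card {p : SimpleGraph (Fin n) × Fin n //
        p.1 ≤ (⊤ : SimpleGraph (Fin n)).deleteEdges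
              {s((⟨0, by omega⟩ : Fin n), (⟨n - 1, by omega⟩ : Fin n))} ∧
        p.1.IsTree ∧ ∀ w : Fin n, p.1.Adj p.2 w → w < p.2} =
      (n - 1) ^ (n - 3) * (n - 2) ^ 2 := by
  obtain ⟨k, rfl⟩ := Nat.exists_eq_add_of_le' hn
  have h := UpTree.total k ⟨0, by omega⟩ ⟨k + 3 - 1, by omega⟩ rfl rfl
  rw [← Nat.card_sigma] at h
  refine Eq.trans ?_ h
  have hiff : ∀ (a z : Fin (k + 3)) (T : SimpleGraph (Fin (k + 3))) (r : Fin (k + 3)),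
      (T ≤ (⊤ : SimpleGraph (Fin (k + 3))).deleteEdges {s(a, z)} ∧ T.IsTree ∧
        ∀ w, T.Adj r w → w < r) ↔ (T ≤ UpTree.Gr a z r ∧ T.IsTree) := by
    intro a z T r
    constructor
    · rintro ⟨h1, h2, h3⟩
      refine ⟨fun v u hvu => ?_, h2⟩
      have h4 := h1 hvu
      rw [SimpleGraph.deleteEdges_adj] at h4
      refine ⟨hvu.ne, h4.2, ?_, ?_⟩
      · rintro rfl; exact h3 _ hvu
      · rintro rfl; exact h3 _ hvu.symm
    · rintro ⟨h1, h2⟩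
      refine ⟨fun v u hvu => ?_, h2, fun w hw => (h1 hw).2.2.1 rfl⟩
      rw [SimpleGraph.deleteEdges_adj]
      exact ⟨hvu.ne, (h1 hvu).2.1⟩
  exact Nat.card_congr
    { toFun := fun p => ⟨p.1.2, p.1.1, (hiff _ _ _ _).1 p.2⟩
      invFun := fun q => ⟨(q.2.1, q.1), (hiff _ _ _ _).2 q.2.2⟩
      left_inv := fun _ => rfl
      right_inv := fun _ => rfl }
end
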